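/- arXiv:0910.0732 — 3 statements merged into one kernel-verified Lean document; each statement's English description precedes it below -/
import Mathlib

section
/- Let G be a finitely generated group. If G has infinitely many pairwise inequivalent 1-dimensional complex representations with finite-index kernel (i.e., r_1(G) = ∞), then for every n ∈ ℕ, either r_n(G) = 0 or r_n(G) = ∞. -/
open CategoryTheory Module

def repSetoid (G : Type) [Group G] (n : ℕ) :
    Setoid {ρ : FDRep ℂ G // Simple ρ ∧ finrank ℂ ρ = n ∧ ρ.ρ.ker.FiniteIndex} where
  r x y := Nonempty (x.1 ≅ y.1)
  iseqv := ⟨fun _ => ⟨Iso.refl _⟩, fun ⟨e⟩ => ⟨e.symm⟩, fun ⟨e⟩ ⟨f⟩ => ⟨e.trans f⟩⟩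

noncomputable def rCount (G : Type) [Group G] (n : ℕ) : ℕ∞ :=
  ENat.card (Quotient (repSetoid G n))

section twist
variable {C : Type*} [Category C] [Preadditive C] [Linear ℂ C] {G : Type} [Group G]

def twObj (χ : G →* ℂˣ) (X : Action C G) : Action C G where
  V := X.V
  ρ :=
    { toFun := fun g => ((χ g : ℂ) • (X.ρ g : X.V ⟶ X.V) : X.V ⟶ X.V)
      map_one' := by
        rw [map_one, map_one, Units.val_one, one_smul]
      map_mul' := fun g h => by
        rw [map_mul, map_mul, End.mul_def, End.mul_def, Linear.smul_comp, Linear.comp_smul,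
          smul_smul, Units.val_mul, mul_comm] }

theorem twObj_ρ (χ : G →* ℂˣ) (X : Action C G) (g : G) :
    (twObj χ X).ρ g = ((χ g : ℂ) • (X.ρ g : X.V ⟶ X.V) : X.V ⟶ X.V) := rfl

def twF (χ : G →* ℂˣ) : Action C G ⥤ Action C G where
  obj X := twObj χ X
  map {X Y} f := 
    { hom := f.hom
      comm := fun g => by
        have h := f.comm g
        rw [twObj_ρ, twObj_ρ]
        erw [Linear.smul_comp, Linear.comp_smul, h]
        rfl }
  map_id X := rfl
  map_comp f g := rfl

def twE (χ : G →* ℂˣ) : Action C G ≌ Action C G where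
  functor := twF χ
  inverse := twF χ⁻¹
  unitIso := NatIso.ofComponents (fun X => Action.mkIso (Iso.refl X.V) (fun g => by
    change X.ρ g ≫ 𝟙 X.V =
      𝟙 X.V ≫ (((χ⁻¹ g : ℂˣ) : ℂ) • ((χ g : ℂ) • (X.ρ g : X.V ⟶ X.V)) : X.V ⟶ X.V)
    rw [smul_smul]
    simp)) (fun f => by
      ext
      change f.hom ≫ 𝟙 _ = 𝟙 _ ≫ f.hom
      simp)
  counitIso := NatIso.ofComponents (fun X => Action.mkIso (Iso.refl X.V) (fun g => by
    change (((χ g : ℂ) • (((χ⁻¹ g : ℂˣ) : ℂ) • (X.ρ g : X.V ⟶ X.V)) : X.V ⟶ X.V)) ≫ 𝟙 X.V = 𝟙 X.V ≫ X.ρ g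
    rw [smul_smul]
    simp)) (fun f => by
      ext
      change f.hom ≫ 𝟙 _ = 𝟙 _ ≫ f.hom
      simp)
  functor_unitIso_comp X := by
    ext
    change 𝟙 X.V ≫ 𝟙 X.V = 𝟙 X.V
    simp

end twist

variable {G : Type} [Group G]

instance twSimple (χ : G →* ℂˣ) (X : FDRep ℂ G) [Simple X] : Simple (twObj χ X : FDRep ℂ G) := by
  have : (twF χ : FDRep ℂ G ⥤ FDRep ℂ G).IsEquivalence := (twE χ).isEquivalence_functor
  exact simple_obj (twF χ : FDRep ℂ G ⥤ FDRep ℂ G) X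

theorem tw_rho (χ : G →* ℂˣ) (X : FDRep ℂ G) (g : G) :
    FDRep.ρ (twObj χ X : FDRep ℂ G) g = (χ g : ℂ) • (FDRep.ρ X g : X →ₗ[ℂ] X) := rfl

noncomputable def dt (X : FDRep ℂ G) : G →* ℂˣ :=
  MonoidHom.toHomUnits ((LinearMap.det : (X →ₗ[ℂ] X) →* ℂ).comp X.ρ)

theorem dt_apply (X : FDRep ℂ G) (g : G) : (dt X g : ℂ) = LinearMap.det (X.ρ g) := rfl

theorem dt_iso {X Y : FDRep ℂ G} (i : X ≅ Y) : dt X = dt Y := by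
  ext g
  rw [dt_apply, dt_apply, FDRep.Iso.conj_ρ i, LinearEquiv.conj_apply]
  exact (LinearMap.det_conj _ _).symm

theorem dt_tw (χ : G →* ℂˣ) (X : FDRep ℂ G) : dt (twObj χ X) = χ ^ finrank ℂ X * dt X := by
  ext g
  rw [dt_apply, tw_rho]
  exact LinearMap.det_smul _ _

theorem iso_of_dt {X Y : FDRep ℂ G} (hX : finrank ℂ X = 1) (hY : finrank ℂ Y = 1)
    (h : dt X = dt Y) : Nonempty (X ≅ Y) := by
  have key : ∀ (Z : FDRep ℂ G), finrank ℂ Z = 1 → ∀ g, ∀ z : Z, Z.ρ g z = (dt Z g : ℂ) • z := by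
    intro Z hZ g z
    obtain ⟨c, hc, -⟩ := LinearMap.existsUnique_eq_smul_id_of_finrank_eq_one hZ (Z.ρ g)
    have hh : (dt Z g : ℂ) = c := by
      rw [dt_apply, hc, LinearMap.det_smul, hZ, LinearMap.det_id]; simp
    rw [hh, hc]; rfl
  let e : X ≃ₗ[ℂ] Y := LinearEquiv.ofFinrankEq X Y (hX.trans hY.symm)
  refine ⟨Action.mkIso (LinearEquiv.toFGModuleCatIso e) (fun g => ?_)⟩
  ext x
  change e (X.ρ g x) = Y.ρ g (e x)
  rw [key X hX, key Y hY, h, map_smul]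

theorem fin_fib (hfg : Group.FG G) (n : ℕ) (hn : n ≠ 0) (ψ : G →* ℂˣ) :
    {χ : G →* ℂˣ | χ ^ n = ψ}.Finite := by
  obtain ⟨S, hS⟩ := hfg.out
  have hf : (Set.pi Set.univ (fun s : S => {z : ℂˣ | z ^ n = ψ s})).Finite := by
    apply Set.Finite.pi
    intro s
    have : {z : ℂ | z ^ n = ψ s}.Finite := by
      refine ((Polynomial.nthRoots n (ψ s : ℂ)).toFinset.finite_toSet).subset ?_
      intro z hz
      simpa [Polynomial.mem_nthRoots (Nat.pos_of_ne_zero hn)] using hz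
    refine (this.preimage (f := fun z : ℂˣ => (z : ℂ)) (Units.val_injective.injOn)).subset ?_
    intro z hz
    have hz : z ^ n = ψ s := hz
    simp [← hz]
  refine Set.Finite.of_finite_image (f := fun (χ : G →* ℂˣ) (s : S) => χ s) (hf.subset ?_) ?_
  · rintro _ ⟨χ, hχ, rfl⟩ s -
    have hχ : χ ^ n = ψ := hχ
    simp [← hχ]
  · intro χ _ χ' _ hh
    exact MonoidHom.eq_of_eqOn_dense hS (fun s hs => congrFun hh ⟨s, hs⟩)

theorem stmt3 (G : Type) [Group G] (hfg : Group.FG G) (h1 : rCount G 1 = ⊤) :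
    ∀ n : ℕ, rCount G n = 0 ∨ rCount G n = ⊤ := by
  intro n
  by_contra! hcon
  obtain ⟨h0, ht⟩ := hcon
  unfold rCount at *
  rw [Ne, ENat.card_eq_top, not_infinite_iff_finite] at ht
  rw [ENat.card_eq_top] at h1
  rw [Ne, ENat.card_eq_zero_iff_empty, not_isEmpty_iff] at h0
  obtain ⟨q⟩ := h0
  obtain ⟨X, hs, hd, hk⟩ := q.out
  have hn : n ≠ 0 := by
    rintro rfl
    apply id_nonzero X
    have : Subsingleton X := finrank_zero_iff.mp hd
    ext x
    exact Subsingleton.elim (α := X) _ _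
  let d1 : Quotient (repSetoid G 1) → (G →* ℂˣ) := fun a => dt a.out.1
  have hd1 : Function.Injective d1 := by
    intro a b hab
    rw [← a.out_eq, ← b.out_eq]
    exact Quotient.sound (iso_of_dt a.out.2.2.1 b.out.2.2.1 hab)
  have hker : ∀ a, (d1 a).ker.FiniteIndex := by
    intro a
    have := a.out.2.2.2
    refine Subgroup.finiteIndex_of_le (H := a.out.1.ρ.ker) ?_
    intro g hg
    rw [MonoidHom.mem_ker] at hg ⊢
    ext
    change LinearMap.det (a.out.1.ρ g) = 1
    rw [hg, map_one]
  let T : Quotient (repSetoid G 1) → Quotient (repSetoid G n) := fun a =>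
    Quotient.mk _ ⟨twObj (d1 a) X, twSimple _ X, hd, by
      have := hker a
      refine Subgroup.finiteIndex_of_le (H := (d1 a).ker ⊓ X.ρ.ker) ?_
      rintro g ⟨h1, h2⟩
      have h1 : d1 a g = 1 := h1
      have h2 : X.ρ g = 1 := h2
      rw [MonoidHom.mem_ker, tw_rho, h1, h2]
      exact one_smul _ _⟩
  obtain ⟨y, hy⟩ := Finite.exists_infinite_fiber T
  have hinf : (T ⁻¹' {y}).Infinite := Set.infinite_coe_iff.mp hy
  obtain ⟨a, ha⟩ := hinf.nonempty
  refine (hinf.image hd1.injOn) ((fin_fib hfg n hn (d1 a ^ n)).subset ?_)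
  rintro _ ⟨b, hb, rfl⟩
  have hba : T b = T a := Eq.trans hb (Eq.symm ha)
  obtain ⟨i⟩ := Quotient.exact hba
  have h := dt_iso i
  dsimp only at h
  rw [dt_tw, dt_tw, hd] at h
  exact mul_right_cancel h
end

section
/- There exists i₀ ∈ ℕ such that for all i ≥ i₀ and all n ≥ 3·81^i, the symmetric group S_n has at least 2^i irreducible complex characters of the same degree, i.e., m(S_n) ≥ 2^i. -/
open CategoryTheory Module

/-- Isomorphism-equivalence on irreducible `d`-dimensional complex representations of `G`. -/
def irrSetoid (G : Type) [Group G] (d : ℕ) :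
    Setoid {ρ : FDRep ℂ G // Simple ρ ∧ finrank ℂ ρ = d} where
  r x y := Nonempty (x.1 ≅ y.1)
  iseqv := ⟨fun _ => ⟨Iso.refl _⟩, fun ⟨e⟩ => ⟨e.symm⟩, fun ⟨e⟩ ⟨f⟩ => ⟨e.trans f⟩⟩

/-- The number of irreducible complex characters of `G` of degree `d`, i.e. the number of
isomorphism classes of irreducible `d`-dimensional complex representations of `G`. -/
noncomputable def multOfDegree (G : Type) [Group G] (d : ℕ) : ℕ :=
  Nat.card (Quotient (irrSetoid G d))

/-- `m(G)`: the maximal multiplicity of the irreducible complex character degrees of `G`. -/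
noncomputable def maxMult (G : Type) [Group G] : ℕ :=
  sSup (Set.range (multOfDegree G))


/-! ### Part C: virtual characters of norm one -/
section PartC

variable {G : Type} [Group G] [Fintype G]

/-- The set of characters of simple objects. -/
def simpleChars (G : Type) [Group G] : Set (G → ℂ) :=
  {χ | ∃ V : FDRep ℂ G, Simple V ∧ V.character = χ}

theorem rep_char_compl {V : Type} [AddCommGroup V] [Module ℂ V] [FiniteDimensional ℂ V]
    (ρ : Representation ℂ G V) (W W' : Subrepresentation ρ)
    (h : IsCompl W.toSubmodule W'.toSubmodule) :
    ρ.character = W.toRepresentation.character + W'.toRepresentation.character := by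
  funext g
  have h1 := LinearMap.trace_conj' (LinearMap.prodMap (W.toRepresentation g) (W'.toRepresentation g))
    (Submodule.prodEquivOfIsCompl _ _ h)
  rw [LinearMap.trace_prodMap'] at h1
  simp only [Representation.character, Pi.add_apply]
  rw [← h1]
  congr 1
  ext v
  obtain ⟨x, rfl⟩ := (Submodule.prodEquivOfIsCompl _ _ h).surjective v
  simp [LinearEquiv.conj_apply, Subrepresentation.toRepresentation]

theorem simple_of_irreducible {V : Type} [AddCommGroup V] [Module ℂ V] [FiniteDimensional ℂ V]
    (ρ : Representation ℂ G V) (h : ρ.IsIrreducible) : Simple (FDRep.of ρ) := by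
  rw [FDRep.simple_iff_char_is_norm_one]
  have := invertibleOfNonzero (NeZero.ne (Nat.card G : ℂ))
  have h2 := Representation.char_orthonormal ρ ρ
  rw [if_pos ⟨Representation.Equiv.refl ρ⟩] at h2
  have h3 : (Nat.card G : ℂ) ≠ 0 := NeZero.ne _
  rw [inv_mul_eq_one₀ h3] at h2
  exact h2.symm

theorem char_mem_closure (d : ℕ) : ∀ {V : Type} [AddCommGroup V] [Module ℂ V]
    [FiniteDimensional ℂ V] (ρ : Representation ℂ G V), finrank ℂ V = d →
    ρ.character ∈ AddSubgroup.closure (simpleChars G) := by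
  induction d using Nat.strong_induction_on with
  | _ d ih =>
    intro V _ _ _ ρ hd
    by_cases hirr : ρ.IsIrreducible
    · exact AddSubgroup.subset_closure ⟨FDRep.of ρ, simple_of_irreducible ρ hirr, rfl⟩
    · by_cases hV : Subsingleton V
      · have : ρ.character = 0 := by
          funext g
          simp [Representation.character, Subsingleton.elim (ρ g) 0]
        rw [this]; exact zero_mem _
      · rw [not_subsingleton_iff_nontrivial] at hV
        have hnt : Nontrivial (Subrepresentation ρ) := by
          refine ⟨⊥, ⊤, fun h => ?_⟩
          have := congrArg Subrepresentation.toSubmodule h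
          exact bot_ne_top this
        have : ∃ W : Subrepresentation ρ, W ≠ ⊥ ∧ W ≠ ⊤ := by
          by_contra hcon
          push Not at hcon
          exact hirr ⟨fun W => or_iff_not_imp_left.mpr (hcon W)⟩
        obtain ⟨W, hW0, hW1⟩ := this
        have hss : ρ.IsSemisimpleRepresentation := inferInstance
        obtain ⟨W', hc⟩ := hss.exists_isCompl W
        have hc' : IsCompl W.toSubmodule W'.toSubmodule := by
          constructor
          · rw [disjoint_iff]
            exact congrArg Subrepresentation.toSubmodule hc.disjoint.eq_bot
          · rw [codisjoint_iff]
            exact congrArg Subrepresentation.toSubmodule hc.codisjoint.eq_top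
        have hWb : W.toSubmodule ≠ ⊥ := fun h => hW0 (Subrepresentation.toSubmodule_injective h)
        have hWt : W.toSubmodule ≠ ⊤ := fun h => hW1 (Subrepresentation.toSubmodule_injective h)
        have hadd := Submodule.finrank_add_eq_of_isCompl hc'
        have hp : 0 < finrank ℂ W.toSubmodule := by
          rw [Nat.pos_iff_ne_zero]; intro h; exact hWb (Submodule.finrank_eq_zero.mp h)
        have hl : finrank ℂ W.toSubmodule < finrank ℂ V := Submodule.finrank_lt hWt
        rw [rep_char_compl ρ W W' hc']
        exact add_mem (ih _ (by omega) _ rfl) (ih _ (by omega) _ rfl)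

/-- inner product -/
noncomputable def cip (χ ψ : G → ℂ) : ℂ := (Nat.card G : ℂ)⁻¹ * ∑ g : G, χ g * ψ g⁻¹

/-- isomorphism classes of simple objects -/
def simpleSetoid (G : Type) [Group G] : Setoid {V : FDRep ℂ G // Simple V} where
  r x y := Nonempty (x.1 ≅ y.1)
  iseqv := ⟨fun _ => ⟨Iso.refl _⟩, fun ⟨e⟩ => ⟨e.symm⟩, fun ⟨e⟩ ⟨f⟩ => ⟨e.trans f⟩⟩

/-- the character of an isomorphism class -/
noncomputable def qchar (q : Quotient (simpleSetoid G)) : G → ℂ := q.out.1.character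

open Classical in
theorem cip_qchar (q r : Quotient (simpleSetoid G)) :
    cip (qchar q) (qchar r) = if q = r then 1 else 0 := by
  have := invertibleOfNonzero (NeZero.ne (Nat.card G : ℂ))
  have := q.out.2
  have := r.out.2
  have h := FDRep.char_orthonormal q.out.1 r.out.1
  unfold cip qchar
  rw [h]
  have hiff : Nonempty (q.out.1 ≅ r.out.1) ↔ q = r := by
    constructor
    · intro h
      have : (simpleSetoid G).r q.out r.out := h
      have := Quotient.sound (s := simpleSetoid G) this
      simpa using this
    · rintro rfl; exact ⟨Iso.refl _⟩
  simp only [hiff]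

theorem cip_sum_left {ι : Type*} (s : Finset ι) (f : ι → G → ℂ) (ψ : G → ℂ) :
    cip (∑ i ∈ s, f i) ψ = ∑ i ∈ s, cip (f i) ψ := by
  simp only [cip, Finset.sum_apply, Finset.sum_mul]
  rw [Finset.sum_comm, Finset.mul_sum]

theorem cip_sum_right {ι : Type*} (s : Finset ι) (f : ι → G → ℂ) (ψ : G → ℂ) :
    cip ψ (∑ i ∈ s, f i) = ∑ i ∈ s, cip ψ (f i) := by
  simp only [cip, Finset.sum_apply, Finset.mul_sum]
  rw [Finset.sum_comm]

theorem cip_smul_left (a : ℂ) (χ ψ : G → ℂ) : cip (a • χ) ψ = a * cip χ ψ := by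
  simp only [cip, Pi.smul_apply, smul_eq_mul, mul_assoc, ← Finset.mul_sum]
  ring

theorem cip_smul_right (a : ℂ) (χ ψ : G → ℂ) : cip χ (a • ψ) = a * cip χ ψ := by
  simp only [cip, Pi.smul_apply, smul_eq_mul, Finset.mul_sum]
  exact Finset.sum_congr rfl fun _ _ => by ring

theorem qchar_linearIndependent : LinearIndependent ℂ (qchar : Quotient (simpleSetoid G) → G → ℂ) := by
  classical
  rw [linearIndependent_iff']
  intro s c h i hi
  have h2 : cip (∑ i ∈ s, c i • qchar i) (qchar i) = 0 := by
    rw [h]; simp [cip]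
  rw [cip_sum_left] at h2
  simpa [cip_smul_left, cip_qchar, hi] using h2

instance finite_simple : Finite (Quotient (simpleSetoid G)) :=
  (qchar_linearIndependent (G := G)).finite

theorem mem_closure_iff_sum (χ : G → ℂ) (h : χ ∈ AddSubgroup.closure (simpleChars G)) :
    ∃ z : Quotient (simpleSetoid G) → ℤ, χ = ∑ᶠ q, (z q : ℂ) • qchar q := by
  classical
  have := Fintype.ofFinite (Quotient (simpleSetoid G))
  simp only [finsum_eq_sum_of_fintype]
  induction h using AddSubgroup.closure_induction with
  | mem x hx =>
    obtain ⟨V, hV, rfl⟩ := hx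
    let q : Quotient (simpleSetoid G) := Quotient.mk _ ⟨V, hV⟩
    refine ⟨fun r => if r = q then 1 else 0, ?_⟩
    simp only [Int.cast_ite, Int.cast_one, Int.cast_zero, ite_smul, one_smul, zero_smul,
      Finset.sum_ite_eq', Finset.mem_univ, if_true]
    have : (simpleSetoid G).r q.out ⟨V, hV⟩ := Quotient.exact (s := simpleSetoid G) (by simp [q])
    obtain ⟨e⟩ := this
    exact (FDRep.char_iso e).symm
  | zero => exact ⟨0, by simp⟩
  | add x y _ _ hx hy =>
    obtain ⟨z, rfl⟩ := hx
    obtain ⟨w, rfl⟩ := hy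
    exact ⟨z + w, by simp [add_smul, Finset.sum_add_distrib]⟩
  | neg x _ hx =>
    obtain ⟨z, rfl⟩ := hx
    exact ⟨-z, by simp⟩

theorem exists_simple_of_norm_one (χ : G → ℂ) (h : χ ∈ AddSubgroup.closure (simpleChars G))
    (hn : cip χ χ = 1) (d : ℕ) (hd : χ 1 = d) : ∃ V : FDRep ℂ G, Simple V ∧ V.character = χ := by
  classical
  have := Fintype.ofFinite (Quotient (simpleSetoid G))
  obtain ⟨z, hz⟩ := mem_closure_iff_sum χ h
  rw [finsum_eq_sum_of_fintype] at hz
  have h1 : cip χ χ = ∑ q, (z q : ℂ) * z q := by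
    rw [hz, cip_sum_left]
    refine Finset.sum_congr rfl fun q _ => ?_
    rw [cip_sum_right]
    simp [cip_smul_left, cip_smul_right, cip_qchar]
  rw [hn] at h1
  have h2 : ∑ q, z q * z q = 1 := by exact_mod_cast h1.symm
  have hne : ∃ q, z q ≠ 0 := by
    by_contra hcon
    push Not at hcon
    simp [hcon] at h2
  obtain ⟨q, hq⟩ := hne
  rw [← Finset.add_sum_erase _ _ (Finset.mem_univ q)] at h2
  have hnn : 0 ≤ ∑ r ∈ Finset.univ.erase q, z r * z r :=
    Finset.sum_nonneg fun r _ => mul_self_nonneg _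
  have hq1 : 1 ≤ z q * z q := by
    have : 0 < z q * z q := mul_self_pos.mpr hq
    omega
  have h0 : ∑ r ∈ Finset.univ.erase q, z r * z r = 0 := by omega
  have hqq : z q * z q = 1 := by omega
  have hz0 : ∀ r, r ≠ q → z r = 0 := by
    intro r hr
    have := (Finset.sum_eq_zero_iff_of_nonneg (fun r _ => mul_self_nonneg (z r))).mp h0 r (by simp [hr])
    simpa using this
  have hchi : χ = (z q : ℂ) • qchar q := by
    rw [hz]
    refine Finset.sum_eq_single q (fun r _ hr => by simp [hz0 r hr]) (by simp)
  rcases mul_self_eq_one_iff.mp hqq with h1 | h1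
  · refine ⟨q.out.1, q.out.2, ?_⟩
    rw [hchi, h1]; simp [qchar]
  · exfalso
    have hsimp := q.out.2
    have e : (d : ℂ) = -(finrank ℂ q.out.1 : ℂ) := by
      rw [← hd, hchi, h1]; simp [qchar, FDRep.char_one]
    have e2 : ((d + finrank ℂ q.out.1 : ℕ) : ℂ) = 0 := by push_cast; rw [e]; ring
    have e3 : d + finrank ℂ q.out.1 = 0 := by exact_mod_cast e2
    have e4 : finrank ℂ q.out.1 = 0 := by omega
    have e5 : Subsingleton q.out.1 := Module.finrank_zero_iff.mp e4
    have e6 : qchar q = 0 := by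
      funext g
      simp only [qchar, FDRep.character, Pi.zero_apply]
      rw [Subsingleton.elim (q.out.1.ρ g) 0]; simp
    have := cip_qchar q q
    rw [e6] at this
    simp [cip] at this

theorem maxMult_ge (d N : ℕ) (V : Fin N → FDRep ℂ G) (hs : ∀ i, Simple (V i))
    (hd : ∀ i, finrank ℂ (V i) = d) (hinj : ∀ i j, (V i).character = (V j).character → i = j) :
    N ≤ maxMult G := by
  let emb : (d : ℕ) → Quotient (irrSetoid G d) → Quotient (simpleSetoid G) := fun d =>
    Quotient.lift (fun x => Quotient.mk _ ⟨x.1, x.2.1⟩) (fun a b h => Quotient.sound h)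
  have hemb : ∀ d, Function.Injective (emb d) := by
    intro d x y
    induction x using Quotient.inductionOn
    induction y using Quotient.inductionOn
    intro h
    exact Quotient.sound (Quotient.exact (s := simpleSetoid G) h)
  have hfin : ∀ d, Finite (Quotient (irrSetoid G d)) := fun d => Finite.of_injective _ (hemb d)
  have hb : BddAbove (Set.range (multOfDegree G)) := by
    refine ⟨Nat.card (Quotient (simpleSetoid G)), ?_⟩
    rintro _ ⟨d, rfl⟩
    exact Nat.card_le_card_of_injective _ (hemb d)
  refine le_trans ?_ (le_csSup hb ⟨d, rfl⟩)
  have := hfin d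
  have := Nat.card_le_card_of_injective
    (fun i : Fin N => (Quotient.mk (irrSetoid G d) ⟨V i, hs i, hd i⟩)) (by
      intro i j h
      obtain ⟨e⟩ := Quotient.exact h
      exact hinj i j (FDRep.char_iso e))
  simpa [multOfDegree] using this

end PartC

/-! ### Part B: the characters of the symmetric group -/
section PartB

open Finset

/-- number of occurrences of a value -/
def cnt {n : ℕ} {A : Type} [DecidableEq A] (h : Fin n → A) (a : A) : ℕ :=
  Fintype.card {x // h x = a}

theorem cnt_sum {n : ℕ} {A : Type} [DecidableEq A] [Fintype A] (h : Fin n → A) :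
    ∑ a, cnt h a = n := by
  have := Fintype.card_congr (Equiv.sigmaFiberEquiv h)
  rw [Fintype.card_sigma] at this
  simpa [cnt] using this

theorem exists_cnt {n : ℕ} {A : Type} [DecidableEq A] [Fintype A] (c : A → ℕ)
    (hc : ∑ a, c a = n) : ∃ h : Fin n → A, ∀ a, cnt h a = c a := by
  have e : Fin n ≃ Σ a, Fin (c a) := Fintype.equivOfCardEq (by simp [hc])
  refine ⟨fun x => (e x).1, fun a => ?_⟩
  have e2 : {x // (e x).1 = a} ≃ Fin (c a) :=
    (e.subtypeEquiv (q := fun y => y.1 = a) (fun x => Iff.rfl)).trans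
      (Equiv.sigmaSubtype a)
  simp [cnt, Fintype.card_congr e2]

theorem exists_perm {n : ℕ} {A : Type} [DecidableEq A] (h h' : Fin n → A)
    (hc : ∀ a, cnt h a = cnt h' a) : ∃ σ : Equiv.Perm (Fin n), h' ∘ σ = h := by
  have e : ∀ a, {x // h x = a} ≃ {x // h' x = a} := fun a => Fintype.equivOfCardEq (hc a)
  refine ⟨((Equiv.sigmaFiberEquiv h).symm.trans (Equiv.sigmaCongrRight e)).trans
    (Equiv.sigmaFiberEquiv h'), ?_⟩
  funext x
  exact (e (h x) ⟨x, rfl⟩).2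

theorem stab_card {n : ℕ} {A : Type} [DecidableEq A] [Fintype A] (h : Fin n → A) :
    #{σ : Equiv.Perm (Fin n) | h ∘ σ = h} = ∏ a, (cnt h a).factorial := by
  rw [← Fintype.card_subtype]
  exact DomMulAct.stabilizer_card h

theorem mult_count {n : ℕ} {A : Type} [DecidableEq A] [Fintype A] (c : A → ℕ)
    (hc : ∑ a, c a = n) :
    #{h : Fin n → A | ∀ a, cnt h a = c a} * ∏ a, (c a).factorial = n.factorial := by
  obtain ⟨h0, hh0⟩ := exists_cnt c hc
  have h1 : n.factorial = #(univ : Finset (Equiv.Perm (Fin n))) := by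
    simp [Fintype.card_perm]
  rw [h1]
  have hcomp : ∀ (h : Fin n → A) (σ : Equiv.Perm (Fin n)) a, cnt (h ∘ σ) a = cnt h a := by
    intro h σ a
    exact Fintype.card_congr (σ.subtypeEquiv (fun x => Iff.rfl))
  rw [card_eq_sum_card_fiberwise (f := fun σ : Equiv.Perm (Fin n) => h0 ∘ σ)
    (t := ({h : Fin n → A | ∀ a, cnt h a = c a} : Finset _)) (by
      intro σ _
      simp only [mem_coe, mem_filter, mem_univ, true_and]
      intro a; rw [hcomp, hh0])]
  rw [← smul_eq_mul, ← sum_const]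
  refine sum_congr rfl fun h hh => ?_
  simp only [mem_filter, mem_univ, true_and] at hh
  obtain ⟨τ, hτ⟩ := exists_perm h h0 (fun a => by rw [hh, hh0])
  have : #{σ : Equiv.Perm (Fin n) | h0 ∘ σ = h} = #{σ : Equiv.Perm (Fin n) | h ∘ σ = h} := by
    refine card_equiv (Equiv.mulLeft τ⁻¹) fun σ => ?_
    simp only [mem_filter, mem_univ, true_and, Equiv.coe_mulLeft]
    rw [← hτ]
    have h3 : (h0 ∘ τ) ∘ (τ⁻¹ * σ : Equiv.Perm (Fin n)) = h0 ∘ σ := by funext x; simp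
    rw [h3]
  rw [this, stab_card]
  exact prod_congr rfl fun a _ => by rw [hh]

theorem burnside_count {n : ℕ} {A : Type} [DecidableEq A] [Fintype A] (P : (A → ℕ) → Prop)
    [DecidablePred P] (B : Finset (A → ℕ)) (hB : ∀ c, c ∈ B ↔ ∑ a, c a = n ∧ P c) :
    ∑ σ : Equiv.Perm (Fin n), #{h : Fin n → A | P (cnt h) ∧ h ∘ σ = h} = n.factorial * #B := by
  have h1 : ∀ σ : Equiv.Perm (Fin n), #{h : Fin n → A | P (cnt h) ∧ h ∘ σ = h} =
      ∑ h : Fin n → A, if P (cnt h) then (if h ∘ σ = h then 1 else 0) else 0 := by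
    intro σ
    rw [card_filter]
    refine sum_congr rfl fun h _ => ?_
    by_cases h1 : P (cnt h) <;> simp [h1]
  simp_rw [h1]
  rw [sum_comm]
  have h2 : ∀ h : Fin n → A, (∑ σ : Equiv.Perm (Fin n),
      if P (cnt h) then (if h ∘ σ = h then 1 else 0) else 0) =
      if P (cnt h) then ∏ a, (cnt h a).factorial else 0 := by
    intro h
    split_ifs with hp
    · rw [← stab_card, card_filter]
    · simp
  simp_rw [h2]
  rw [← sum_filter]
  rw [← sum_fiberwise_of_maps_to (g := fun h : Fin n → A => cnt h) (t := B) (by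
    intro h hh
    simp only [mem_filter, mem_univ, true_and] at hh
    exact (hB _).2 ⟨cnt_sum h, hh⟩)]
  rw [mul_comm, ← smul_eq_mul, ← sum_const]
  refine sum_congr rfl fun c hc => ?_
  obtain ⟨hc1, hc2⟩ := (hB c).1 hc
  rw [← mult_count c hc1, ← smul_eq_mul, ← sum_const, filter_filter]
  have : ({h : Fin n → A | P (cnt h) ∧ cnt h = c} : Finset _) =
      ({h : Fin n → A | ∀ a, cnt h a = c a} : Finset _) := by
    ext h
    simp only [mem_filter, mem_univ, true_and]
    constructor
    · rintro ⟨_, rfl⟩ a; rfl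
    · intro hh
      have : cnt h = c := funext hh
      exact ⟨by rw [this]; exact hc2, this⟩
  rw [this]
  refine sum_congr rfl fun h hh => ?_
  simp only [mem_filter, mem_univ, true_and] at hh
  exact prod_congr rfl fun a _ => by rw [hh]

end PartB
/-! ### The Cauchy determinant and the power series computation -/
section Cauchy

open Finset

theorem cauchy_field {K : Type} [Field K] {M : ℕ} (x y : Fin M → K) (hy0 : ∀ i, y i ≠ 0)
    (hyi : Function.Injective y) :
    (Matrix.of fun i j => ∏ k ∈ univ.erase j, (1 - x i * y k)).det =
      (Matrix.vandermonde x).det * (Matrix.vandermonde y).det := by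
  let p : Fin M → Polynomial K := fun j => ∏ k ∈ univ.erase j, (1 - Polynomial.C (y k) * Polynomial.X)
  let E : Matrix (Fin M) (Fin M) K := Matrix.of fun m j => (p j).coeff m
  have hdeg : ∀ j, (p j).natDegree < M := by
    intro j
    have h1 : (p j).natDegree ≤ ∑ k ∈ univ.erase j, 1 := by
      refine (Polynomial.natDegree_prod_le _ _).trans (sum_le_sum fun k _ => ?_)
      compute_degree
    have h2 : 0 < M := j.pos
    simp at h1
    omega
  have hev : ∀ z : Fin M → K, (Matrix.of fun i j => ∏ k ∈ univ.erase j, (1 - z i * y k)) =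
      Matrix.vandermonde z * E := by
    intro z
    ext i j
    rw [Matrix.mul_apply]
    simp only [Matrix.of_apply, Matrix.vandermonde_apply, E]
    have : ∏ k ∈ univ.erase j, (1 - z i * y k) = (p j).eval (z i) := by
      simp only [p, Polynomial.eval_prod]
      refine prod_congr rfl fun k _ => ?_
      rw [Polynomial.eval_sub, Polynomial.eval_one, Polynomial.eval_mul, Polynomial.eval_C,
        Polynomial.eval_X, mul_comm]
    rw [this, Polynomial.eval_eq_sum_range' (hdeg j), ← Fin.sum_univ_eq_sum_range
      (fun m => (p j).coeff m * z i ^ m)]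
    exact sum_congr rfl fun m _ => mul_comm _ _
  rw [hev, Matrix.det_mul]
  congr 1
  have hV : (Matrix.vandermonde fun i => (y i)⁻¹).det ≠ 0 := by
    rw [Matrix.det_vandermonde_ne_zero_iff]
    intro a b hab
    exact hyi (inv_injective hab)
  have h3 : (Matrix.vandermonde fun i => (y i)⁻¹).det * E.det =
      ∏ i, ∏ k ∈ univ.erase i, (1 - (y i)⁻¹ * y k) := by
    rw [← Matrix.det_mul, ← hev]
    have : (Matrix.of fun i j => ∏ k ∈ univ.erase j, (1 - (y i)⁻¹ * y k)) =
      Matrix.diagonal fun i => ∏ k ∈ univ.erase i, (1 - (y i)⁻¹ * y k) := by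
      ext i j
      rw [Matrix.diagonal_apply]
      split_ifs with hij
      · subst hij; rfl
      · simp only [Matrix.of_apply]
        refine prod_eq_zero (i := i) (by simp [hij]) ?_
        rw [inv_mul_cancel₀ (hy0 i), sub_self]
    rw [this, Matrix.det_diagonal]
  apply mul_left_cancel₀ hV
  rw [h3, Matrix.det_vandermonde, Matrix.det_vandermonde]
  have hsplit : ∀ i : Fin M, univ.erase i = Ioi i ∪ Iio i := by
    intro i; ext k
    simp only [mem_erase, mem_univ, and_true, mem_union, mem_Ioi, mem_Iio]
    rw [or_comm, lt_or_lt_iff_ne]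
  have hdis : ∀ i : Fin M, Disjoint (Ioi i) (Iio i) := by
    intro i; rw [disjoint_left]; intro k; simp; intro h; exact h.le
  simp_rw [hsplit, prod_union (hdis _), prod_mul_distrib]
  have hswap : ∏ i : Fin M, ∏ k ∈ Iio i, (1 - (y i)⁻¹ * y k) =
      ∏ i : Fin M, ∏ k ∈ Ioi i, (1 - (y k)⁻¹ * y i) := by
    refine prod_comm' ?_
    intro a b; simp
  rw [hswap, ← prod_mul_distrib, ← prod_mul_distrib]
  refine prod_congr rfl fun i _ => ?_
  rw [← prod_mul_distrib, ← prod_mul_distrib]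
  refine prod_congr rfl fun k _ => ?_
  have := hy0 i
  have := hy0 k
  field_simp

/-- geometric series in a monomial -/
noncomputable def geo {s : Type} (u : s →₀ ℕ) : MvPowerSeries s ℤ :=
  open Classical in fun e => if ∃ c : ℕ, e = c • u then 1 else 0

theorem coeff_geo {s : Type} (u e : s →₀ ℕ) [Decidable (∃ c : ℕ, e = c • u)] :
    MvPowerSeries.coeff e (geo u) = if ∃ c : ℕ, e = c • u then 1 else 0 := by
  show geo u e = _
  unfold geo
  congr

theorem geo_mul {s : Type} (u : s →₀ ℕ) (hu : u ≠ 0) :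
    geo u * (1 - MvPowerSeries.monomial u 1) = 1 := by
  classical
  obtain ⟨a, ha⟩ : ∃ a, u a ≠ 0 := by
    by_contra h; push Not at h; exact hu (Finsupp.ext h)
  rw [mul_comm]
  ext e
  rw [sub_mul, one_mul, map_sub, MvPowerSeries.coeff_monomial_mul, coeff_geo, MvPowerSeries.coeff_one,
    coeff_geo, one_mul]
  by_cases h0 : e = 0
  · subst h0
    have h1 : ¬ u ≤ 0 := fun h => hu (le_antisymm h (zero_le))
    have h2 : ∃ c : ℕ, (0 : s →₀ ℕ) = c • u := ⟨0, by simp⟩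
    simp [h1, h2]
  · by_cases hle : u ≤ e
    · have : (∃ c : ℕ, e - u = c • u) ↔ ∃ c : ℕ, e = c • u := by
        constructor
        · rintro ⟨c, hc⟩
          refine ⟨c + 1, ?_⟩
          rw [add_smul, ← hc, one_smul, tsub_add_cancel_of_le hle]
        · rintro ⟨c, hc⟩
          cases c with
          | zero => exact absurd (by simpa using hc) h0
          | succ c => exact ⟨c, by rw [hc, add_smul, one_smul, add_tsub_cancel_right]⟩
      simp [hle, this, h0]
    · have : ¬ ∃ c : ℕ, e = c • u := by
        rintro ⟨c, hc⟩
        cases c with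
        | zero => exact absurd (by simpa using hc) h0
        | succ c => exact hle (by rw [hc, add_smul, one_smul]; exact le_add_of_nonneg_left zero_le)
      simp [hle, this, h0]

theorem coeff_prod_geo {s ι : Type} [Fintype ι] (u : ι → s →₀ ℕ) (hu : ∀ t, u t ≠ 0)
    (m e : s →₀ ℕ) (B : Finset (ι → ℕ)) (hB : ∀ c, c ∈ B ↔ ∑ t, c t • u t + m = e) :
    MvPowerSeries.coeff e (MvPowerSeries.monomial m (1 : ℤ) * ∏ t, geo (u t)) = #B := by
  classical
  rw [MvPowerSeries.coeff_monomial_mul, one_mul]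
  split_ifs with hme
  · rw [MvPowerSeries.coeff_prod]
    have hl : ∀ l : ι →₀ s →₀ ℕ, ∏ t, MvPowerSeries.coeff (l t) (geo (u t)) =
        if (∀ t, ∃ c : ℕ, l t = c • u t) then (1 : ℤ) else 0 := by
      intro l
      simp_rw [coeff_geo, prod_boole]
      congr 1
      simp
    rw [sum_congr rfl fun l _ => hl l, sum_boole]
    congr 1
    symm
    refine card_bij (fun c _ => Finsupp.equivFunOnFinite.symm (fun t => c t • u t)) ?_ ?_ ?_
    · intro c hc
      rw [hB] at hc
      simp only [mem_filter, mem_finsuppAntidiag, subset_univ, and_true]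
      refine ⟨?_, fun t => ⟨c t, by simp⟩⟩
      rw [← hc, add_tsub_cancel_right]
      simp
    · intro c _ c' _ h
      have h2 := Finsupp.equivFunOnFinite.symm.injective h
      funext t
      obtain ⟨a, ha⟩ : ∃ a, u t a ≠ 0 := by
        by_contra h; push Not at h; exact hu t (Finsupp.ext h)
      have h3 := DFunLike.congr_fun (congrFun h2 t) a
      simp only [Finsupp.smul_apply, smul_eq_mul] at h3
      exact Nat.eq_of_mul_eq_mul_right (Nat.pos_of_ne_zero ha) h3
    · intro f hf
      simp only [mem_filter, mem_finsuppAntidiag, subset_univ, and_true] at hf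
      obtain ⟨h1, h2⟩ := hf
      choose c hc using h2
      refine ⟨c, ?_, ?_⟩
      · rw [hB]
        simp_rw [← hc]
        rw [h1, tsub_add_cancel_of_le hme]
      · ext t a
        simp [hc t]
  · have : B = ∅ := by
      rw [eq_empty_iff_forall_notMem]
      intro c hc
      rw [hB] at hc
      exact hme (by rw [← hc]; exact le_add_of_nonneg_left zero_le)
    simp [this]

end Cauchy
section Cauchy2

open Finset

/-- variables -/
noncomputable def uu {M : ℕ} (t : Fin M × Fin M) : (Fin M ⊕ Fin M) →₀ ℕ :=
  Finsupp.single (Sum.inl t.1) 1 + Finsupp.single (Sum.inr t.2) 1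

theorem uu_ne {M : ℕ} (t : Fin M × Fin M) : uu t ≠ 0 := by
  intro h
  have := DFunLike.congr_fun h (Sum.inl t.1)
  simp [uu] at this

/-- exponent vector -/
noncomputable def ee {M : ℕ} (a b : Fin M → ℕ) : (Fin M ⊕ Fin M) →₀ ℕ :=
  Finsupp.equivFunOnFinite.symm (Sum.elim a b)

theorem cauchy_dom {R K : Type} [CommRing R] [Field K] (φ : R →+* K) (hφ : Function.Injective φ)
    {M : ℕ} (x y : Fin M → R) (hy0 : ∀ i, y i ≠ 0) (hyinj : Function.Injective y) :
    (Matrix.of fun i j : Fin M => ∏ k ∈ univ.erase j, (1 - x i * y k)).det =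
      (Matrix.vandermonde x).det * (Matrix.vandermonde y).det := by
  apply hφ
  have := cauchy_field (fun i => φ (x i)) (fun i => φ (y i))
    (fun i => by rw [Ne, map_eq_zero_iff φ hφ]; exact hy0 i) (hφ.comp hyinj)
  have h1 : φ.mapMatrix (Matrix.of fun i j : Fin M => ∏ k ∈ univ.erase j, (1 - x i * y k)) =
      (Matrix.of fun i j : Fin M => ∏ k ∈ univ.erase j, (1 - φ (x i) * φ (y k))) := by
    ext i j; simp
  have h2 : ∀ z : Fin M → R, φ.mapMatrix (Matrix.vandermonde z) =
      Matrix.vandermonde (fun i => φ (z i)) := by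
    intro z; ext i j; simp [Matrix.vandermonde_apply]
  rw [map_mul, RingHom.map_det, RingHom.map_det, RingHom.map_det, h1, h2, h2, this]

theorem cauchy_geo (M : ℕ) :
    (Matrix.vandermonde fun i : Fin M => (MvPowerSeries.X (Sum.inl i) : MvPowerSeries (Fin M ⊕ Fin M) ℤ)).det *
    (Matrix.vandermonde fun i : Fin M => (MvPowerSeries.X (Sum.inr i) : MvPowerSeries (Fin M ⊕ Fin M) ℤ)).det *
    ∏ t : Fin M × Fin M, geo (uu t) = (Matrix.of fun i j : Fin M => geo (uu (i, j))).det := by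
  let R := MvPowerSeries (Fin M ⊕ Fin M) ℤ
  have : IsDomain R := NoZeroDivisors.to_isDomain _
  let x : Fin M → R := fun i => MvPowerSeries.X (Sum.inl i)
  let y : Fin M → R := fun i => MvPowerSeries.X (Sum.inr i)
  have hxy : ∀ i j, MvPowerSeries.monomial (uu (i, j)) (1 : ℤ) = x i * y j := by
    intro i j
    simp only [x, y, uu, MvPowerSeries.X]
    rw [MvPowerSeries.monomial_mul_monomial, one_mul]
  have hg : ∀ i j, geo (uu (i, j)) * (1 - x i * y j) = 1 := by
    intro i j
    rw [← hxy, geo_mul _ (uu_ne _)]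
  have h1 : (Matrix.of fun i j : Fin M => ∏ k ∈ univ.erase j, (1 - x i * y k)).det =
      (Matrix.vandermonde x).det * (Matrix.vandermonde y).det := by
    have hyinj : Function.Injective y := by
      intro a b hab
      have := MvPowerSeries.X_inj.1 hab
      simpa using this
    have hy0 : ∀ i, y i ≠ 0 := by
      intro i h
      have := congrArg (MvPowerSeries.coeff (Finsupp.single (Sum.inr i) 1)) h
      simp [y] at this
    exact cauchy_dom (algebraMap R (FractionRing R)) (IsFractionRing.injective R _) x y hy0 hyinj
  change (Matrix.vandermonde x).det * (Matrix.vandermonde y).det * _ = _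
  rw [← h1]
  have h2 : (Matrix.of fun i j : Fin M => ∏ k ∈ univ.erase j, (1 - x i * y k)) =
      Matrix.of fun i j => (∏ k, (1 - x i * y k)) * (Matrix.of fun i j : Fin M => geo (uu (i, j))) i j := by
    ext1 i j
    simp only [Matrix.of_apply]
    rw [← mul_prod_erase univ _ (mem_univ j)]
    linear_combination (-(∏ k ∈ univ.erase j, (1 - x i * y k))) * hg i j
  rw [h2, Matrix.det_mul_column, ← prod_product', univ_product_univ, mul_right_comm, ← prod_mul_distrib]
  rw [prod_eq_one, one_mul]
  rintro ⟨i, j⟩ _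
  rw [mul_comm, hg]

theorem vand_expand {R : Type} [CommRing R] {M : ℕ} (x : Fin M → R) : (Matrix.vandermonde x).det =
    ∑ w : Equiv.Perm (Fin M), ((Equiv.Perm.sign w : ℤ) : R) * ∏ i, x i ^ (w i : ℕ) := by
  rw [← Matrix.det_transpose, Matrix.det_apply']
  simp [Matrix.vandermonde_apply]

theorem prod_X_eq {M : ℕ} (a b : Fin M → ℕ) :
    (∏ i, (MvPowerSeries.X (Sum.inl i) : MvPowerSeries (Fin M ⊕ Fin M) ℤ) ^ a i) *
    (∏ i, (MvPowerSeries.X (Sum.inr i) : MvPowerSeries (Fin M ⊕ Fin M) ℤ) ^ b i) =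
    MvPowerSeries.monomial (ee a b) 1 := by
  simp_rw [MvPowerSeries.X_pow_eq]
  have h : ∀ (f : Fin M → (Fin M ⊕ Fin M) →₀ ℕ),
      ∏ i, MvPowerSeries.monomial (f i) (1 : ℤ) = MvPowerSeries.monomial (∑ i, f i) 1 := by
    intro f
    have := MvPowerSeries.prod_monomial (R := ℤ) (s := univ) f (fun _ => 1)
    simpa using this
  rw [h, h, MvPowerSeries.monomial_mul_monomial, one_mul]
  congr 2
  ext k
  rcases k with k | k
  · simp [ee, Finsupp.single_apply]
  · simp [ee, Finsupp.single_apply]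

theorem ee_apply_inl {M : ℕ} (a b : Fin M → ℕ) (i : Fin M) : ee a b (Sum.inl i) = a i := rfl
theorem ee_apply_inr {M : ℕ} (a b : Fin M → ℕ) (i : Fin M) : ee a b (Sum.inr i) = b i := rfl

theorem cauchy_count {M : ℕ} (l l' : Fin M → ℕ) (hl : StrictMono l) (hl' : StrictMono l')
    (B : Equiv.Perm (Fin M) → Equiv.Perm (Fin M) → Finset (Fin M × Fin M → ℕ))
    (hB : ∀ w w' c, c ∈ B w w' ↔ (∀ i, ∑ j, c (i, j) + w i = l i) ∧
      (∀ j, ∑ i, c (i, j) + w' j = l' j)) :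
    ∑ w : Equiv.Perm (Fin M), ∑ w' : Equiv.Perm (Fin M),
      (Equiv.Perm.sign w : ℤ) * (Equiv.Perm.sign w' : ℤ) * (#(B w w') : ℤ) =
      if l = l' then 1 else 0 := by
  classical
  have key := congrArg (MvPowerSeries.coeff (ee l l')) (cauchy_geo M)
  rw [vand_expand, vand_expand, sum_mul_sum, sum_mul, map_sum] at key
  have hL : ∀ w : Equiv.Perm (Fin M), MvPowerSeries.coeff (ee l l')
      ((∑ w' : Equiv.Perm (Fin M), (((Equiv.Perm.sign w : ℤ) : MvPowerSeries (Fin M ⊕ Fin M) ℤ) *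
        ∏ i, MvPowerSeries.X (Sum.inl i) ^ (w i : ℕ)) *
        (((Equiv.Perm.sign w' : ℤ) : MvPowerSeries (Fin M ⊕ Fin M) ℤ) *
        ∏ i, MvPowerSeries.X (Sum.inr i) ^ (w' i : ℕ))) * ∏ t : Fin M × Fin M, geo (uu t)) =
      ∑ w' : Equiv.Perm (Fin M),
      (Equiv.Perm.sign w : ℤ) * (Equiv.Perm.sign w' : ℤ) * (#(B w w') : ℤ) := by
    intro w
    rw [sum_mul, map_sum]
    refine sum_congr rfl fun w' _ => ?_
    rw [mul_mul_mul_comm, prod_X_eq, ← Int.cast_mul, mul_assoc, ← zsmul_eq_mul, map_zsmul, smul_eq_mul]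
    congr 1
    refine coeff_prod_geo uu uu_ne _ _ _ fun c => ?_
    rw [hB]
    have h1 : ∀ i, (∑ t, c t • uu t) (Sum.inl i) = ∑ j, c (i, j) := by
      intro i
      simp [Finsupp.finsetSum_apply, uu, Finsupp.single_apply, Fintype.sum_prod_type]
    have h2 : ∀ j, (∑ t, c t • uu t) (Sum.inr j) = ∑ i, c (i, j) := by
      intro i
      simp [Finsupp.finsetSum_apply, uu, Finsupp.single_apply, Fintype.sum_prod_type]
    constructor
    · rintro ⟨ha, hb⟩
      ext k
      rcases k with k | k
      · rw [Finsupp.add_apply, h1, ee_apply_inl, ee_apply_inl, ha]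
      · rw [Finsupp.add_apply, h2, ee_apply_inr, ee_apply_inr, hb]
    · intro h
      constructor
      · intro i
        have := DFunLike.congr_fun h (Sum.inl i)
        rwa [Finsupp.add_apply, h1, ee_apply_inl, ee_apply_inl] at this
      · intro i
        have := DFunLike.congr_fun h (Sum.inr i)
        rwa [Finsupp.add_apply, h2, ee_apply_inr, ee_apply_inr] at this
  rw [sum_congr rfl fun w _ => hL w] at key
  rw [key, Matrix.det_apply', map_sum]
  have hR : ∀ v : Equiv.Perm (Fin M), MvPowerSeries.coeff (ee l l')
      (((Equiv.Perm.sign v : ℤ) : MvPowerSeries (Fin M ⊕ Fin M) ℤ) *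
        ∏ i, (Matrix.of fun i j : Fin M => geo (uu (i, j))) (v i) i) =
      if l ∘ v = l' then (Equiv.Perm.sign v : ℤ) else 0 := by
    intro v
    rw [← zsmul_eq_mul, map_zsmul, smul_eq_mul]
    have := coeff_prod_geo (fun i => uu (v i, i)) (fun i => uu_ne _) 0 (ee l l')
      (if l ∘ v = l' then {l'} else ∅) (fun c => ?_)
    · rw [MvPowerSeries.monomial_zero_one, one_mul] at this
      simp only [Matrix.of_apply]
      rw [this]
      split_ifs <;> simp
    · rw [add_zero]
      have h1 : ∀ i, (∑ t, c t • uu (v t, t)) (Sum.inl (v i)) = c i := by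
        intro i
        simp [Finsupp.finsetSum_apply, uu, Finsupp.single_apply]
      have h2 : ∀ i, (∑ t, c t • uu (v t, t)) (Sum.inr i) = c i := by
        intro i
        simp [Finsupp.finsetSum_apply, uu, Finsupp.single_apply]
      constructor
      · intro hc
        split_ifs at hc with hv
        · rw [mem_singleton] at hc
          ext k
          rcases k with k | k
          · obtain ⟨i, rfl⟩ := v.surjective k
            rw [h1, ee_apply_inl, hc, ← hv]; rfl
          · rw [h2, ee_apply_inr, hc]
        · simp at hc
      · intro hc
        have hc' : c = l' := by
          funext i; rw [← h2, hc, ee_apply_inr]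
        have : l ∘ v = l' := by
          funext i
          rw [← hc', ← h1, hc, ee_apply_inl]; rfl
        rw [if_pos this, hc', mem_singleton]
  rw [sum_congr rfl fun v _ => hR v]
  have hv1 : ∀ v : Equiv.Perm (Fin M), l ∘ v = l' → v = 1 := by
    intro v hv
    have hmono : StrictMono v := by
      intro a b hab
      have := hl' hab
      rw [← hv] at this
      exact hl.lt_iff_lt.1 this
    ext i
    have : (⇑v) = id := by
      have h := Subsingleton.elim (hmono.orderIsoOfSurjective v v.surjective) (OrderIso.refl _)
      funext j
      exact DFunLike.congr_fun h j
    simp [this]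
  split_ifs with hll
  · rw [sum_eq_single 1]
    · simp [hll]
    · intro v _ hv
      rw [if_neg (fun h => hv (hv1 v h))]
    · simp
  · refine sum_eq_zero fun v _ => ?_
    rw [if_neg]
    intro h
    have := hv1 v h
    subst this
    exact hll (by simpa using h)

end Cauchy2
section CharSym

open Finset

theorem cnt_comp {n : ℕ} {A : Type} [DecidableEq A] (h : Fin n → A) (σ : Equiv.Perm (Fin n)) (a : A) :
    cnt (h ∘ σ) a = cnt h a :=
  Fintype.card_congr (σ.subtypeEquiv (fun _ => Iff.rfl))

/-- permutation representation on words of given content -/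
noncomputable def wordRep {n : ℕ} {A : Type} [DecidableEq A] (P : (A → ℕ) → Prop) :
    Representation ℂ (Equiv.Perm (Fin n)) ({f : Fin n → A // P (cnt f)} → ℂ) where
  toFun σ := LinearMap.funLeft ℂ ℂ (fun f => ⟨f.1 ∘ σ, by
    have : cnt (f.1 ∘ σ) = cnt f.1 := funext fun a => cnt_comp f.1 σ a
    rw [this]; exact f.2⟩)
  map_one' := by ext; simp [LinearMap.funLeft]
  map_mul' σ τ := by ext; simp [LinearMap.funLeft, Function.comp_assoc]

theorem wordRep_char {n : ℕ} {A : Type} [DecidableEq A] [Fintype A] (P : (A → ℕ) → Prop)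
    [DecidablePred P] (σ : Equiv.Perm (Fin n)) :
    (wordRep (n := n) P).character σ = #{f : Fin n → A | P (cnt f) ∧ f ∘ σ = f} := by
  classical
  unfold Representation.character
  rw [LinearMap.trace_eq_matrix_trace ℂ (Pi.basisFun ℂ _), Matrix.trace]
  have : ∀ f : {f : Fin n → A // P (cnt f)},
      ((LinearMap.toMatrix (Pi.basisFun ℂ {f : Fin n → A // P (cnt f)}) (Pi.basisFun ℂ _)) (wordRep P σ)).diag f
      = if f.1 ∘ σ = f.1 then 1 else 0 := by
    intro f
    rw [Matrix.diag_apply, LinearMap.toMatrix_apply]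
    simp [wordRep, LinearMap.funLeft, Pi.single_apply, Subtype.ext_iff]
  simp_rw [this]
  rw [sum_boole]
  congr 1
  rw [← Fintype.card_subtype, ← Fintype.card_subtype]
  exact Fintype.card_congr (Equiv.subtypeSubtypeEquivSubtypeInter (fun f : Fin n → A => P (cnt f))
    (fun f => f ∘ σ = f))

/-- The irreducible characters, by the determinantal formula -/
noncomputable def chi {n M : ℕ} (l : Fin M → ℕ) (σ : Equiv.Perm (Fin n)) : ℂ :=
  ∑ w : Equiv.Perm (Fin M), ((Equiv.Perm.sign w : ℤ) : ℂ) *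
    #{f : Fin n → Fin M | (∀ i, cnt f i + w i = l i) ∧ f ∘ σ = f}

theorem chi_mem {n M : ℕ} (l : Fin M → ℕ) :
    (chi l : Equiv.Perm (Fin n) → ℂ) ∈ AddSubgroup.closure (simpleChars (Equiv.Perm (Fin n))) := by
  have : (chi l : Equiv.Perm (Fin n) → ℂ) = ∑ w : Equiv.Perm (Fin M), (Equiv.Perm.sign w : ℤ) •
      (wordRep (n := n) (fun c : Fin M → ℕ => ∀ i, c i + w i = l i)).character := by
    funext σ
    simp only [chi, Finset.sum_apply]
    refine sum_congr rfl fun w _ => ?_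
    rw [Pi.smul_apply, wordRep_char, zsmul_eq_mul]
  rw [this]
  refine AddSubgroup.sum_mem _ fun w _ => AddSubgroup.zsmul_mem _ ?_ _
  classical
  exact char_mem_closure _ _ rfl

theorem cnt_fst {n : ℕ} {A : Type} [DecidableEq A] [Fintype A] (h : Fin n → A × A) (a : A) :
    cnt (fun x => (h x).1) a = ∑ b, cnt h (a, b) := by
  simp only [cnt, Fintype.card_subtype]
  rw [card_eq_sum_card_fiberwise (f := fun x => (h x).2) (t := univ) (by simp)]
  refine sum_congr rfl fun b _ => ?_
  rw [filter_filter]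
  congr 1
  ext x
  simp [Prod.ext_iff]

theorem cnt_snd {n : ℕ} {A : Type} [DecidableEq A] [Fintype A] (h : Fin n → A × A) (b : A) :
    cnt (fun x => (h x).2) b = ∑ a, cnt h (a, b) := by
  simp only [cnt, Fintype.card_subtype]
  rw [card_eq_sum_card_fiberwise (f := fun x => (h x).1) (t := univ) (by simp)]
  refine sum_congr rfl fun b _ => ?_
  rw [filter_filter]
  congr 1
  ext x
  simp [Prod.ext_iff, and_comm]

theorem cip_chi {n M : ℕ} (l l' : Fin M → ℕ) (hl : StrictMono l) (hl' : StrictMono l')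
    (hs : ∑ i, l i = n + ∑ i : Fin M, (i : ℕ)) :
    cip (chi l : Equiv.Perm (Fin n) → ℂ) (chi l') = if l = l' then 1 else 0 := by
  classical
  let P : Equiv.Perm (Fin M) → Equiv.Perm (Fin M) → (Fin M × Fin M → ℕ) → Prop :=
    fun w w' c => (∀ i, ∑ j, c (i, j) + w i = l i) ∧ (∀ j, ∑ i, c (i, j) + w' j = l' j)
  have hbound : ∀ w w' c, P w w' c → ∑ t, c t = n := by
    intro w w' c hc
    have h1 : ∑ i, (∑ j, c (i, j) + (w i : ℕ)) = ∑ i, l i := sum_congr rfl fun i _ => hc.1 i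
    rw [sum_add_distrib, Equiv.sum_comp w (fun i : Fin M => (i : ℕ)), hs,
      ← Fintype.sum_prod_type (f := fun t : Fin M × Fin M => c t)] at h1
    omega
  let B : Equiv.Perm (Fin M) → Equiv.Perm (Fin M) → Finset (Fin M × Fin M → ℕ) := fun w w' =>
    (Fintype.piFinset (fun _ => range (n + 1))).filter (P w w')
  have hB : ∀ w w' c, c ∈ B w w' ↔ P w w' c := by
    intro w w' c
    simp only [B, mem_filter, Fintype.mem_piFinset, mem_range, and_iff_right_iff_imp]
    intro hc t
    have := hbound w w' c hc
    have h2 : c t ≤ ∑ t, c t := single_le_sum (f := c) (fun _ _ => Nat.zero_le _) (mem_univ t)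
    omega
  have key := cauchy_count l l' hl hl' B hB
  have hprod : ∀ (w w' : Equiv.Perm (Fin M)) (σ : Equiv.Perm (Fin n)),
      #{f : Fin n → Fin M | (∀ i, cnt f i + w i = l i) ∧ f ∘ σ = f} *
      #{f : Fin n → Fin M | (∀ i, cnt f i + w' i = l' i) ∧ f ∘ ⇑(σ⁻¹) = f} =
      #{h : Fin n → Fin M × Fin M | P w w' (cnt h) ∧ h ∘ σ = h} := by
    intro w w' σ
    rw [← card_product]
    refine card_equiv (Equiv.arrowProdEquivProdArrow _ _ _).symm ?_
    rintro ⟨f, g⟩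
    simp only [mem_product, mem_filter, mem_univ, true_and, P]
    have e1 : ∀ i, cnt f i = ∑ j, cnt (fun x => (f x, g x)) (i, j) :=
      fun i => cnt_fst (fun x => (f x, g x)) i
    have e2 : ∀ i, cnt g i = ∑ j, cnt (fun x => (f x, g x)) (j, i) :=
      fun i => cnt_snd (fun x => (f x, g x)) i
    have e3 : ((Equiv.arrowProdEquivProdArrow (Fin n) (fun _ => Fin M) (fun _ => Fin M)).symm (f, g)) =
      (fun x => (f x, g x)) := rfl
    have e4 : g ∘ ⇑(σ⁻¹) = g ↔ g ∘ σ = g := by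
      constructor
      · intro h; conv_lhs => rw [← h]
        funext x; simp
      · intro h; conv_lhs => rw [← h]
        funext x; simp
    have e5 : (fun x => (f x, g x)) ∘ σ = (fun x => (f x, g x)) ↔ f ∘ σ = f ∧ g ∘ σ = g := by
      simp only [funext_iff, Function.comp, Prod.ext_iff, forall_and]
    rw [e3, e4, e5]
    simp_rw [e1, e2]
    tauto
  have hburn : ∀ w w' : Equiv.Perm (Fin M), ∑ σ : Equiv.Perm (Fin n),
      #{h : Fin n → Fin M × Fin M | P w w' (cnt h) ∧ h ∘ σ = h} = n.factorial * #(B w w') := by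
    intro w w'
    refine burnside_count (P w w') (B w w') fun c => ?_
    rw [hB]
    exact ⟨fun h => ⟨hbound _ _ _ h, h⟩, fun h => h.2⟩
  have hn : (n.factorial : ℂ) ≠ 0 := by exact_mod_cast n.factorial_ne_zero
  unfold cip
  rw [Nat.card_eq_fintype_card, Fintype.card_perm, Fintype.card_fin, inv_mul_eq_iff_eq_mul₀ hn]
  calc ∑ g : Equiv.Perm (Fin n), chi l g * chi l' g⁻¹ 
      = ∑ w : Equiv.Perm (Fin M), ∑ w' : Equiv.Perm (Fin M), ∑ g : Equiv.Perm (Fin n),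
        ((Equiv.Perm.sign w : ℤ) : ℂ) * ((Equiv.Perm.sign w' : ℤ) : ℂ) * 
        (#{h : Fin n → Fin M × Fin M | P w w' (cnt h) ∧ h ∘ g = h} : ℕ) := by
        simp_rw [chi, sum_mul_sum]
        rw [sum_comm]
        refine sum_congr rfl fun w _ => ?_
        rw [sum_comm]
        refine sum_congr rfl fun w' _ => sum_congr rfl fun g _ => ?_
        rw [mul_mul_mul_comm, ← hprod, Nat.cast_mul]
    _ = ∑ w : Equiv.Perm (Fin M), ∑ w' : Equiv.Perm (Fin M), 
        (n.factorial : ℂ) * (((Equiv.Perm.sign w : ℤ) * (Equiv.Perm.sign w' : ℤ) * (#(B w w') : ℤ) : ℤ) : ℂ) := by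
        refine sum_congr rfl fun w _ => sum_congr rfl fun w' _ => ?_
        rw [← mul_sum, ← Nat.cast_sum, hburn]
        push_cast
        ring
    _ = _ := by
        simp_rw [← mul_sum, ← Int.cast_sum]
        rw [key]
        split_ifs <;> simp

theorem chi_one {n M : ℕ} (l : Fin M → ℕ) (hs : ∑ i, l i = n + ∑ i : Fin M, (i : ℕ)) :
    (chi l (1 : Equiv.Perm (Fin n))) * ∏ i, ((l i).factorial : ℂ) =
      n.factorial * ∏ i, ∏ j ∈ Ioi i, ((l j : ℂ) - l i) := by
  classical
  have h1 : ∀ w : Equiv.Perm (Fin M),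
      #{f : Fin n → Fin M | (∀ i, cnt f i + w i = l i) ∧ f ∘ (1 : Equiv.Perm (Fin n)) = f} *
        ∏ i, (l i).factorial = n.factorial * ∏ i, (l i).descFactorial (w i) := by
    intro w
    by_cases hw : ∀ i, (w i : ℕ) ≤ l i
    · have h2 := mult_count (n := n) (fun i => l i - w i) (by
        have : ∑ i, (l i - w i) + ∑ i, (w i : ℕ) = ∑ i, l i := by
          rw [← sum_add_distrib]
          exact sum_congr rfl fun i _ => Nat.sub_add_cancel (hw i)
        rw [Equiv.sum_comp w (fun i : Fin M => (i : ℕ)), hs] at this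
        omega)
      rw [← h2]
      have h3 : #{f : Fin n → Fin M | (∀ i, cnt f i + w i = l i) ∧ f ∘ (1 : Equiv.Perm (Fin n)) = f}
          = #{f : Fin n → Fin M | ∀ i, cnt f i = l i - w i} := by
        congr 1
        ext f
        simp only [mem_filter, mem_univ, true_and, Equiv.Perm.coe_one, Function.comp_id, and_true]
        refine forall_congr' fun i => ?_
        have := hw i
        omega
      rw [h3, mul_assoc, ← prod_mul_distrib]
      refine congrArg₂ (· * ·) (by congr!) ?_
      exact prod_congr rfl fun i _ => (Nat.factorial_mul_descFactorial (hw i)).symm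
    · push Not at hw
      obtain ⟨i, hi⟩ := hw
      rw [prod_eq_zero (f := fun i => (l i).descFactorial (w i)) (mem_univ i)
        (Nat.descFactorial_of_lt hi), mul_zero]
      have : ({f : Fin n → Fin M | (∀ i, cnt f i + w i = l i) ∧
          f ∘ (1 : Equiv.Perm (Fin n)) = f} : Finset _) = ∅ := by
        rw [filter_eq_empty_iff]
        intro f _ hf
        have := hf.1 i
        omega
      rw [this]
      simp
  have h4 : (Matrix.vandermonde fun i => (l i : ℂ)).det =
      ∑ w : Equiv.Perm (Fin M), ((Equiv.Perm.sign w : ℤ) : ℂ) * ∏ i, ((l i).descFactorial (w i) : ℂ) := by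
    rw [Matrix.det_eval_matrixOfPolynomials_eq_det_vandermonde _
      (fun i : Fin M => descPochhammer ℂ i) (fun i => descPochhammer_natDegree _ _)
      (fun i => monic_descPochhammer _ _), ← Matrix.det_transpose, Matrix.det_apply']
    simp [descPochhammer_eval_eq_descFactorial]
  rw [← Matrix.det_vandermonde, h4, chi, sum_mul, mul_sum]
  refine sum_congr rfl fun w _ => ?_
  have := congrArg (Nat.cast (R := ℂ)) (h1 w)
  rw [Nat.cast_mul, Nat.cast_mul, Nat.cast_prod, Nat.cast_prod] at this
  rw [mul_assoc, this]
  ring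

end CharSym
section Family

open Finset

/-- product of the hook lengths of a beta-set -/
def hookProd (X : Finset ℕ) : ℕ := ∏ x ∈ X, ∏ y ∈ range x \ X, (x - y)

theorem hookProd_pos (X : Finset ℕ) : 0 < hookProd X := by
  refine prod_pos fun x _ => prod_pos fun y hy => ?_
  simp at hy
  omega

theorem fact_eq_prod (x : ℕ) : x.factorial = ∏ y ∈ range x, (x - y) := by
  rw [← prod_range_reflect, ← prod_range_add_one_eq_factorial]
  refine prod_congr rfl fun y hy => ?_
  simp at hy
  omega

theorem hook_formula (X : Finset ℕ) {M : ℕ} (h : #X = M) :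
    ∏ i, ((X.orderEmbOfFin h i).factorial : ℂ) =
      (hookProd X : ℂ) * ∏ i, ∏ j ∈ Ioi i, ((X.orderEmbOfFin h j : ℂ) - X.orderEmbOfFin h i) := by
  classical
  have hre : ∀ f : ℕ → ℂ, ∏ i, f (X.orderEmbOfFin h i) = ∏ x ∈ X, f x := by
    intro f
    rw [← prod_image (s := univ) (g := X.orderEmbOfFin h) (f := f)
      (fun a _ b _ hab => (X.orderEmbOfFin h).injective hab), image_orderEmbOfFin_univ]
  have h1 : ∏ i, ∏ j ∈ Ioi i, ((X.orderEmbOfFin h j : ℂ) - X.orderEmbOfFin h i) =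
      ∏ x ∈ X, ∏ y ∈ X with y < x, ((x : ℂ) - y) := by
    rw [prod_comm' (t' := univ) (s' := fun j => Iio j) (by intro a b; simp)]
    rw [← hre (fun x => ∏ y ∈ X with y < x, ((x : ℂ) - y))]
    refine prod_congr rfl fun j _ => ?_
    rw [prod_filter]
    rw [← hre (fun y => if y < X.orderEmbOfFin h j then ((X.orderEmbOfFin h j : ℂ) - y) else 1)]
    rw [← prod_filter]
    refine prod_congr ?_ fun _ _ => rfl
    ext i
    simp
  rw [h1, hre (fun x => (x.factorial : ℂ)), hookProd, Nat.cast_prod, ← prod_mul_distrib]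
  refine prod_congr rfl fun x _ => ?_
  have h2 : ({y ∈ X | y < x} : Finset ℕ) = range x ∩ X := by
    ext y; simp [and_comm]
  rw [h2, fact_eq_prod, ← prod_sdiff (inter_subset_left : range x ∩ X ⊆ range x), Nat.cast_mul,
    sdiff_inter_self_left]
  congr 1
  rw [Nat.cast_prod]
  refine prod_congr rfl fun y hy => ?_
  simp at hy
  rw [Nat.cast_sub hy.1.le]

theorem maxMult_of_family {n M N : ℕ} (X : Fin N → Finset ℕ) (hX : Function.Injective X)
    (hcard : ∀ a, #(X a) = M) (hsum : ∀ a, ∑ x ∈ X a, x = n + ∑ i ∈ range M, i)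
    (hhook : ∀ a b, hookProd (X a) = hookProd (X b)) :
    N ≤ maxMult (Equiv.Perm (Fin n)) := by
  classical
  rcases Nat.eq_zero_or_pos N with rfl | hN
  · simp
  let H := hookProd (X ⟨0, hN⟩)
  have hH : 0 < H := hookProd_pos _
  let l : Fin N → Fin M → ℕ := fun a => (X a).orderEmbOfFin (hcard a)
  have hmono : ∀ a, StrictMono (l a) := fun a => ((X a).orderEmbOfFin (hcard a)).strictMono
  have hs : ∀ a, ∑ i, l a i = n + ∑ i : Fin M, (i : ℕ) := by
    intro a
    rw [Fin.sum_univ_eq_sum_range (fun i => i), ← hsum a]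
    rw [← sum_image (s := univ) (g := l a) (f := fun x => x)
      (fun x _ y _ hab => (hmono a).injective hab)]
    congr 1
    exact image_orderEmbOfFin_univ _ _
  have hlinj : Function.Injective l := by
    intro a b hab
    apply hX
    have h1 := image_orderEmbOfFin_univ (X a) (hcard a)
    have h2 := image_orderEmbOfFin_univ (X b) (hcard b)
    rw [← h1, ← h2]
    exact congrArg (fun f => univ.image f) hab
  have hdeg : ∀ a, chi (l a) (1 : Equiv.Perm (Fin n)) * H = n.factorial := by
    intro a
    have h1 := chi_one (n := n) (l a) (hs a)
    have h2 := hook_formula (X a) (hcard a)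
    have h3 : ∏ i, ∏ j ∈ Ioi i, ((l a j : ℂ) - l a i) ≠ 0 := by
      refine prod_ne_zero_iff.2 fun i _ => prod_ne_zero_iff.2 fun j hj => ?_
      rw [sub_ne_zero]
      have := hmono a (mem_Ioi.1 hj)
      exact_mod_cast this.ne'
    rw [hhook a ⟨0, hN⟩] at h2
    change ∏ i, ((l a i).factorial : ℂ) = (H : ℂ) * ∏ i, ∏ j ∈ Ioi i, ((l a j : ℂ) - l a i) at h2
    rw [h2, ← mul_assoc] at h1
    exact mul_right_cancel₀ h3 h1
  have hnat : ∀ a, chi (l a) (1 : Equiv.Perm (Fin n)) = ((n.factorial / H : ℕ) : ℂ) := by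
    intro a
    obtain ⟨z, hz⟩ : ∃ z : ℤ, chi (l a) (1 : Equiv.Perm (Fin n)) = z :=
      ⟨∑ w : Equiv.Perm (Fin M), (Equiv.Perm.sign w : ℤ) *
        (#{f : Fin n → Fin M | (∀ i, cnt f i + w i = l a i) ∧ f ∘ (1 : Equiv.Perm (Fin n)) = f} : ℤ), by
        rw [chi, Int.cast_sum]
        refine sum_congr rfl fun w _ => ?_
        rw [Int.cast_mul, Int.cast_natCast]⟩
    have h1 := hdeg a
    rw [hz] at h1
    have h2 : z * (H : ℤ) = n.factorial := by exact_mod_cast h1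
    rw [hz]
    have h3 : ((n.factorial / H : ℕ) : ℤ) = z := by
      rw [Int.natCast_div, ← h2]
      exact Int.mul_ediv_cancel _ (by exact_mod_cast hH.ne')
    rw [← h3]
    simp only [Int.cast_natCast]
  have hV := fun a => exists_simple_of_norm_one (chi (l a) : Equiv.Perm (Fin n) → ℂ) (chi_mem _)
    (by rw [cip_chi _ _ (hmono a) (hmono a) (hs a), if_pos rfl]) _ (hnat a)
  choose V hVs hVc using hV
  refine maxMult_ge (n.factorial / H) N V hVs ?_ ?_
  · intro a
    have h1 := FDRep.char_one (V a)
    rw [hVc, hnat] at h1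
    exact_mod_cast h1.symm
  · intro a b hab
    rw [hVc, hVc] at hab
    by_contra hne
    have h1 := cip_chi (n := n) (l a) (l b) (hmono a) (hmono b) (hs a)
    rw [if_neg (fun h => hne (hlinj h)), ← hab, cip_chi _ _ (hmono a) (hmono a) (hs a), if_pos rfl] at h1
    exact one_ne_zero h1

end Family
/-! ### Part A: the combinatorial construction -/
section Combi

open Finset

/-- alternating sum of a function over a list of boundary positions -/
def altSum (f : ℤ → ℤ) : List ℤ → ℤ
  | [] => 0
  | x :: l => f x - altSum f l

theorem altSum_congr {f g : ℤ → ℤ} : ∀ {l : List ℤ}, (∀ x ∈ l, f x = g x) → altSum f l = altSum g l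
  | [], _ => rfl
  | x :: l, h => by
    rw [altSum, altSum, h x (by simp), altSum_congr (l := l) (fun y hy => h y (by simp [hy]))]

theorem altSum_add (f g : ℤ → ℤ) : ∀ l, altSum (fun x => f x + g x) l = altSum f l + altSum g l
  | [] => rfl
  | x :: l => by rw [altSum, altSum, altSum, altSum_add f g l]; ring

theorem altSum_sub (f g : ℤ → ℤ) : ∀ l, altSum (fun x => f x - g x) l = altSum f l - altSum g l
  | [] => rfl
  | x :: l => by rw [altSum, altSum, altSum, altSum_sub f g l]; ring

theorem altSum_mul (c : ℤ) (f : ℤ → ℤ) : ∀ l, altSum (fun x => c * f x) l = c * altSum f l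
  | [] => by simp [altSum]
  | x :: l => by rw [altSum, altSum, altSum_mul c f l]; ring

theorem altSum_mul_right (c : ℤ) (f : ℤ → ℤ) (l : List ℤ) :
    altSum (fun x => f x * c) l = altSum f l * c := by
  simp_rw [mul_comm _ c]
  exact altSum_mul c f l

theorem altSum_const (c : ℤ) (l : List ℤ) : altSum (fun _ => c) l = c * altSum (fun _ => 1) l := by
  rw [← altSum_mul]; simp

theorem altSum_sum {ι : Type} (s : Finset ι) (f : ι → ℤ → ℤ) :
    ∀ l, ∑ k ∈ s, altSum (f k) l = altSum (fun x => ∑ k ∈ s, f k x) l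
  | [] => by simp [altSum]
  | x :: l => by simp only [altSum]; rw [sum_sub_distrib, altSum_sum s f l]

/-- autocorrelation functional -/
def autoCorr (f : ℤ → ℤ) (l : List ℤ) : ℤ := altSum (fun x => altSum (fun y => f (y - x)) l) l

/-- the inflation operator -/
def inflate (a b : ℤ) : List ℤ → List ℤ
  | [] => []
  | x :: l => (4 * x - b) :: (4 * x + a - b) :: (4 * x + a) :: inflate a b l

theorem altSum_inflate (a b : ℤ) (f : ℤ → ℤ) : ∀ l, altSum f (inflate a b l) =
    altSum (fun x => f (4 * x - b) - f (4 * x + a - b) + f (4 * x + a)) l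
  | [] => rfl
  | x :: l => by
    rw [inflate, altSum, altSum, altSum, altSum, altSum_inflate a b f l]; ring

theorem autoCorr_inflate (a b : ℤ) (f : ℤ → ℤ) (l : List ℤ) : autoCorr f (inflate a b l) =
    autoCorr (fun z => 3 * f (4 * z) - f (4 * z + a) - f (4 * z - a) - f (4 * z + b) - f (4 * z - b)
      + f (4 * z + (a + b)) + f (4 * z - (a + b))) l := by
  unfold autoCorr
  rw [altSum_inflate]
  refine altSum_congr fun x _ => ?_
  rw [altSum_inflate, altSum_inflate, altSum_inflate, ← altSum_sub, ← altSum_add]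
  refine altSum_congr fun y _ => ?_
  ring_nf

theorem autoCorr_swap (a b : ℤ) (f : ℤ → ℤ) (l : List ℤ) :
    autoCorr f (inflate a b l) = autoCorr f (inflate b a l) := by
  rw [autoCorr_inflate, autoCorr_inflate]
  unfold autoCorr
  refine altSum_congr fun x _ => altSum_congr fun y _ => ?_
  rw [add_comm b a]
  ring

theorem inflate_inj (a b : ℤ) : ∀ l l', inflate a b l = inflate a b l' → l = l'
  | [], [], _ => rfl
  | [], y :: l', h => by simp [inflate] at h
  | x :: l, [], h => by simp [inflate] at h
  | x :: l, y :: l', h => by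
    simp only [inflate, List.cons.injEq] at h
    rw [inflate_inj a b l l' h.2.2.2]
    congr 1
    omega

theorem inflate_ne (a b : ℤ) (hab : a ≠ b) (l l' : List ℤ) (hl : l ≠ []) :
    inflate a b l ≠ inflate b a l' := by
  intro h
  cases l with
  | nil => exact hl rfl
  | cons x l =>
    cases l' with
    | nil => simp [inflate] at h
    | cons y l' =>
      simp only [inflate, List.cons.injEq] at h
      omega

/-- spacing condition -/
abbrev Spaced (l : List ℤ) : Prop := List.IsChain (fun x y => x + 17 ≤ y) l

theorem spaced_inflate (a b : ℤ) (ha : 17 ≤ a) (hb : 17 ≤ b) (hab : a + b ≤ 51) :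
    ∀ l, Spaced l → Spaced (inflate a b l)
  | [], _ => by simp [inflate, Spaced]
  | [x], _ => by
    simp only [inflate, Spaced, List.isChain_cons_cons, List.isChain_singleton, and_true]
    omega
  | x :: y :: l, h => by
    have h1 := spaced_inflate a b ha hb hab (y :: l) (List.isChain_cons_cons.1 h).2
    have h2 := (List.isChain_cons_cons.1 h).1
    rw [inflate]
    rw [inflate] at h1 ⊢
    simp only [Spaced, List.isChain_cons_cons] at h1 ⊢
    refine ⟨by omega, by omega, by omega, h1⟩

/-- the invariants of a boundary list -/
structure Good (n : ℕ) (l : List ℤ) : Prop where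
  spaced : Spaced l
  zeroth : altSum (fun _ => 1) l = 1
  first : altSum (fun x => x) l = 0
  second : altSum (fun x => x * x) l = 2 * n

theorem good_inflate (n : ℕ) (a b : ℕ) (ha : 17 ≤ a) (hb : 17 ≤ b) (hab : a + b ≤ 51) (l : List ℤ)
    (h : Good n l) : Good (16 * n + a * b) (inflate a b l) where
  spaced := spaced_inflate a b (by omega) (by omega) (by omega) l h.spaced
  zeroth := by
    rw [altSum_inflate]
    simp only [sub_self, zero_add]
    exact h.zeroth
  first := by
    rw [altSum_inflate]
    have : altSum (fun x => 4 * x) l = 0 := by rw [altSum_mul, h.first, mul_zero]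
    rw [← this]
    exact altSum_congr fun x _ => by ring
  second := by
    rw [altSum_inflate]
    have : altSum (fun x => 16 * (x * x) + (2 * a * b : ℤ)) l = 16 * (2 * n) + 2 * a * b := by
      rw [altSum_add, altSum_mul, altSum_const, h.zeroth, h.second, mul_one]
    push_cast
    rw [show (2 * (16 * n + a * b) : ℤ) = 16 * (2 * n) + 2 * a * b by ring, ← this]
    exact altSum_congr fun x _ => by ring

theorem good_base (m : ℕ) (hm : 2000 ≤ m) : ∃ l, Good m l := by
  obtain ⟨r, s, hr, hs, hrs⟩ : ∃ r s : ℕ, 17 ≤ r ∧ 17 ≤ s ∧ m = 306 + 18 * r + 17 * s :=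
    ⟨17 + m % 17, (m - 306 - 18 * (17 + m % 17)) / 17, by omega, by omega, by omega⟩
  refine ⟨[-(17 + (r : ℤ)), 1 - r, 1, 1 + s, 18 + s], ?_, ?_, ?_, ?_⟩
  · simp only [Spaced, List.isChain_cons_cons, List.isChain_singleton, and_true]
    omega
  · simp [altSum]
  · simp [altSum]; ring
  · simp only [altSum]; subst hrs; push_cast; ring

theorem good_family (i : ℕ) : ∀ n : ℕ, 2000 * 17 ^ i ≤ n → ∃ F : Finset (List ℤ), #F = 2 ^ i ∧
    (∀ l ∈ F, Good n l) ∧ ∀ l ∈ F, ∀ l' ∈ F, ∀ f, autoCorr f l = autoCorr f l' := by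
  induction i with
  | zero =>
    intro n hn
    obtain ⟨l, hl⟩ := good_base n (by simpa using hn)
    exact ⟨{l}, by simp, by simpa using hl, by simp⟩
  | succ i ih =>
    intro n hn
    have hpos : 1 ≤ 17 ^ i := Nat.one_le_pow _ _ (by norm_num)
    rw [pow_succ] at hn
    obtain ⟨b, n', hb1, hb2, hn', hle⟩ : ∃ b n' : ℕ, 18 ≤ b ∧ b ≤ 33 ∧ n = 16 * n' + 17 * b ∧
        2000 * 17 ^ i ≤ n' :=
      ⟨18 + (n + 14) % 16, (n - 17 * (18 + (n + 14) % 16)) / 16, by omega, by omega, by omega,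
        by omega⟩
    obtain ⟨F, hF1, hF2, hF3⟩ := ih n' hle
    classical
    refine ⟨F.image (inflate (17 : ℕ) b) ∪ F.image (inflate b (17 : ℕ)), ?_, ?_, ?_⟩
    · rw [card_union_of_disjoint, card_image_of_injective _ (fun l l' h => inflate_inj _ _ l l' h),
        card_image_of_injective _ (fun l l' h => inflate_inj _ _ l l' h), hF1, pow_succ]
      · ring
      · rw [disjoint_left]
        intro k hk hk'
        obtain ⟨l, hl, rfl⟩ := mem_image.1 hk
        obtain ⟨l', hl', h⟩ := mem_image.1 hk'
        refine inflate_ne _ _ (by omega) l l' ?_ h.symm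
        rintro rfl
        have := (hF2 _ hl).zeroth
        simp [altSum] at this
    · intro k hk
      rcases mem_union.1 hk with hk | hk
      · obtain ⟨l, hl, rfl⟩ := mem_image.1 hk
        rw [hn']
        exact good_inflate n' 17 b (by omega) (by omega) (by omega) l (hF2 l hl)
      · obtain ⟨l, hl, rfl⟩ := mem_image.1 hk
        rw [hn', mul_comm 17 b]
        exact good_inflate n' b 17 (by omega) (by omega) (by omega) l (hF2 l hl)
    · have h1 : ∀ k ∈ F.image (inflate (17 : ℕ) b) ∪ F.image (inflate b (17 : ℕ)), ∃ l ∈ F,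
          ∀ f, autoCorr f k = autoCorr f (inflate (17 : ℕ) b l) := by
        intro k hk
        rcases mem_union.1 hk with hk | hk
        · obtain ⟨l, hl, rfl⟩ := mem_image.1 hk
          exact ⟨l, hl, fun f => rfl⟩
        · obtain ⟨l, hl, rfl⟩ := mem_image.1 hk
          exact ⟨l, hl, fun f => autoCorr_swap _ _ _ _⟩
      intro k hk k' hk' f
      obtain ⟨l, hl, h⟩ := h1 k hk
      obtain ⟨l', hl', h'⟩ := h1 k' hk'
      rw [h, h', autoCorr_inflate, autoCorr_inflate, hF3 l hl l' hl']

end Combi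
section Transfer

open Finset

/-- gap indicator: `1` at gaps, `0` at beads -/
def gapAt (l : List ℤ) (x : ℤ) : ℤ := altSum (fun y => if y ≤ x then 1 else 0) l

theorem gapAt_cons (y : ℤ) (l : List ℤ) (x : ℤ) :
    gapAt (y :: l) x = (if y ≤ x then 1 else 0) - gapAt l x := rfl

theorem gapAt_left (l : List ℤ) (x : ℤ) (h : ∀ y ∈ l, x < y) : gapAt l x = 0 := by
  have : altSum (fun y => if y ≤ x then 1 else 0) l = altSum (fun _ => 0) l :=
    altSum_congr fun y hy => if_neg (not_le.2 (h y hy))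
  rw [gapAt, this, altSum_const, zero_mul]

theorem gapAt_right (l : List ℤ) (x : ℤ) (h : ∀ y ∈ l, y ≤ x) :
    gapAt l x = altSum (fun _ => 1) l :=
  altSum_congr fun y hy => if_pos (h y hy)

theorem spaced_lt {x : ℤ} {l : List ℤ} (h : Spaced (x :: l)) : ∀ y ∈ l, x < y := by
  have h1 : List.IsChain (· < ·) (x :: l) := h.imp (fun a b hab => by omega)
  have h2 := List.isChain_iff_pairwise.1 h1
  exact (List.pairwise_cons.1 h2).1

theorem spaced_tail {x : ℤ} {l : List ℤ} (h : Spaced (x :: l)) : Spaced l := h.of_cons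

theorem gapAt_01 : ∀ (l : List ℤ), Spaced l → ∀ x, gapAt l x = 0 ∨ gapAt l x = 1
  | [], _, x => Or.inl rfl
  | y :: l, h, x => by
    rw [gapAt_cons]
    have ih := gapAt_01 l (spaced_tail h) x
    by_cases hy : y ≤ x
    · rw [if_pos hy]; omega
    · rw [gapAt_left l x (fun z hz => by have := spaced_lt h z hz; omega)]
      simp [hy]

theorem gapAt_inj : ∀ (l l' : List ℤ), Spaced l → Spaced l' → (∀ x, gapAt l x = gapAt l' x) → l = l'
  | [], [], _, _, _ => rfl
  | [], y :: l', _, h', h => by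
    have := h y
    rw [gapAt_cons, gapAt_left l' y (spaced_lt h')] at this
    simp [gapAt, altSum] at this
  | x :: l, [], h', _, h => by
    have := h x
    rw [gapAt_cons, gapAt_left l x (spaced_lt h')] at this
    simp [gapAt, altSum] at this
  | x :: l, y :: l', h1, h2, h => by
    have hx := h x
    have hy := h y
    have e : x = y := by
      rcases lt_trichotomy x y with hlt | heq | hgt
      · rw [gapAt_cons, gapAt_left l x (spaced_lt h1), gapAt_left (y :: l') x] at hx
        · simp at hx
        · intro z hz
          rcases List.mem_cons.1 hz with rfl | hz
          · exact hlt
          · exact hlt.trans (spaced_lt h2 z hz)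
      · exact heq
      · rw [gapAt_cons y, gapAt_left l' y (spaced_lt h2), gapAt_left (x :: l) y] at hy
        · simp at hy
        · intro z hz
          rcases List.mem_cons.1 hz with rfl | hz
          · exact hgt
          · exact hgt.trans (spaced_lt h1 z hz)
    subst e
    rw [gapAt_inj l l' (spaced_tail h1) (spaced_tail h2)]
    intro z
    have := h z
    rw [gapAt_cons, gapAt_cons] at this
    omega

/-- beta-set of a boundary list -/
def betaSet (M : ℕ) (l : List ℤ) : Finset ℕ := {k ∈ range (2 * M) | gapAt l ((k : ℤ) - M) = 0}

/-- summation over a final window -/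
theorem sum_window (f : ℕ → ℤ) (M : ℕ) (y : ℤ) (h1 : -M ≤ y) (h2 : y ≤ M) :
    ∑ k ∈ range (2 * M), f k * (if y ≤ (k : ℤ) - M then 1 else 0) =
      ∑ k ∈ range (2 * M), f k - ∑ k ∈ range (y + M).toNat, f k := by
  have h3 : (y + M).toNat ≤ 2 * M := by omega
  rw [eq_sub_iff_add_eq, ← Finset.sum_range_add_sum_Ico _ h3,
    ← Finset.sum_range_add_sum_Ico f h3]
  have e1 : ∑ k ∈ range (y + M).toNat, f k * (if y ≤ (k : ℤ) - M then 1 else 0) = 0 := by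
    refine sum_eq_zero fun k hk => ?_
    rw [mem_range] at hk
    rw [if_neg (by omega), mul_zero]
  have e2 : ∑ k ∈ Ico (y + M).toNat (2 * M), f k * (if y ≤ (k : ℤ) - M then 1 else 0) =
      ∑ k ∈ Ico (y + M).toNat (2 * M), f k := by
    refine sum_congr rfl fun k hk => ?_
    rw [mem_Ico] at hk
    rw [if_pos (by omega), mul_one]
  rw [e1, e2]
  ring

theorem sum_gap (f : ℕ → ℤ) (M : ℕ) (l : List ℤ) (hl : ∀ y ∈ l, -(M : ℤ) ≤ y ∧ y ≤ M) :
    ∑ k ∈ range (2 * M), f k * gapAt l ((k : ℤ) - M) =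
      altSum (fun y => ∑ k ∈ range (2 * M), f k - ∑ k ∈ range (y + M).toNat, f k) l := by
  simp_rw [gapAt, ← altSum_mul]
  rw [altSum_sum]
  exact altSum_congr fun y hy => sum_window f M y (hl y hy).1 (hl y hy).2

variable {n M : ℕ} {l : List ℤ}

theorem sum_gap_one (h : Good n l) (hl : ∀ y ∈ l, -(M : ℤ) ≤ y ∧ y ≤ M) :
    ∑ k ∈ range (2 * M), gapAt l ((k : ℤ) - M) = M := by
  have h1 := sum_gap (fun _ => 1) M l hl
  simp only [one_mul] at h1
  rw [h1]
  have : altSum (fun y => (M : ℤ) - y) l = M := by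
    rw [altSum_sub, altSum_const, h.zeroth, h.first]; ring
  rw [← this]
  refine altSum_congr fun y hy => ?_
  have := hl y hy
  simp
  omega

theorem sum_gap_id (h : Good n l) (hl : ∀ y ∈ l, -(M : ℤ) ≤ y ∧ y ≤ M) :
    2 * ∑ k ∈ range (2 * M), (k : ℤ) * gapAt l ((k : ℤ) - M) = 3 * M * M - M - 2 * n := by
  rw [sum_gap (fun k => (k : ℤ)) M l hl, ← altSum_mul]
  have hg : ∀ K : ℕ, 2 * ∑ k ∈ range K, (k : ℤ) = K * K - K := by
    intro K
    induction K with
    | zero => simp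
    | succ K ih => rw [sum_range_succ, mul_add, ih]; push_cast; ring
  have : altSum (fun y => (3 * M * M - M : ℤ) - (2 * M - 1) * y - y * y) l = 3 * M * M - M - 2 * n := by
    rw [altSum_sub, altSum_sub, altSum_const, altSum_mul, h.zeroth, h.first, h.second]; ring
  rw [← this]
  refine altSum_congr fun y hy => ?_
  have h3 := hl y hy
  rw [mul_sub, hg, hg, Int.toNat_of_nonneg (by omega)]
  push_cast
  ring

theorem beta_sum (f : ℕ → ℤ) (h : Good n l) :
    ∑ k ∈ betaSet M l, f k = ∑ k ∈ range (2 * M), f k - ∑ k ∈ range (2 * M), f k * gapAt l ((k : ℤ) - M) := by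
  rw [betaSet, sum_filter, ← sum_sub_distrib]
  refine sum_congr rfl fun k _ => ?_
  rcases gapAt_01 l h.spaced ((k : ℤ) - M) with h1 | h1 <;> simp [h1]

theorem beta_card (h : Good n l) (hl : ∀ y ∈ l, -(M : ℤ) ≤ y ∧ y ≤ M) : #(betaSet M l) = M := by
  have h1 := beta_sum (M := M) (fun _ => 1) h
  simp only [one_mul, sum_gap_one h hl] at h1
  simp at h1
  omega

theorem beta_total (h : Good n l) (hl : ∀ y ∈ l, -(M : ℤ) ≤ y ∧ y ≤ M) :
    ∑ x ∈ betaSet M l, x = n + ∑ i ∈ range M, i := by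
  have h1 := beta_sum (M := M) (fun k => (k : ℤ)) h
  have h2 := sum_gap_id h hl
  have hg : ∀ K : ℕ, 2 * ∑ k ∈ range K, (k : ℤ) = K * K - K := by
    intro K
    induction K with
    | zero => simp
    | succ K ih => rw [sum_range_succ, mul_add, ih]; push_cast; ring
  have h3 := hg M
  have h4 := hg (2 * M)
  zify
  push_cast at h4
  linarith

theorem hook_count (h : Good n l) (hl : ∀ y ∈ l, -(M : ℤ) ≤ y ∧ y ≤ M) (d : ℕ) :
    ∑ k ∈ range (2 * M), gapAt l ((k : ℤ) - M) * (1 - gapAt l ((k : ℤ) - M + d)) =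
      autoCorr (fun z => max 0 (z - d)) l := by
  simp_rw [mul_sub, mul_one]
  rw [sum_sub_distrib, sum_gap_one h hl]
  have h1 : ∀ k : ℕ, gapAt l ((k : ℤ) - M) * gapAt l ((k : ℤ) - M + d) =
      altSum (fun x => altSum (fun y => if max x (y - d) ≤ (k : ℤ) - M then 1 else 0) l) l := by
    intro k
    rw [gapAt, ← altSum_mul_right]
    refine altSum_congr fun x _ => ?_
    rw [gapAt, ← altSum_mul]
    refine altSum_congr fun y _ => ?_
    by_cases hx : x ≤ (k : ℤ) - M <;> by_cases hy : y ≤ (k : ℤ) - M + d <;> simp [hx, hy]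
  simp_rw [h1]
  rw [altSum_sum]
  have h2 : altSum (fun x => ∑ k ∈ range (2 * M),
      altSum (fun y => if max x (y - d) ≤ (k : ℤ) - M then 1 else 0) l) l =
      altSum (fun x => (M - x : ℤ) - altSum (fun y => max 0 (y - x - d)) l) l := by
    refine altSum_congr fun x hx => ?_
    rw [altSum_sum]
    have h3 : (M - x : ℤ) = altSum (fun _ => (M - x : ℤ)) l := by
      rw [altSum_const, h.zeroth, mul_one]
    rw [h3, ← altSum_sub]
    refine altSum_congr fun y hy => ?_
    have := hl x hx
    have := hl y hy
    have h4 := sum_window (fun _ => 1) M (max x (y - d)) (by omega) (by omega)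
    simp only [one_mul] at h4
    rw [h4]
    simp
    omega
  rw [h2, altSum_sub, altSum_sub, altSum_const, h.zeroth, h.first, autoCorr]
  ring

theorem hookProd_eq (h : Good n l) (hl : ∀ y ∈ l, -(M : ℤ) ≤ y ∧ y ≤ M) :
    hookProd (betaSet M l) =
      ∏ d ∈ range (2 * M), d ^ (autoCorr (fun z => max 0 (z - d)) l).toNat := by
  let P : Finset (ℕ × ℕ) := {p ∈ range (2 * M) ×ˢ range (2 * M) |
    p.2 < p.1 ∧ gapAt l ((p.1 : ℤ) - M) = 0 ∧ gapAt l ((p.2 : ℤ) - M) = 1}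
  have h01 := gapAt_01 l h.spaced
  have e1 : hookProd (betaSet M l) = ∏ p ∈ P, (p.1 - p.2) := by
    rw [hookProd]
    symm
    refine prod_finset_product' P _ _ ?_
    rintro ⟨x, y⟩
    have := h01 ((y : ℤ) - M)
    simp only [P, betaSet, mem_filter, mem_product, mem_range, mem_sdiff, not_and]
    constructor
    · rintro ⟨⟨a, b⟩, c, d, e⟩
      exact ⟨⟨a, d⟩, c, fun _ => by omega⟩
    · rintro ⟨⟨a, d⟩, c, e⟩
      have := e (by omega)
      refine ⟨⟨a, by omega⟩, c, d, by omega⟩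
  rw [e1, ← prod_fiberwise_of_maps_to (s := P) (t := range (2 * M)) (g := fun p => p.1 - p.2) (by
    rintro ⟨x, y⟩ hp
    simp only [P, mem_filter, mem_product, mem_range] at hp ⊢
    omega)]
  refine prod_congr rfl fun d hd => ?_
  rw [prod_congr rfl (g := fun _ => d) (by
    intro p hp
    exact (mem_filter.1 hp).2), prod_const]
  rcases Nat.eq_zero_or_pos d with rfl | hd0
  · have c1 : ({p ∈ P | p.1 - p.2 = 0} : Finset _) = ∅ := by
      rw [filter_eq_empty_iff]
      rintro ⟨x, y⟩ hp
      simp only [P, mem_filter, mem_product, mem_range] at hp ⊢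
      omega
    have c2 : autoCorr (fun z => max 0 (z - (0 : ℕ))) l = 0 := by
      rw [← hook_count h hl 0]
      refine sum_eq_zero fun k _ => ?_
      rcases h01 ((k : ℤ) - M) with h1 | h1 <;> simp [h1]
    rw [c1, c2]
    rfl
  · congr 1
    rw [← hook_count h hl d]
    have c1 : ∑ k ∈ range (2 * M), gapAt l ((k : ℤ) - M) * (1 - gapAt l ((k : ℤ) - M + d)) =
        (({k ∈ range (2 * M) | gapAt l ((k : ℤ) - M) = 1 ∧ gapAt l ((k : ℤ) - M + d) = 0} :
          Finset ℕ).card : ℤ) := by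
      rw [card_filter, Nat.cast_sum]
      refine sum_congr rfl fun k _ => ?_
      rcases h01 ((k : ℤ) - M) with h1 | h1 <;> rcases h01 ((k : ℤ) - M + d) with h2 | h2 <;>
        simp [h1, h2]
    rw [c1, Int.toNat_natCast]
    refine card_bij (fun p _ => p.2) ?_ ?_ ?_
    · rintro ⟨x, y⟩ hp
      simp only [P, mem_filter, mem_product, mem_range] at hp ⊢
      refine ⟨by omega, by omega, ?_⟩
      rw [show ((y : ℤ) - M + d) = (x : ℤ) - M by omega]
      omega
    · rintro ⟨x, y⟩ hp ⟨x', y'⟩ hp' hy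
      simp only [P, mem_filter, mem_product, mem_range] at hp hp' hy
      ext <;> simp <;> omega
    · intro k hk
      simp only [mem_filter, mem_range] at hk
      have hlt : k + d < 2 * M := by
        by_contra hge
        have := gapAt_right l ((k : ℤ) - M + d) (fun y hy => by have := hl y hy; omega)
        rw [h.zeroth] at this
        omega
      refine ⟨(k + d, k), ?_, rfl⟩
      simp only [P, mem_filter, mem_product, mem_range]
      refine ⟨⟨⟨hlt, hk.1⟩, by omega, ?_, hk.2.1⟩, by omega⟩
      rw [← hk.2.2]
      congr 1
      push_cast
      ring

theorem betaSet_inj {n' : ℕ} {l' : List ℤ} (h : Good n l) (hl : ∀ y ∈ l, -(M : ℤ) ≤ y ∧ y ≤ M)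
    (h' : Good n' l') (hl' : ∀ y ∈ l', -(M : ℤ) ≤ y ∧ y ≤ M)
    (e : betaSet M l = betaSet M l') : l = l' := by
  refine gapAt_inj l l' h.spaced h'.spaced fun x => ?_
  by_cases hx1 : x < -M
  · rw [gapAt_left l x (fun y hy => by have := hl y hy; omega),
      gapAt_left l' x (fun y hy => by have := hl' y hy; omega)]
  by_cases hx2 : (M : ℤ) ≤ x
  · rw [gapAt_right l x (fun y hy => by have := hl y hy; omega),
      gapAt_right l' x (fun y hy => by have := hl' y hy; omega), h.zeroth, h'.zeroth]
  have h1 : (x + M).toNat ∈ betaSet M l ↔ (x + M).toNat ∈ betaSet M l' := by rw [e]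
  have h2 : ((x + M).toNat : ℤ) - M = x := by omega
  simp only [betaSet, mem_filter, mem_range, h2] at h1
  have h3 : (x + M).toNat < 2 * M := by omega
  have := gapAt_01 l h.spaced x
  have := gapAt_01 l' h'.spaced x
  omega

theorem exists_bound (F : Finset (List ℤ)) : ∃ M : ℕ, ∀ l ∈ F, ∀ y ∈ l, -(M : ℤ) ≤ y ∧ y ≤ M := by
  refine ⟨∑ l ∈ F, (l.map Int.natAbs).sum, fun l hl y hy => ?_⟩
  have h1 : (l.map Int.natAbs).sum ≤ ∑ l ∈ F, (l.map Int.natAbs).sum :=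
    single_le_sum (f := fun l : List ℤ => (l.map Int.natAbs).sum) (fun _ _ => Nat.zero_le _) hl
  have h2 : y.natAbs ≤ (l.map Int.natAbs).sum :=
    List.le_sum_of_mem (List.mem_map_of_mem hy)
  omega

theorem pow_bound (i : ℕ) (hi : 5 ≤ i) : 2000 * 17 ^ i ≤ 3 * 81 ^ i := by
  induction i, hi using Nat.le_induction with
  | base => norm_num
  | succ k _ ih => rw [pow_succ, pow_succ]; omega

end Transfer

theorem stmt5 :
    ∃ i₀ : ℕ, ∀ i ≥ i₀, ∀ n : ℕ, 3 * 81 ^ i ≤ n →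
      2 ^ i ≤ maxMult (Equiv.Perm (Fin n)) := by
  refine ⟨5, fun i hi n hn => ?_⟩
  obtain ⟨F, hF1, hF2, hF3⟩ := good_family i n ((pow_bound i hi).trans hn)
  obtain ⟨M, hM⟩ := exists_bound F
  let e : Fin (2 ^ i) ≃ F := (F.equivFinOfCardEq hF1).symm
  refine maxMult_of_family (M := M) (fun a => betaSet M (e a).1) ?_ ?_ ?_ ?_
  · intro a b hab
    have := betaSet_inj (hF2 _ (e a).2) (hM _ (e a).2) (hF2 _ (e b).2) (hM _ (e b).2) hab
    exact e.injective (Subtype.ext this)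
  · intro a
    exact beta_card (hF2 _ (e a).2) (hM _ (e a).2)
  · intro a
    exact beta_total (hF2 _ (e a).2) (hM _ (e a).2)
  · intro a b
    rw [hookProd_eq (hF2 _ (e a).2) (hM _ (e a).2), hookProd_eq (hF2 _ (e b).2) (hM _ (e b).2)]
    refine Finset.prod_congr rfl fun d _ => ?_
    rw [hF3 _ (e a).2 _ (e b).2]
end

section
/- For all sufficiently large n, the symmetric group S_n has at least n^{1/7} irreducible complex characters of the same degree; that is, there exists n₀ such that for all n ≥ n₀, m(S_n) ≥ n^{1/7}. -/
open CategoryTheory Module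

/-! ### Beta-sets and the number of paths -/

open Polynomial in
theorem lag_aux (S : Finset ℕ) :
    let g : ℚ[X] := ∏ y ∈ S, (X - C (y : ℚ))
    let g1 : ℚ[X] := ∏ y ∈ S, (X - C ((y : ℚ) + 1))
    let P : ℚ[X] := (X - C (S.card : ℚ)) * g - X * g1
    P.degree < (S.card : WithBot ℕ) ∧
      P.coeff (S.card - 1) = ∑ y ∈ S, (y : ℚ) - (S.card : ℚ) * (S.card - 1) / 2 := by
  induction S using Finset.induction_on with
  | empty => simp
  | insert u S hu ih =>
    intro g g1 P
    set g' : ℚ[X] := ∏ y ∈ S, (X - C (y : ℚ)) with hg'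
    set g1' : ℚ[X] := ∏ y ∈ S, (X - C ((y : ℚ) + 1)) with hg1'
    set P' : ℚ[X] := (X - C (S.card : ℚ)) * g' - X * g1' with hP'
    obtain ⟨ih1, ih2⟩ : P'.degree < (S.card : WithBot ℕ) ∧
      P'.coeff (S.card - 1) = ∑ y ∈ S, (y : ℚ) - (S.card : ℚ) * (S.card - 1) / 2 := ih
    clear_value P'
    have hmon : g'.Monic := monic_prod_of_monic _ _ fun y _ => monic_X_sub_C _
    have hdeg : g'.natDegree = S.card := by
      rw [hg', natDegree_prod_of_monic _ _ fun y _ => monic_X_sub_C _]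
      simp only [natDegree_X_sub_C, Finset.sum_const, smul_eq_mul, mul_one]
    have hP : P = (X - C ((u : ℚ) + 1)) * P' + C ((u : ℚ) - S.card) * g' := by
      simp only [P, g, g1, Finset.prod_insert hu, Finset.card_insert_of_notMem hu, hP', ← hg', ← hg1']
      simp only [map_add, map_sub, map_one, Nat.cast_add, Nat.cast_one]
      ring
    have hcard : (insert u S).card = S.card + 1 := Finset.card_insert_of_notMem hu
    have hc0 : ∀ m, S.card ≤ m → P'.coeff m = 0 := fun m hm =>
      coeff_eq_zero_of_degree_lt (lt_of_lt_of_le ih1 (by exact_mod_cast hm))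
    have hg0 : ∀ m, S.card < m → g'.coeff m = 0 := fun m hm =>
      coeff_eq_zero_of_natDegree_lt (by omega)
    have hgt : g'.coeff S.card = 1 := by rw [← hdeg]; exact hmon
    rw [hcard, Finset.sum_insert hu]
    constructor
    · rw [degree_lt_iff_coeff_zero]
      intro m hm
      obtain ⟨m, rfl⟩ : ∃ j, m = j + 1 := ⟨m - 1, by omega⟩
      rw [hP, sub_mul]
      simp only [coeff_add, coeff_sub, coeff_X_mul, coeff_C_mul]
      rw [hc0 m (by omega), hc0 (m+1) (by omega), hg0 (m+1) (by omega)]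
      simp
    · rw [hP, sub_mul]
      simp only [coeff_add, coeff_sub, coeff_C_mul, Nat.add_sub_cancel]
      rw [hc0 _ le_rfl, hgt]
      rcases Nat.eq_zero_or_pos S.card with h0 | h0
      · have : S = ∅ := Finset.card_eq_zero.mp h0
        subst this
        simp
      · obtain ⟨m, hm⟩ : ∃ j, S.card = j + 1 := ⟨S.card - 1, by omega⟩
        rw [hm] at ih2 ⊢
        rw [coeff_X_mul]
        simp only [Nat.add_sub_cancel] at ih2
        rw [ih2]
        push_cast
        ring

theorem lag_sum (S : Finset ℕ) :
    ∑ y ∈ S, (y : ℚ) * ∏ z ∈ S.erase y, (((y : ℚ) - 1 - z) / (y - z)) =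
      ∑ y ∈ S, (y : ℚ) - (S.card : ℚ) * (S.card - 1) / 2 := by
  obtain ⟨h1, h2⟩ := lag_aux S
  rw [← h2, Lagrange.coeff_eq_sum (s := S) (v := fun y : ℕ => (y : ℚ))
    (fun a _ b _ h => Nat.cast_injective h) h1]
  refine Finset.sum_congr rfl fun y hy => ?_
  rw [Finset.prod_div_distrib, ← mul_div_assoc]
  congr 1
  simp only [Polynomial.eval_sub, Polynomial.eval_mul, Polynomial.eval_prod, Polynomial.eval_X,
    Polynomial.eval_C]
  rw [Finset.prod_eq_zero hy (sub_self _)]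
  rw [← Finset.mul_prod_erase S (fun z : ℕ => (y : ℚ) - ((z : ℚ) + 1)) hy]
  have : ∀ z : ℕ, (y : ℚ) - ((z : ℚ) + 1) = (y : ℚ) - 1 - z := fun z => by ring
  simp only [this]
  ring

/-- Move the bead at `x` to `x + 1`. -/
def mv (S : Finset ℕ) (x : ℕ) : Finset ℕ := insert (x + 1) (S.erase x)

/-- Move the bead at `y` to `y - 1`. -/
def mvd (S : Finset ℕ) (y : ℕ) : Finset ℕ := insert (y - 1) (S.erase y)

/-- Beads which can be moved down. -/
def rem (S : Finset ℕ) : Finset ℕ := S.filter fun y => 1 ≤ y ∧ y - 1 ∉ S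

/-- State after `t` letters of a content word. -/
def st (k : ℕ) (c : ℕ → ℕ) : ℕ → Finset ℕ
  | 0 => Finset.range k
  | t + 1 => mv (st k c t) (c t)

/-- Valid content words (standard tableaux). -/
def Val (k n : ℕ) (S : Finset ℕ) (c : ℕ → ℕ) : Prop :=
  (∀ t < n, c t ∈ st k c t ∧ c t + 1 ∉ st k c t) ∧ (∀ t, n ≤ t → c t = 0) ∧ st k c n = S

theorem st_congr (k : ℕ) (c d : ℕ → ℕ) (t : ℕ) (h : ∀ s < t, c s = d s) : st k c t = st k d t := by
  induction t with
  | zero => rfl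
  | succ t ih =>
    rw [st, st, ih fun s hs => h s (by omega), h t (by omega)]

theorem mvd_mv (S : Finset ℕ) (x : ℕ) (h : x ∈ S) (h' : x + 1 ∉ S) : mvd (mv S x) (x + 1) = S := by
  ext z; simp only [mvd, mv, Finset.mem_insert, Finset.mem_erase]; grind

theorem mv_mvd (S : Finset ℕ) (y : ℕ) (h : y ∈ rem S) : mv (mvd S y) (y - 1) = S := by
  simp only [rem, Finset.mem_filter] at h
  ext z; simp only [mvd, mv, Finset.mem_insert, Finset.mem_erase]; grind

theorem mem_rem_mv (S : Finset ℕ) (x : ℕ) : x + 1 ∈ rem (mv S x) := by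
  simp [rem, mv]

theorem mem_mvd (S : Finset ℕ) (y : ℕ) (h : y ∈ rem S) :
    y - 1 ∈ mvd S y ∧ y - 1 + 1 ∉ mvd S y := by
  simp only [rem, Finset.mem_filter] at h
  simp only [mvd, Finset.mem_insert, Finset.mem_erase]; grind

theorem card_mv (S : Finset ℕ) (x : ℕ) (h : x ∈ S) (h' : x + 1 ∉ S) : (mv S x).card = S.card := by
  rw [mv, Finset.card_insert_of_notMem (by simp [h']), Finset.card_erase_of_mem h]
  have := Finset.card_pos.mpr ⟨x, h⟩
  omega

theorem sum_mv (S : Finset ℕ) (x : ℕ) (h : x ∈ S) (h' : x + 1 ∉ S) :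
    ∑ y ∈ mv S x, y = ∑ y ∈ S, y + 1 := by
  rw [mv, Finset.sum_insert (by simp [h']), ← Finset.add_sum_erase S (fun y => y) h]
  ring

theorem mv_mv_card_sum (S : Finset ℕ) (y : ℕ) (h : y ∈ rem S) :
    (mvd S y).card = S.card ∧ ∑ z ∈ mvd S y, z + 1 = ∑ z ∈ S, z := by
  have h1 := mem_mvd S y h
  have h2 := card_mv _ _ h1.1 h1.2
  have h3 := sum_mv _ _ h1.1 h1.2
  rw [mv_mvd S y h] at h2 h3
  exact ⟨h2.symm, h3.symm⟩

theorem val_card_sum (k n : ℕ) (S : Finset ℕ) (c : ℕ → ℕ) (h : Val k n S c) :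
    S.card = k ∧ ∑ y ∈ S, y = ∑ y ∈ Finset.range k, y + n := by
  obtain ⟨h1, -, rfl⟩ := h
  induction n with
  | zero => simp [st]
  | succ n ih =>
    obtain ⟨ih1, ih2⟩ := ih fun t ht => h1 t (by omega)
    have := h1 n (by omega)
    rw [st, card_mv _ _ this.1 this.2, sum_mv _ _ this.1 this.2, ih1, ih2]
    exact ⟨rfl, by ring⟩

theorem val_succ (k n : ℕ) (S : Finset ℕ) (c : ℕ → ℕ) :
    Val k (n + 1) S c ↔ c n + 1 ∈ rem S ∧ Val k n (mvd S (c n + 1)) (Function.update c n 0) := by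
  have hst : ∀ t ≤ n, st k (Function.update c n 0) t = st k c t := fun t ht =>
    st_congr _ _ _ _ fun s hs => by rw [Function.update_of_ne (by omega)]
  constructor
  · rintro ⟨h1, h2, rfl⟩
    have hn := h1 n (by omega)
    refine ⟨by rw [st]; exact mem_rem_mv _ _, ?_, ?_, ?_⟩
    · intro t ht
      rw [hst t ht.le, Function.update_of_ne (by omega)]
      exact h1 t (by omega)
    · intro t ht
      rcases eq_or_ne t n with rfl | h
      · simp
      · rw [Function.update_of_ne h]; exact h2 t (by omega)
    · rw [hst n le_rfl, st, mvd_mv _ _ hn.1 hn.2]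
  · rintro ⟨h0, h1, h2, h3⟩
    rw [hst n le_rfl] at h3
    refine ⟨?_, ?_, ?_⟩
    · intro t ht
      rcases eq_or_ne t n with rfl | h
      · rw [h3]; simpa using mem_mvd S _ h0
      · have := h1 t (by omega)
        rwa [hst t (by omega), Function.update_of_ne h] at this
    · intro t ht
      have := h2 t (by omega)
      rwa [Function.update_of_ne (by omega)] at this
    · rw [st, h3]; simpa using mv_mvd S _ h0

/-- Append a letter. -/
def appE (n x : ℕ) : (ℕ → ℕ) ↪ (ℕ → ℕ) where
  toFun c t := c t + if t = n then x else 0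
  inj' := fun c d h => by
    funext t; have := congrFun h t; simpa using this

theorem appE_apply (n x : ℕ) (c : ℕ → ℕ) :
    appE n x c = fun t => c t + if t = n then x else 0 := rfl

open scoped Classical in
/-- The finite set of valid words. -/
noncomputable def Wd (k : ℕ) : ℕ → Finset ℕ → Finset (ℕ → ℕ)
  | 0, S => if S = Finset.range k then {fun _ => 0} else ∅
  | n + 1, S => (rem S).biUnion fun y =>
      (Wd k n (mvd S y)).map (appE n (y - 1))

theorem mem_Wd (k n : ℕ) (S : Finset ℕ) (c : ℕ → ℕ) : c ∈ Wd k n S ↔ Val k n S c := by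
  induction n generalizing S c with
  | zero =>
    simp only [Wd, Val, st]
    split_ifs with h
    · simp [h, funext_iff]
    · simp [Ne.symm h]
  | succ n ih =>
    simp only [Wd, Finset.mem_biUnion, Finset.mem_map, appE_apply, val_succ, ih]
    constructor
    · rintro ⟨y, hy, d, hd, rfl⟩
      have hy1 : 1 ≤ y := by simp only [rem, Finset.mem_filter] at hy; exact hy.2.1
      have hdn : d n = 0 := hd.2.1 n le_rfl
      have e1 : d n + (if n = n then y - 1 else 0) + 1 = y := by simp [hdn]; omega
      have e2 : Function.update (fun t => d t + if t = n then y - 1 else 0) n 0 = d := by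
        funext t
        rcases eq_or_ne t n with rfl | h
        · simp [hdn]
        · simp [h]
      beta_reduce
      rw [e1, e2]
      exact ⟨hy, hd⟩
    · rintro ⟨h1, h2⟩
      refine ⟨c n + 1, h1, _, h2, ?_⟩
      funext t
      rcases eq_or_ne t n with rfl | h
      · simp
      · simp [h]

open scoped Classical in
theorem card_Wd_succ (k n : ℕ) (S : Finset ℕ) :
    (Wd k (n + 1) S).card = ∑ y ∈ rem S, (Wd k n (mvd S y)).card := by
  rw [Wd, Finset.card_biUnion]
  · simp
  · intro y hy z hz hyz
    rw [Function.onFun, Finset.disjoint_left]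
    intro c hc hd
    simp only [Finset.mem_map, appE_apply] at hc hd
    obtain ⟨c', hc', rfl⟩ := hc
    obtain ⟨d', hd', h⟩ := hd
    have := congrFun h n
    beta_reduce at this
    have h1 := ((mem_Wd _ _ _ _).1 hc').2.1 n le_rfl
    have h2 := ((mem_Wd _ _ _ _).1 hd').2.1 n le_rfl
    simp only [rem, Finset.mem_filter, Finset.mem_coe] at hy hz
    simp [h1, h2] at this
    omega

/-- Absolute value of the Vandermonde product. -/
def Vd (S : Finset ℕ) : ℚ := ∏ y ∈ S, ∏ z ∈ S with z < y, ((y : ℚ) - z)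

theorem Vd_insert (S : Finset ℕ) (u : ℕ) (hu : u ∉ S) :
    Vd (insert u S) = Vd S * ∏ z ∈ S, |(u : ℚ) - z| := by
  rw [Vd, Finset.prod_insert hu]
  have h1 : (insert u S).filter (· < u) = S.filter (· < u) := by
    rw [Finset.filter_insert]; simp
  have h2 : ∀ y ∈ S, ∏ z ∈ insert u S with z < y, ((y : ℚ) - z) =
      (if u < y then ((y : ℚ) - u) else 1) * ∏ z ∈ S with z < y, ((y : ℚ) - z) := by
    intro y hy
    rw [Finset.filter_insert]
    split_ifs with h
    · rw [Finset.prod_insert (by simp [hu])]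
    · simp
  rw [h1, Finset.prod_congr rfl h2, Finset.prod_mul_distrib, Finset.prod_filter, ← mul_assoc,
    ← Finset.prod_mul_distrib, mul_comm, Vd]
  congr 1
  refine Finset.prod_congr rfl fun z hz => ?_
  have : z ≠ u := fun h => hu (h ▸ hz)
  rcases lt_or_gt_of_ne this with h | h
  · have h' : (z : ℚ) < u := by exact_mod_cast h
    rw [if_pos h, if_neg (by omega), abs_of_pos (by linarith)]; ring
  · have h' : (u : ℚ) < z := by exact_mod_cast h
    rw [if_neg (by omega), if_pos h, abs_of_neg (by linarith)]; ring

/-- The product of the factorials. -/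
def Fc (S : Finset ℕ) : ℚ := ∏ y ∈ S, (y.factorial : ℚ)

theorem Fc_ne (S : Finset ℕ) : Fc S ≠ 0 :=
  Finset.prod_ne_zero_iff.mpr fun y _ => by positivity

theorem ratio (S : Finset ℕ) (y : ℕ) (hy : y ∈ rem S) :
    Vd (mvd S y) / Fc (mvd S y) =
      Vd S / Fc S * ((y : ℚ) * ∏ z ∈ S.erase y, (((y : ℚ) - 1 - z) / (y - z))) := by
  simp only [rem, Finset.mem_filter] at hy
  obtain ⟨h1, h2, h3⟩ := hy
  have hn : y - 1 ∉ S.erase y := by simp [h3]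
  have hS : insert y (S.erase y) = S := Finset.insert_erase h1
  have hV : Vd S = Vd (S.erase y) * ∏ z ∈ S.erase y, |(y : ℚ) - z| := by
    conv_lhs => rw [← hS]
    exact Vd_insert _ _ (by simp)
  have hF : Fc S = y.factorial * Fc (S.erase y) := by
    rw [Fc, Fc]; exact (Finset.mul_prod_erase S _ h1).symm
  have hF' : Fc (mvd S y) = (y - 1).factorial * Fc (S.erase y) := by
    rw [Fc, mvd, Finset.prod_insert hn, Fc]
  have hy' : (y.factorial : ℚ) = y * (y - 1).factorial := by
    exact_mod_cast (Nat.mul_factorial_pred (by omega)).symm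
  rw [hV, hF, hF', mvd, Vd_insert _ _ hn, hy']
  have hne : ∀ z ∈ S.erase y, |(y : ℚ) - z| ≠ 0 := by
    intro z hz
    rw [abs_ne_zero, sub_ne_zero]
    exact_mod_cast (Finset.ne_of_mem_erase hz).symm
  have hp : ∏ z ∈ S.erase y, |((y - 1 : ℕ) : ℚ) - z| =
      (∏ z ∈ S.erase y, |(y : ℚ) - z|) * ∏ z ∈ S.erase y, (((y : ℚ) - 1 - z) / (y - z)) := by
    rw [← Finset.prod_mul_distrib]
    refine Finset.prod_congr rfl fun z hz => ?_
    have hzy : z ≠ y := Finset.ne_of_mem_erase hz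
    have hzy' : z ≠ y - 1 := fun h => h3 (h ▸ Finset.mem_of_mem_erase hz)
    push_cast [Nat.cast_sub h2]
    rcases lt_or_gt_of_ne hzy with h | h
    · have h' : (z : ℚ) + 1 ≤ y := by exact_mod_cast h
      rw [abs_of_nonneg (by linarith), abs_of_pos (by linarith), mul_div_cancel₀]
      linarith
    · have h' : (y : ℚ) + 1 ≤ z := by exact_mod_cast h
      have : (y : ℚ) - z ≠ 0 := by linarith
      rw [abs_of_neg (by linarith), abs_of_neg (by linarith)]
      field_simp
  rw [hp]
  have hy0 : (y : ℚ) ≠ 0 := by positivity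
  have := Fc_ne (S.erase y)
  field_simp

theorem le_max_card (S : Finset ℕ) (k : ℕ) (h : S.card = k + 1) (hne : S.Nonempty) :
    k ≤ S.max' hne := by
  by_contra hlt
  have : S ⊆ Finset.range k := fun z hz => by
    have := Finset.le_max' S z hz
    simp; omega
  have := Finset.card_le_card this
  simp at this; omega

theorem sum_range_card_le (S : Finset ℕ) (k : ℕ) (h : S.card = k) :
    ∑ y ∈ Finset.range k, y ≤ ∑ y ∈ S, y := by
  induction k generalizing S with
  | zero => simp
  | succ k ih =>
    have hne : S.Nonempty := Finset.card_pos.mp (by omega)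
    have hmax := Finset.max'_mem S hne
    have hk := le_max_card S k h hne
    rw [← Finset.add_sum_erase S (fun y => y) hmax, Finset.sum_range_succ]
    have := ih (S.erase (S.max' hne)) (by rw [Finset.card_erase_of_mem hmax]; omega)
    omega

theorem sum_eq_range (S : Finset ℕ) (k : ℕ) (h : S.card = k)
    (hs : ∑ y ∈ S, y = ∑ y ∈ Finset.range k, y) : S = Finset.range k := by
  induction k generalizing S with
  | zero => simpa using h
  | succ k ih =>
    have hne : S.Nonempty := Finset.card_pos.mp (by omega)
    have hmax := Finset.max'_mem S hne
    set M := S.max' hne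
    have hk : k ≤ M := le_max_card S k h hne
    have h1 := sum_range_card_le (S.erase M) _ rfl
    rw [Finset.card_erase_of_mem hmax, h, Nat.add_sub_cancel] at h1
    rw [← Finset.add_sum_erase S (fun y => y) hmax, Finset.sum_range_succ] at hs
    have hM : M = k := by omega
    have := ih (S.erase M) (by rw [Finset.card_erase_of_mem hmax]; omega) (by omega)
    rw [← Finset.insert_erase hmax, this, hM, Finset.range_add_one]

theorem card_formula (k n : ℕ) (S : Finset ℕ) (h : S.card = k)
    (hs : ∑ y ∈ S, y = ∑ y ∈ Finset.range k, y + n) :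
    ((Wd k n S).card : ℚ) = n.factorial * (Vd S / Fc S) := by
  induction n generalizing S with
  | zero =>
    have := sum_eq_range S k h (by simpa using hs)
    subst this
    simp only [Wd, if_true, Finset.card_singleton, Nat.factorial_zero, Nat.cast_one, one_mul]
    have : Vd (Finset.range k) = Fc (Finset.range k) := by
      rw [Vd, Fc]
      refine Finset.prod_congr rfl fun y hy => ?_
      have : (Finset.range k).filter (· < y) = Finset.range y := by
        ext z; simp at hy ⊢; omega
      rw [this, ← Finset.prod_range_reflect, ← Finset.prod_range_add_one_eq_factorial]
      push_cast
      refine Finset.prod_congr rfl fun z hz => ?_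
      simp at hz
      rw [Nat.cast_sub (by omega), Nat.cast_sub (by omega)]; push_cast; ring
    rw [this, div_self (Fc_ne _)]
  | succ n ih =>
    rw [card_Wd_succ]
    push_cast
    have h1 : ∀ y ∈ rem S, ((Wd k n (mvd S y)).card : ℚ) = n.factorial * (Vd S / Fc S) *
        ((y : ℚ) * ∏ z ∈ S.erase y, (((y : ℚ) - 1 - z) / (y - z))) := by
      intro y hy
      obtain ⟨e1, e2⟩ := mv_mv_card_sum S y hy
      rw [ih _ (e1.trans h) (by omega), ratio S y hy, mul_assoc]
    rw [Finset.sum_congr rfl h1, ← Finset.mul_sum]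
    have h2 : ∑ y ∈ rem S, ((y : ℚ) * ∏ z ∈ S.erase y, (((y : ℚ) - 1 - z) / (y - z))) =
        ∑ y ∈ S, ((y : ℚ) * ∏ z ∈ S.erase y, (((y : ℚ) - 1 - z) / (y - z))) := by
      refine Finset.sum_subset (Finset.filter_subset _ _) fun y hy hy' => ?_
      rcases Nat.eq_zero_or_pos y with rfl | hpos
      · simp
      · have : y - 1 ∈ S := by
          by_contra hh; exact hy' (Finset.mem_filter.mpr ⟨hy, hpos, hh⟩)
        rw [Finset.prod_eq_zero (i := y - 1) (by simp [this]; omega), mul_zero]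
        rw [Nat.cast_sub hpos]; simp
    rw [h2, lag_sum]
    have h3 : (∑ y ∈ S, (y : ℚ)) = (k : ℚ) * (k - 1) / 2 + (n + 1) := by
      have : ((∑ y ∈ S, y : ℕ) : ℚ) = ((∑ y ∈ Finset.range k, y + (n + 1) : ℕ) : ℚ) := by rw [hs]
      push_cast at this
      rw [this]
      congr 1
      clear * -
      induction k with
      | zero => simp
      | succ k ih => rw [Finset.sum_range_succ, ih]; push_cast; ring
    rw [h3, h, Nat.factorial_succ]
    push_cast
    ring

/-- The product of the hook lengths. -/
def Hk (S : Finset ℕ) : ℚ := ∏ y ∈ S, ∏ z ∈ Finset.range y with z ∉ S, ((y : ℚ) - z)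

theorem Vd_ne (S : Finset ℕ) : Vd S ≠ 0 := by
  refine Finset.prod_ne_zero_iff.mpr fun y _ => Finset.prod_ne_zero_iff.mpr fun z hz => ?_
  have : (z : ℚ) < y := by exact_mod_cast (Finset.mem_filter.mp hz).2
  linarith

theorem Fc_eq (S : Finset ℕ) : Fc S = Vd S * Hk S := by
  rw [Fc, Vd, Hk, ← Finset.prod_mul_distrib]
  refine Finset.prod_congr rfl fun y _ => ?_
  have e : S.filter (· < y) = (Finset.range y).filter (· ∈ S) := by
    ext z; simp [and_comm]
  rw [e, Finset.prod_filter_mul_prod_filter_not, ← Finset.prod_range_reflect,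
    ← Finset.prod_range_add_one_eq_factorial]
  push_cast
  refine Finset.prod_congr rfl fun z hz => ?_
  simp at hz
  rw [Nat.cast_sub (by omega), Nat.cast_sub (by omega)]; push_cast; ring

theorem hook_formula_s6 (k n : ℕ) (S : Finset ℕ) (h : S.card = k)
    (hs : ∑ y ∈ S, y = ∑ y ∈ Finset.range k, y + n) :
    ((Wd k n S).card : ℚ) = n.factorial / Hk S := by
  rw [card_formula k n S h hs, Fc_eq]
  have := Vd_ne S
  field_simp

theorem Wd_nonempty (k n : ℕ) (S : Finset ℕ) (h : S.card = k)
    (hs : ∑ y ∈ S, y = ∑ y ∈ Finset.range k, y + n) : (Wd k n S).Nonempty := by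
  rw [← Finset.card_pos]
  have h1 := card_formula k n S h hs
  have : ((Wd k n S).card : ℚ) ≠ 0 := by
    rw [h1]
    exact mul_ne_zero (by positivity) (div_ne_zero (Vd_ne S) (Fc_ne S))
  exact Nat.pos_of_ne_zero (by exact_mod_cast this)

/-! ### Coxeter presentation of the symmetric group -/

section Cox
variable {G : Type*} [Group G]

/-- The product `g m * g (m-1) * ... ` of length `d`. -/
def cU (g : ℕ → G) (m : ℕ) : ℕ → G
  | 0 => 1
  | d + 1 => cU g m d * g (m - d)

/-- Coxeter relations of type `A` for the first `m` members of a sequence. -/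
structure CoxRel (g : ℕ → G) (m : ℕ) : Prop where
  sq : ∀ i < m, g i * g i = 1
  br : ∀ i, i + 1 < m → g i * g (i + 1) * g i = g (i + 1) * g i * g (i + 1)
  cm : ∀ i j, i + 1 < j → j < m → g i * g j = g j * g i

theorem cU_comm (g : ℕ → G) (m : ℕ) (h : CoxRel g (m + 1)) (d i : ℕ) (hd : i + d < m) :
    cU g m d * g i = g i * cU g m d := by
  induction d with
  | zero => simp [cU]
  | succ d ih =>
    rw [cU, mul_assoc, ← h.cm i (m - d) (by omega) (by omega), ← mul_assoc, ih (by omega), mul_assoc]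

theorem cU_shift (g : ℕ → G) (m : ℕ) (h : CoxRel g (m + 1)) (d i : ℕ) (hd : d ≤ m + 1)
    (hi : m < i + d) (hi' : i < m) :
    cU g m d * g (i + 1) = g i * cU g m d := by
  induction d with
  | zero => omega
  | succ d ih =>
    by_cases hlt : m < i + d
    · rw [cU, mul_assoc, h.cm (m - d) (i + 1) (by omega) (by omega), ← mul_assoc,
        ih (by omega) hlt, mul_assoc]
    · have hi2 : m = i + d := by omega
      obtain ⟨e, rfl⟩ : ∃ e, d = e + 1 := ⟨d - 1, by omega⟩
      have e1 : m - (e + 1) = i := by omega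
      have e2 : m - e = i + 1 := by omega
      rw [cU, cU, e1, e2]
      have := h.br i (by omega)
      have hc := cU_comm g m h e i (by omega)
      calc cU g m e * g (i + 1) * g i * g (i + 1) = cU g m e * (g (i + 1) * g i * g (i + 1)) := by
            group
        _ = cU g m e * (g i * g (i + 1) * g i) := by rw [this]
        _ = (cU g m e * g i) * g (i + 1) * g i := by group
        _ = _ := by rw [hc]; group

theorem CoxRel.mono {g : ℕ → G} {m : ℕ} (h : CoxRel g (m + 1)) : CoxRel g m :=
  ⟨fun i hi => h.sq i (by omega), fun i hi => h.br i (by omega), fun i j hi hj =>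
    h.cm i j hi (by omega)⟩

theorem cox_bound (g : ℕ → G) (m : ℕ) (h : CoxRel g m) :
    (Subgroup.closure (g '' Set.Iio m) : Set G).Finite ∧
      (Subgroup.closure (g '' Set.Iio m) : Set G).ncard ≤ (m + 1).factorial := by
  induction m with
  | zero => simp
  | succ m ih =>
    obtain ⟨ih1, ih2⟩ := ih h.mono
    set K := Subgroup.closure (g '' Set.Iio m) with hK
    have hgK : ∀ i < m, g i ∈ K := fun i hi => Subgroup.subset_closure ⟨i, hi, rfl⟩
    set X : Set G := ⋃ d ∈ Finset.range (m + 2), (fun x => x * cU g m d) '' (K : Set G) with hX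
    have memX : ∀ x, x ∈ X ↔ ∃ d < m + 2, ∃ y ∈ K, y * cU g m d = x := by
      intro x
      simp only [hX, Set.mem_iUnion, Set.mem_image, Finset.mem_range, SetLike.mem_coe, exists_prop]
    have hmul : ∀ x ∈ X, ∀ i < m + 1, x * g i ∈ X := by
      intro x hx i hi
      obtain ⟨d, hd, y, hy, rfl⟩ := (memX _).1 hx
      rw [memX]
      rcases lt_trichotomy (i + d) m with hlt | heq | hgt
      · refine ⟨d, hd, y * g i, K.mul_mem hy (hgK i (by omega)), ?_⟩
        rw [mul_assoc, mul_assoc, cU_comm g m h d i hlt]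
      · refine ⟨d + 1, by omega, y, hy, ?_⟩
        rw [cU, show m - d = i by omega, mul_assoc]
      · rcases Nat.lt_or_ge (m + 1) (i + d) with h2 | h2
        · obtain ⟨j, rfl⟩ : ∃ j, i = j + 1 := ⟨i - 1, by omega⟩
          refine ⟨d, hd, y * g j, K.mul_mem hy (hgK j (by omega)), ?_⟩
          rw [mul_assoc, mul_assoc, cU_shift g m h d j (by omega) (by omega) (by omega)]
        · obtain ⟨e, rfl⟩ : ∃ e, d = e + 1 := ⟨d - 1, by omega⟩
          refine ⟨e, by omega, y, hy, ?_⟩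
          rw [cU, show m - e = i by omega, mul_assoc, mul_assoc, h.sq i hi, mul_one]
    have hsub : (Subgroup.closure (g '' Set.Iio (m + 1)) : Set G) ⊆ X := by
      intro x hx
      refine Subgroup.closure_induction_right (p := fun x _ => x ∈ X) ?_ ?_ ?_ hx
      · exact (memX _).2 ⟨0, by omega, 1, K.one_mem, by simp [cU]⟩
      · rintro x _ _ ⟨i, hi, rfl⟩ hx
        exact hmul x hx i hi
      · rintro x _ _ ⟨i, hi, rfl⟩ hx
        have : (g i)⁻¹ = g i := inv_eq_of_mul_eq_one_left (h.sq i hi)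
        rw [this]
        exact hmul x hx i hi
    have hXf : X.Finite := by
      rw [hX]
      exact Set.Finite.biUnion (Finset.finite_toSet _) fun d _ => ih1.image _
    refine ⟨hXf.subset hsub, (Set.ncard_le_ncard hsub hXf).trans ?_⟩
    calc X.ncard ≤ ∑ d ∈ Finset.range (m + 2), ((fun x => x * cU g m d) '' (K : Set G)).ncard :=
          Finset.set_ncard_biUnion_le _ _
      _ ≤ ∑ d ∈ Finset.range (m + 2), (m + 1).factorial :=
          Finset.sum_le_sum fun d _ => (Set.ncard_image_le ih1).trans ih2
      _ = (m + 1 + 1).factorial := by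
          rw [Finset.sum_const, Finset.card_range, smul_eq_mul, Nat.factorial_succ (m + 1)]

theorem cox_hom (g : ℕ → G) (m : ℕ) (h : CoxRel g m) :
    ∃ φ : Equiv.Perm (Fin (m + 1)) →* G,
      ∀ i : Fin m, φ (Equiv.swap i.castSucc i.succ) = g i := by
  let s : ℕ → Equiv.Perm (Fin (m + 1)) := fun i =>
    if hi : i < m then Equiv.swap (Fin.castSucc ⟨i, hi⟩) (Fin.succ ⟨i, hi⟩) else 1
  have hs : CoxRel s m := by
    refine ⟨?_, ?_, ?_⟩
    · intro i hi
      simp [s, hi]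
    · intro i hi
      have hi' : i < m := by omega
      simp only [s, hi, hi', dif_pos]
      have e : Fin.castSucc (⟨i + 1, hi⟩ : Fin m) = Fin.succ ⟨i, hi'⟩ := by
        ext; simp
      rw [e]
      rw [Equiv.swap_mul_swap_mul_swap, Equiv.swap_comm (Fin.castSucc _) (Fin.succ _),
        Equiv.swap_comm (Fin.succ ⟨i, hi'⟩) (Fin.succ _), Equiv.swap_mul_swap_mul_swap,
        Equiv.swap_comm]
      all_goals simp only [ne_eq, Fin.ext_iff, Fin.val_castSucc, Fin.val_succ]; omega
    · intro i j hij hj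
      have hi' : i < m := by omega
      simp only [s, hj, hi', dif_pos]
      refine (Equiv.Perm.Disjoint.commute ?_).eq
      intro x
      by_cases hx : x = Fin.castSucc ⟨i, hi'⟩ ∨ x = Fin.succ ⟨i, hi'⟩
      · right
        refine Equiv.swap_apply_of_ne_of_ne ?_ ?_ <;>
        · rintro rfl
          simp [Fin.ext_iff] at hx
          omega
      · left
        push Not at hx
        exact Equiv.swap_apply_of_ne_of_ne hx.1 hx.2
  let γ : ℕ → Equiv.Perm (Fin (m + 1)) × G := fun i => (s i, g i)
  have hγ : CoxRel γ m := by
    refine ⟨fun i hi => ?_, fun i hi => ?_, fun i j hi hj => ?_⟩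
    · exact Prod.ext (hs.sq i hi) (h.sq i hi)
    · exact Prod.ext (hs.br i hi) (h.br i hi)
    · exact Prod.ext (hs.cm i j hi hj) (h.cm i j hi hj)
  obtain ⟨hfin, hcard⟩ := cox_bound γ m hγ
  set Γ := Subgroup.closure (γ '' Set.Iio m) with hΓ
  let π : Γ →* Equiv.Perm (Fin (m + 1)) := (MonoidHom.fst _ _).comp Γ.subtype
  have hmem : ∀ i : Fin m, γ i ∈ Γ := fun i => Subgroup.subset_closure ⟨i, i.2, rfl⟩
  have hπ : ∀ i : Fin m, π ⟨γ i, hmem i⟩ = Equiv.swap i.castSucc i.succ := by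
    intro i
    simp [π, γ, s]
    rfl
  have hsurj : Function.Surjective π := by
    rw [← MonoidHom.mrange_eq_top, ← top_le_iff, ← Equiv.Perm.mclosure_swap_castSucc_succ,
      Submonoid.closure_le]
    rintro _ ⟨i, rfl⟩
    exact ⟨_, hπ i⟩
  have : Finite Γ := hfin
  have hbij : Function.Bijective π := by
    refine hsurj.bijective_of_nat_card_le ?_
    have hp : Nat.card (Equiv.Perm (Fin (m + 1))) = (m + 1).factorial := by
      rw [Nat.card_eq_fintype_card, Fintype.card_perm, Fintype.card_fin]
    rw [hp]
    exact hcard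
  let e := MulEquiv.ofBijective π hbij
  refine ⟨(MonoidHom.snd _ _).comp (Γ.subtype.comp e.symm.toMonoidHom), fun i => ?_⟩
  have : e.symm (Equiv.swap i.castSucc i.succ) = ⟨γ i, hmem i⟩ := by
    rw [MulEquiv.symm_apply_eq]
    exact (hπ i).symm
  simp [this, γ]

end Cox
/-! ### Young's orthogonal form -/

/-- The adjacent transposition on positions. -/
def sw (i : ℕ) : ℕ → ℕ := Equiv.swap i (i + 1)

theorem sw_l (i : ℕ) : sw i i = i + 1 := by simp [sw]
theorem sw_r (i : ℕ) : sw i (i + 1) = i := by simp [sw]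
theorem sw_ne (i j : ℕ) (h : j ≠ i) (h' : j ≠ i + 1) : sw i j = j := by
  simp [sw, Equiv.swap_apply_of_ne_of_ne h h']
theorem sw_sw (i : ℕ) (c : ℕ → ℕ) : (c ∘ sw i) ∘ sw i = c := by
  funext t; simp [sw]

theorem sw_cases (i t : ℕ) : sw i t = if t = i then i + 1 else if t = i + 1 then i else t := by
  simp only [sw, Equiv.swap_apply_def]

theorem sw_comm (i j : ℕ) (h : i + 1 < j) (c : ℕ → ℕ) : (c ∘ sw i) ∘ sw j = (c ∘ sw j) ∘ sw i := by
  funext t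
  simp only [Function.comp_apply, sw_cases]
  congr 1
  grind

theorem sw_braid (i : ℕ) (c : ℕ → ℕ) :
    ((c ∘ sw i) ∘ sw (i + 1)) ∘ sw i = ((c ∘ sw (i + 1)) ∘ sw i) ∘ sw (i + 1) := by
  funext t
  simp only [Function.comp_apply, sw_cases]
  congr 1
  grind

theorem mv_mv_swap (S : Finset ℕ) (a b : ℕ) (ha : a ∈ S) (ha' : a + 1 ∉ S) (hb : b ∈ mv S a)
    (hb' : b + 1 ∉ mv S a) (h : a + 1 ≠ b) (h' : b + 1 ≠ a) :
    b ∈ S ∧ b + 1 ∉ S ∧ a ∈ mv S b ∧ a + 1 ∉ mv S b ∧ mv (mv S b) a = mv (mv S a) b := by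
  simp only [mv, Finset.mem_insert, Finset.mem_erase] at *
  refine ⟨by grind, by grind, by grind, by grind, ?_⟩
  ext z
  simp only [Finset.mem_insert, Finset.mem_erase]
  grind

theorem val_ne {k n : ℕ} {S : Finset ℕ} {c : ℕ → ℕ} (h : Val k n S c) {i : ℕ} (hi : i + 1 < n) :
    c i ≠ c (i + 1) := by
  intro he
  have h2 := (h.1 (i + 1) hi).1
  rw [st, ← he] at h2
  simp [mv] at h2

theorem val_swap {k n : ℕ} {S : Finset ℕ} {c : ℕ → ℕ} (h : Val k n S c) {i : ℕ} (hi : i + 1 < n)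
    (h1 : c i + 1 ≠ c (i + 1)) (h2 : c (i + 1) + 1 ≠ c i) : Val k n S (c ∘ sw i) := by
  have ha := h.1 i (by omega)
  have hb := h.1 (i + 1) hi
  rw [st] at hb
  obtain ⟨q1, q2, q3, q4, q5⟩ := mv_mv_swap _ _ _ ha.1 ha.2 hb.1 hb.2 h1 h2
  have e0 : ∀ t ≤ i, st k (c ∘ sw i) t = st k c t := fun t ht =>
    st_congr _ _ _ _ fun s hs => by rw [Function.comp_apply, sw_ne] <;> omega
  have e1 : st k (c ∘ sw i) (i + 1) = mv (st k c i) (c (i + 1)) := by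
    rw [st, e0 i le_rfl, Function.comp_apply, sw_l]
  have e2 : ∀ t, st k (c ∘ sw i) (i + 2 + t) = st k c (i + 2 + t) := by
    intro t
    induction t with
    | zero => rw [add_zero, st, e1, Function.comp_apply, sw_r, q5]; rfl
    | succ t ih =>
      rw [← add_assoc, st, st, ih, Function.comp_apply, sw_ne] <;> omega
  refine ⟨?_, ?_, ?_⟩
  · intro t ht
    rcases lt_trichotomy t i with hlt | rfl | hgt
    · rw [e0 t hlt.le, Function.comp_apply, sw_ne _ _ (by omega) (by omega)]
      exact h.1 t ht
    · rw [e0 t le_rfl, Function.comp_apply, sw_l]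
      exact ⟨q1, q2⟩
    · rcases eq_or_ne t (i + 1) with rfl | hne
      · rw [e1, Function.comp_apply, sw_r]
        exact ⟨q3, q4⟩
      · obtain ⟨s, rfl⟩ : ∃ s, t = i + 2 + s := ⟨t - (i + 2), by omega⟩
        rw [e2, Function.comp_apply, sw_ne _ _ (by omega) (by omega)]
        exact h.1 _ ht
  · intro t ht
    rw [Function.comp_apply, sw_ne _ _ (by omega) (by omega)]
    exact h.2.1 t ht
  · obtain ⟨s, rfl⟩ : ∃ s, n = i + 2 + s := ⟨n - (i + 2), by omega⟩
    rw [e2]; exact h.2.2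

theorem val_ne2 {k n : ℕ} {S : Finset ℕ} {c : ℕ → ℕ} (h : Val k n S c) {i : ℕ} (hi : i + 2 < n) :
    c i ≠ c (i + 2) := by
  intro he
  have h0 := h.1 i (by omega)
  have h1 := h.1 (i + 1) (by omega)
  have h2 := h.1 (i + 2) hi
  rw [st] at h1
  rw [st, st, ← he] at h2
  simp only [mv, Finset.mem_insert, Finset.mem_erase] at h0 h1 h2
  grind

/-- Inverse axial distance. -/
noncomputable def qi (a b : ℕ) : ℂ := ((b : ℂ) - a)⁻¹

/-- Off-diagonal coefficient. -/
noncomputable def wi (a b : ℕ) : ℂ := ((Real.sqrt (1 - (((b : ℝ) - a) ^ 2)⁻¹) : ℝ) : ℂ)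

theorem qi_symm (a b : ℕ) : qi b a = -qi a b := by
  rw [qi, qi, ← inv_neg]; congr 1; ring

theorem wi_symm (a b : ℕ) : wi b a = wi a b := by
  rw [wi, wi]; congr 4; ring

theorem wi_sq (a b : ℕ) (h : a ≠ b) : wi a b ^ 2 = 1 - qi a b ^ 2 := by
  have h1 : (1 : ℝ) ≤ ((b : ℝ) - a) ^ 2 := by
    have : (1 : ℤ) ≤ ((b : ℤ) - a) ^ 2 := by
      have : ((b : ℤ) - a) ≠ 0 := by omega
      have := sq_pos_of_ne_zero this
      omega
    exact_mod_cast this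
  have h2 : (((b : ℝ) - a) ^ 2)⁻¹ ≤ 1 := inv_le_one_of_one_le₀ h1
  rw [wi, ← Complex.ofReal_pow, Real.sq_sqrt (by linarith), qi]
  push_cast
  rw [inv_pow]

theorem wi_zero (a b : ℕ) (h : a + 1 = b ∨ b + 1 = a) : wi a b = 0 := by
  rw [wi]
  rcases h with rfl | rfl <;> simp

theorem wi_ne_zero (a b : ℕ) (h0 : a ≠ b) (h1 : a + 1 ≠ b) (h2 : b + 1 ≠ a) : wi a b ≠ 0 := by
  rw [wi, Complex.ofReal_ne_zero, Real.sqrt_ne_zero']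
  have h1 : (1 : ℝ) < ((b : ℝ) - a) ^ 2 := by
    have : (1 : ℤ) < ((b : ℤ) - a) ^ 2 := by
      rcases lt_or_gt_of_ne h0 with h | h
      · have h3 : (2 : ℤ) ≤ (b : ℤ) - a := by omega
        nlinarith
      · have h3 : (2 : ℤ) ≤ (a : ℤ) - b := by omega
        nlinarith
    exact_mod_cast this
  have := inv_lt_one_of_one_lt₀ h1
  linarith

theorem qi_add (a b d : ℕ) (h1 : a ≠ b) (h2 : b ≠ d) (h3 : a ≠ d) :
    qi a b * qi b d = qi a d * (qi a b + qi b d) := by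
  have e1 : (b : ℂ) - a ≠ 0 := by rw [sub_ne_zero]; exact_mod_cast h1.symm
  have e2 : (d : ℂ) - b ≠ 0 := by rw [sub_ne_zero]; exact_mod_cast h2.symm
  have e3 : (d : ℂ) - a ≠ 0 := by rw [sub_ne_zero]; exact_mod_cast h3.symm
  simp only [qi]
  field_simp
  ring

/-- The operator of the adjacent transposition on all functions on words. -/
noncomputable def op (i : ℕ) : ((ℕ → ℕ) → ℂ) →ₗ[ℂ] ((ℕ → ℕ) → ℂ) where
  toFun F c := qi (c i) (c (i + 1)) * F c + wi (c i) (c (i + 1)) * F (c ∘ sw i)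
  map_add' F F' := by funext c; simp only [Pi.add_apply]; ring
  map_smul' r F := by funext c; simp only [Pi.smul_apply, smul_eq_mul, RingHom.id_apply]; ring

theorem op_apply (i : ℕ) (F : (ℕ → ℕ) → ℂ) (c : ℕ → ℕ) :
    op i F c = qi (c i) (c (i + 1)) * F c + wi (c i) (c (i + 1)) * F (c ∘ sw i) := rfl

/-- Functions supported on valid words. -/
def VS (k n : ℕ) (S : Finset ℕ) : Submodule ℂ ((ℕ → ℕ) → ℂ) where
  carrier := {F | ∀ c, ¬ Val k n S c → F c = 0}
  add_mem' hF hG c hc := by simp [hF c hc, hG c hc]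
  zero_mem' c hc := rfl
  smul_mem' r F hF c hc := by simp [hF c hc]

theorem op_mem (k n : ℕ) (S : Finset ℕ) (i : ℕ) (hi : i + 1 < n) (F : (ℕ → ℕ) → ℂ)
    (hF : F ∈ VS k n S) : op i F ∈ VS k n S := by
  intro c hc
  rw [op_apply, hF c hc, mul_zero, zero_add]
  by_cases h : Val k n S (c ∘ sw i)
  · by_cases h1 : c i + 1 = c (i + 1) ∨ c (i + 1) + 1 = c i
    · rw [wi_zero _ _ h1, zero_mul]
    · push Not at h1
      refine absurd ?_ hc
      have := val_swap h hi (by simpa [sw_l, sw_r] using h1.2) (by simpa [sw_l, sw_r] using h1.1)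
      rwa [sw_sw] at this
  · rw [hF _ h, mul_zero]

theorem op_sq (k n : ℕ) (S : Finset ℕ) (i : ℕ) (hi : i + 1 < n) (F : (ℕ → ℕ) → ℂ)
    (hF : F ∈ VS k n S) : op i (op i F) = F := by
  funext c
  by_cases hc : Val k n S c
  · simp only [op_apply, Function.comp_apply, sw_l, sw_r, sw_sw]
    rw [qi_symm (c i) (c (i + 1)), wi_symm (c i) (c (i + 1))]
    linear_combination (F c) * wi_sq _ _ (val_ne hc hi)
  · rw [hF c hc]
    exact op_mem k n S i hi _ (op_mem k n S i hi F hF) c hc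

theorem op_braid (k n : ℕ) (S : Finset ℕ) (i : ℕ) (hi : i + 2 < n) (F : (ℕ → ℕ) → ℂ)
    (hF : F ∈ VS k n S) : op i (op (i + 1) (op i F)) = op (i + 1) (op i (op (i + 1) F)) := by
  have m1 : ∀ F ∈ VS k n S, op i F ∈ VS k n S := fun F hF => op_mem k n S i (by omega) F hF
  have m2 : ∀ F ∈ VS k n S, op (i + 1) F ∈ VS k n S := fun F hF => op_mem k n S _ (by omega) F hF
  funext c
  by_cases hc : Val k n S c
  · have n1 := val_ne hc (i := i) (by omega)
    have n2 := val_ne hc (i := i + 1) (by omega)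
    have n3 := val_ne2 hc hi
    have s1 : sw i (i + 1 + 1) = i + 2 := sw_ne _ _ (by omega) (by omega)
    have s2 : sw (i + 1) i = i := sw_ne _ _ (by omega) (by omega)
    simp only [op_apply, Function.comp_apply, sw_l, sw_r, sw_sw, s1, s2, sw_braid]
    have w1 := wi_sq _ _ n1
    have w2 := wi_sq _ _ n2
    have hq := qi_add _ _ _ n1 n2 n3
    simp only [show i + 1 + 1 = i + 2 from rfl] at *
    set a := c i
    set b := c (i + 1)
    set d := c (i + 2)
    rw [qi_symm a b, qi_symm b d, wi_symm a b, wi_symm b d]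
    generalize qi a b = u at *
    generalize qi b d = v at *
    generalize qi a d = z at *
    generalize wi a b = x at *
    generalize wi b d = y at *
    generalize wi a d = t at *
    generalize F (c ∘ sw i) = f1
    generalize F (c ∘ sw (i + 1)) = f2
    generalize F ((c ∘ sw i) ∘ sw (i + 1)) = f3
    generalize F ((c ∘ sw (i + 1)) ∘ sw i) = f4
    generalize F (((c ∘ sw (i + 1)) ∘ sw i) ∘ sw (i + 1)) = f5
    linear_combination (F c * z) * w1 - (F c * z) * w2 + (F c * (u - v) + f1 * x - f2 * y) * hq
  · rw [m1 _ (m2 _ (m1 _ hF)) c hc, m2 _ (m1 _ (m2 _ hF)) c hc]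

theorem op_comm (i j : ℕ) (hij : i + 1 < j) (F : (ℕ → ℕ) → ℂ) :
    op i (op j F) = op j (op i F) := by
  funext c
  have s1 : sw i j = j := sw_ne _ _ (by omega) (by omega)
  have s2 : sw i (j + 1) = j + 1 := sw_ne _ _ (by omega) (by omega)
  have s3 : sw j i = i := sw_ne _ _ (by omega) (by omega)
  have s4 : sw j (i + 1) = i + 1 := sw_ne _ _ (by omega) (by omega)
  simp only [op_apply, Function.comp_apply, s1, s2, s3, s4, sw_comm i j hij]
  ring
/-! ### Commutant of the orthogonal form -/

theorem upd_val (k n : ℕ) (S : Finset ℕ) (d : ℕ → ℕ) (x : ℕ) (hx : x + 1 ∈ rem S)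
    (hd : Val k n (mvd S (x + 1)) d) : Val k (n + 1) S (Function.update d n x) := by
  rw [val_succ]
  simp only [Function.update_self, Function.update_idem]
  refine ⟨hx, ?_⟩
  have : Function.update d n 0 = d := by
    rw [Function.update_eq_self_iff]
    exact (hd.2.1 n le_rfl).symm
  rwa [this]

theorem conn (k n : ℕ) (S : Finset ℕ) (a : (ℕ → ℕ) → ℂ)
    (ha : ∀ c, Val k n S c → ∀ i, i + 1 < n → c i + 1 ≠ c (i + 1) → c (i + 1) + 1 ≠ c i →
      a c = a (c ∘ sw i)) :
    ∀ c c', Val k n S c → Val k n S c' → a c = a c' := by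
  induction n generalizing S a with
  | zero =>
    intro c c' hc hc'
    congr 1
    funext t
    rw [hc.2.1 t (by omega), hc'.2.1 t (by omega)]
  | succ n ih =>
    have key : ∀ c c', Val k (n + 1) S c → Val k (n + 1) S c' → c n = c' n → a c = a c' := by
      intro c c' hc hc' he
      have h1 := (val_succ k n S c).1 hc
      have h2 := (val_succ k n S c').1 hc'
      rw [← he] at h2
      have := ih (mvd S (c n + 1)) (fun d => a (Function.update d n (c n))) ?_ _ _ h1.2 h2.2
      · simp only [Function.update_idem, Function.update_eq_self] at this
        rwa [he, Function.update_eq_self] at this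
      · intro d hd i hi e1 e2
        have hv := upd_val k n S d (c n) h1.1 hd
        have e3 : Function.update (d ∘ sw i) n (c n) = Function.update d n (c n) ∘ sw i := by
          funext t
          simp only [Function.update_apply, Function.comp_apply, sw_cases]
          grind
        show a _ = a _
        rw [e3]
        refine ha _ hv i (by omega) ?_ ?_
        · rwa [Function.update_of_ne (by omega), Function.update_of_ne (by omega)]
        · rwa [Function.update_of_ne (by omega), Function.update_of_ne (by omega)]
    intro c c' hc hc'
    by_cases he : c n = c' n
    · exact key c c' hc hc' he
    have h1 := ((val_succ k n S c).1 hc).1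
    have h2 := ((val_succ k n S c').1 hc').1
    have hcs := val_card_sum _ _ _ _ hc
    have h3 : c' n + 1 ∈ rem (mvd S (c n + 1)) := by
      simp only [rem, Finset.mem_filter, mvd, Finset.mem_insert, Finset.mem_erase] at *
      grind
    have s1 := mv_mv_card_sum _ _ h1
    have s2 := mv_mv_card_sum _ _ h3
    have s3 := sum_range_card_le (mvd (mvd S (c n + 1)) (c' n + 1)) k (by omega)
    obtain ⟨p, rfl⟩ : ∃ p, n = p + 1 := ⟨n - 1, by omega⟩
    obtain ⟨e, he'⟩ := Wd_nonempty k p (mvd (mvd S (c (p + 1) + 1)) (c' (p + 1) + 1))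
      (by omega) (by omega)
    rw [mem_Wd] at he'
    have v1 := upd_val _ _ _ _ _ h1 (upd_val _ _ _ _ _ h3 he')
    set c1 := Function.update (Function.update e p (c' (p + 1))) (p + 1) (c (p + 1)) with hc1
    have g1 : c1 (p + 1) = c (p + 1) := by simp [hc1]
    have g2 : c1 p = c' (p + 1) := by
      rw [hc1, Function.update_of_ne (by omega), Function.update_self]
    have ne1 : c1 p + 1 ≠ c1 (p + 1) := by
      rw [g1, g2]
      simp only [rem, Finset.mem_filter] at h1 h2
      grind
    have ne2 : c1 (p + 1) + 1 ≠ c1 p := by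
      rw [g1, g2]
      simp only [rem, Finset.mem_filter] at h1 h2
      grind
    have v2 := val_swap v1 (i := p) (by omega) ne1 ne2
    rw [key c c1 hc v1 g1.symm, ha c1 v1 p (by omega) ne1 ne2]
    refine key _ _ v2 hc' ?_
    rw [Function.comp_apply, sw_r, g2]

theorem val_zero {k n : ℕ} {S : Finset ℕ} {c : ℕ → ℕ} (h : Val k (n + 1) S c) : c 0 = k - 1 := by
  have := h.1 0 (by omega)
  simp only [st, Finset.mem_range] at this
  omega

/-- Multiplication by the `t`-th letter. -/
noncomputable def Dt (k n : ℕ) (S : Finset ℕ) (t : ℕ) (F : VS k n S) : VS k n S :=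
  ⟨fun c => (c t : ℂ) * F.1 c, fun c hc => by
    show (c t : ℂ) * F.1 c = 0
    rw [F.2 c hc, mul_zero]⟩

/-- The operator on the space of valid words. -/
noncomputable def opV (k n : ℕ) (S : Finset ℕ) (i : ℕ) (hi : i + 1 < n) :
    VS k n S →ₗ[ℂ] VS k n S := (op i).restrict (op_mem k n S i hi)

theorem opV_coe (k n : ℕ) (S : Finset ℕ) (i : ℕ) (hi : i + 1 < n) (F : VS k n S) :
    (opV k n S i hi F : (ℕ → ℕ) → ℂ) = op i F.1 := rfl

theorem Dt_succ (k n : ℕ) (S : Finset ℕ) (i : ℕ) (hi : i + 1 < n) (F : VS k n S) :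
    Dt k n S (i + 1) F = opV k n S i hi (Dt k n S i (opV k n S i hi F)) + opV k n S i hi F := by
  apply Subtype.ext
  funext c
  show (c (i + 1) : ℂ) * F.1 c = op i (fun c => (c i : ℂ) * op i F.1 c) c + op i F.1 c
  by_cases hc : Val k n S c
  · conv_lhs => rw [← op_sq k n S i hi F.1 F.2]
    rw [op_apply i (op i F.1) c, op_apply i (fun c => (c i : ℂ) * op i F.1 c) c]
    simp only [Function.comp_apply, sw_l]
    have h1 : qi (c i) (c (i + 1)) * ((c (i + 1) : ℂ) - c i) = 1 := by
      rw [qi, inv_mul_cancel₀]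
      rw [sub_ne_zero]; exact_mod_cast (val_ne hc hi).symm
    linear_combination (op i F.1 c) * h1
  · have h1 : op i (fun c => (c i : ℂ) * op i F.1 c) c = 0 :=
      op_mem k n S i hi _ (Dt k n S i (opV k n S i hi F)).2 c hc
    rw [F.2 c hc, op_mem k n S i hi _ F.2 c hc, h1]
    ring

/-- Intertwiners. -/
def Intw (k n : ℕ) (S S' : Finset ℕ) (φ : VS k n S →ₗ[ℂ] VS k n S') : Prop :=
  ∀ i (hi : i + 1 < n) F, φ (opV k n S i hi F) = opV k n S' i hi (φ F)

theorem intw_Dt (k n : ℕ) (S S' : Finset ℕ) (φ : VS k n S →ₗ[ℂ] VS k n S') (h : Intw k n S S' φ)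
    (t : ℕ) (ht : t < n) (F : VS k n S) : φ (Dt k n S t F) = Dt k n S' t (φ F) := by
  induction t generalizing F with
  | zero =>
    obtain ⟨p, rfl⟩ : ∃ p, n = p + 1 := ⟨n - 1, by omega⟩
    have key : ∀ T (G : VS k (p + 1) T), Dt k (p + 1) T 0 G = ((k - 1 : ℕ) : ℂ) • G := by
      intro T G
      apply Subtype.ext
      funext c
      show (c 0 : ℂ) * G.1 c = ((k - 1 : ℕ) : ℂ) * G.1 c
      by_cases hc : Val k (p + 1) T c
      · rw [val_zero hc]
      · rw [G.2 c hc, mul_zero, mul_zero]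
    rw [key, key, map_smul]
  | succ t ih => rw [Dt_succ _ _ _ _ ht, Dt_succ _ _ _ _ ht, map_add, h, ih (by omega), h]

open scoped Classical in
/-- Basis vector. -/
noncomputable def dl (k n : ℕ) (S : Finset ℕ) (c : ℕ → ℕ) (hc : Val k n S c) : VS k n S :=
  ⟨Pi.single c 1, fun d hd => Pi.single_eq_of_ne (by rintro rfl; exact hd hc) _⟩

theorem Dt_dl (k n : ℕ) (S : Finset ℕ) (c : ℕ → ℕ) (hc : Val k n S c) (t : ℕ) :
    Dt k n S t (dl k n S c hc) = (c t : ℂ) • dl k n S c hc := by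
  classical
  apply Subtype.ext
  funext d
  show (d t : ℂ) * (Pi.single c 1 : (ℕ → ℕ) → ℂ) d = (c t : ℂ) * (Pi.single c 1 : (ℕ → ℕ) → ℂ) d
  by_cases h : d = c
  · rw [h]
  · rw [Pi.single_eq_of_ne h, mul_zero, mul_zero]

theorem intw_supp (k n : ℕ) (S S' : Finset ℕ) (φ : VS k n S →ₗ[ℂ] VS k n S') (h : Intw k n S S' φ)
    (c : ℕ → ℕ) (hc : Val k n S c) (d : ℕ → ℕ) (hd : (φ (dl k n S c hc)).1 d ≠ 0) :
    d = c ∧ S = S' := by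
  have hv : Val k n S' d := by
    by_contra hv
    exact hd ((φ (dl k n S c hc)).2 d hv)
  have hdc : d = c := by
    funext t
    by_cases ht : t < n
    · have h1 := intw_Dt k n S S' φ h t ht (dl k n S c hc)
      rw [Dt_dl, map_smul] at h1
      have h2 : (c t : ℂ) * (φ (dl k n S c hc)).1 d = (d t : ℂ) * (φ (dl k n S c hc)).1 d :=
        congrFun (congrArg Subtype.val h1) d
      have := mul_right_cancel₀ hd h2
      exact_mod_cast this.symm
    · rw [hv.2.1 t (by omega), hc.2.1 t (by omega)]
  subst hdc
  exact ⟨rfl, by rw [← hc.2.2, hv.2.2]⟩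

theorem VS_expand (k n : ℕ) (S : Finset ℕ) (F : VS k n S) :
    F = ∑ c : {c // c ∈ Wd k n S}, F.1 c.1 • dl k n S c.1 ((mem_Wd _ _ _ _).1 c.2) := by
  classical
  apply Subtype.ext
  funext d
  rw [Submodule.coe_sum, Finset.sum_apply]
  show F.1 d = ∑ c : {c // c ∈ Wd k n S}, F.1 c.1 * (Pi.single c.1 1 : (ℕ → ℕ) → ℂ) d
  by_cases hd : Val k n S d
  · rw [Finset.sum_eq_single ⟨d, (mem_Wd _ _ _ _).2 hd⟩]
    · simp
    · rintro ⟨b, hb⟩ - hne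
      rw [Pi.single_eq_of_ne (by rintro rfl; exact hne rfl), mul_zero]
    · simp
  · rw [F.2 d hd, eq_comm]
    refine Finset.sum_eq_zero ?_
    rintro ⟨b, hb⟩ -
    rw [Pi.single_eq_of_ne (by rintro rfl; exact hd ((mem_Wd _ _ _ _).1 hb)), mul_zero]

theorem intw_apply (k n : ℕ) (S : Finset ℕ) (φ : VS k n S →ₗ[ℂ] VS k n S) (h : Intw k n S S φ)
    (F : VS k n S) (c : ℕ → ℕ) (hc : Val k n S c) :
    (φ F).1 c = (φ (dl k n S c hc)).1 c * F.1 c := by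
  conv_lhs => rw [VS_expand k n S F]
  rw [map_sum, Submodule.coe_sum, Finset.sum_apply,
    Finset.sum_eq_single ⟨c, (mem_Wd _ _ _ _).2 hc⟩]
  · rw [map_smul]
    show F.1 c * _ = _
    rw [mul_comm]
  · rintro ⟨b, hb⟩ - hne
    rw [map_smul]
    show F.1 b * _ = _
    rw [mul_eq_zero]
    right
    by_contra h0
    have := (intw_supp k n S S φ h b _ c h0).1
    subst this
    exact hne rfl
  · simp

theorem intw_zero (k n : ℕ) (S S' : Finset ℕ) (hS : S ≠ S') (φ : VS k n S →ₗ[ℂ] VS k n S')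
    (h : Intw k n S S' φ) : φ = 0 := by
  ext1 F
  rw [VS_expand k n S F, map_sum]
  refine Finset.sum_eq_zero fun c _ => ?_
  rw [map_smul]
  have : φ (dl k n S c.1 ((mem_Wd _ _ _ _).1 c.2)) = 0 := by
    apply Subtype.ext
    funext d
    by_contra h0
    exact hS (intw_supp k n S S' φ h _ _ d h0).2
  rw [this, smul_zero]

theorem intw_scalar (k n : ℕ) (S : Finset ℕ) (φ : VS k n S →ₗ[ℂ] VS k n S)
    (h : Intw k n S S φ) : ∃ r : ℂ, φ = r • LinearMap.id := by
  classical
  by_cases hne : ∃ c0, Val k n S c0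
  · obtain ⟨c0, hc0⟩ := hne
    let a : (ℕ → ℕ) → ℂ := fun c => if hc : Val k n S c then (φ (dl k n S c hc)).1 c else 0
    have ha : ∀ F c, (φ F).1 c = a c * F.1 c := by
      intro F c
      by_cases hc : Val k n S c
      · simp only [a, dif_pos hc]
        exact intw_apply k n S φ h F c hc
      · rw [(φ F).2 c hc, F.2 c hc, mul_zero]
    have hcn := conn k n S a (by
      intro c hc i hi h1 h2
      have hv := val_swap hc hi h1 h2
      have e := congrFun (congrArg Subtype.val (h i hi (dl k n S _ hv))) c
      rw [ha, opV_coe, opV_coe, op_apply, op_apply, ha, ha] at e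
      have e1 : (dl k n S _ hv).1 (c ∘ sw i) = 1 := by simp [dl]
      rw [e1] at e
      have := wi_ne_zero _ _ (val_ne hc hi) h1 h2
      have e2 : wi (c i) (c (i + 1)) * a c = wi (c i) (c (i + 1)) * a (c ∘ sw i) := by
        linear_combination e
      exact mul_left_cancel₀ this e2)
    refine ⟨a c0, ?_⟩
    ext1 F
    apply Subtype.ext
    funext c
    show _ = a c0 * F.1 c
    rw [ha]
    by_cases hc : Val k n S c
    · rw [hcn c c0 hc hc0]
    · rw [F.2 c hc, mul_zero, mul_zero]
  · refine ⟨0, ?_⟩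
    ext1 F
    apply Subtype.ext
    funext c
    rw [(φ F).2 c (fun hc => hne ⟨c, hc⟩)]
    simp

/-- Coordinates. -/
noncomputable def VSequiv (k n : ℕ) (S : Finset ℕ) :
    VS k n S ≃ₗ[ℂ] ({c // c ∈ Wd k n S} → ℂ) where
  toFun F c := F.1 c.1
  map_add' _ _ := rfl
  map_smul' _ _ := rfl
  invFun f := ∑ c : {c // c ∈ Wd k n S}, f c • dl k n S c.1 ((mem_Wd _ _ _ _).1 c.2)
  left_inv F := (VS_expand k n S F).symm
  right_inv f := by
    classical
    funext d
    show (∑ c : {c // c ∈ Wd k n S}, f c • dl k n S c.1 ((mem_Wd _ _ _ _).1 c.2)).1 d.1 = f d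
    rw [Submodule.coe_sum, Finset.sum_apply]
    show ∑ c : {c // c ∈ Wd k n S}, f c * (Pi.single c.1 1 : (ℕ → ℕ) → ℂ) d.1 = f d
    rw [Finset.sum_eq_single d]
    · simp
    · rintro b - hne
      rw [Pi.single_eq_of_ne (fun h => hne (Subtype.ext h.symm)), mul_zero]
    · simp

instance VS_finite (k n : ℕ) (S : Finset ℕ) : Module.Finite ℂ (VS k n S) :=
  Module.Finite.equiv (VSequiv k n S).symm

theorem VS_finrank (k n : ℕ) (S : Finset ℕ) :
    Module.finrank ℂ (VS k n S) = (Wd k n S).card := by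
  rw [(VSequiv k n S).finrank_eq, Module.finrank_fintype_fun_eq_card, Fintype.card_coe]

theorem rep_exists (k m : ℕ) (S : Finset ℕ) :
    ∃ ρ : Equiv.Perm (Fin (m + 1)) →* (VS k (m + 1) S →ₗ[ℂ] VS k (m + 1) S),
      ∀ i (hi : i < m), ρ (Equiv.swap (Fin.castSucc ⟨i, hi⟩) (Fin.succ ⟨i, hi⟩)) =
        opV k (m + 1) S i (by omega) := by
  have hsq : ∀ i (hi : i + 1 < m + 1), opV k (m + 1) S i hi * opV k (m + 1) S i hi = 1 := by
    intro i hi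
    ext1 F
    exact Subtype.ext (op_sq k (m + 1) S i hi F.1 F.2)
  let g : ℕ → (VS k (m + 1) S →ₗ[ℂ] VS k (m + 1) S)ˣ := fun i =>
    if hi : i + 1 < m + 1 then ⟨opV k (m + 1) S i hi, opV k (m + 1) S i hi, hsq i hi, hsq i hi⟩
    else 1
  have hg : ∀ i (hi : i + 1 < m + 1), (g i : VS k (m + 1) S →ₗ[ℂ] VS k (m + 1) S) =
      opV k (m + 1) S i hi := by
    intro i hi
    simp only [g, dif_pos hi]
  have hrel : CoxRel g m := by
    refine ⟨?_, ?_, ?_⟩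
    · intro i hi
      apply Units.ext
      rw [Units.val_mul, hg i (by omega), hsq]; rfl
    · intro i hi
      apply Units.ext
      simp only [Units.val_mul]
      rw [hg i (by omega), hg (i + 1) (by omega)]
      ext1 F
      exact Subtype.ext (op_braid k (m + 1) S i (by omega) F.1 F.2)
    · intro i j hij hj
      apply Units.ext
      simp only [Units.val_mul]
      rw [hg i (by omega), hg j (by omega)]
      ext1 F
      exact Subtype.ext (op_comm i j hij F.1)
  obtain ⟨φ, hφ⟩ := cox_hom g m hrel
  refine ⟨(Units.coeHom _).comp φ, fun i hi => ?_⟩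
  rw [MonoidHom.comp_apply, hφ ⟨i, hi⟩]
  exact hg i (by omega)
/-! ### Passage to `FDRep` -/

/-- The representation attached to a beta-set. -/
noncomputable def repOf (k m : ℕ) (S : Finset ℕ) : FDRep ℂ (Equiv.Perm (Fin (m + 1))) :=
  FDRep.of (V := VS k (m + 1) S) (rep_exists k m S).choose

theorem repOf_finrank (k m : ℕ) (S : Finset ℕ) :
    finrank ℂ (repOf k m S) = (Wd k (m + 1) S).card := VS_finrank k (m + 1) S

/-- The underlying linear map of a morphism. -/
noncomputable def homLin (k m : ℕ) (S S' : Finset ℕ) (f : repOf k m S ⟶ repOf k m S') :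
    VS k (m + 1) S →ₗ[ℂ] VS k (m + 1) S' := f.hom.hom.hom

theorem homLin_inj (k m : ℕ) (S S' : Finset ℕ) (f g : repOf k m S ⟶ repOf k m S')
    (h : homLin k m S S' f = homLin k m S S' g) : f = g := by
  apply Action.Hom.ext
  apply InducedCategory.hom_ext
  exact ModuleCat.hom_ext h

theorem homLin_intw (k m : ℕ) (S S' : Finset ℕ) (f : repOf k m S ⟶ repOf k m S') :
    Intw k (m + 1) S S' (homLin k m S S' f) := by
  intro i hi F
  have h1 := (rep_exists k m S).choose_spec i (by omega)
  have h2 := (rep_exists k m S').choose_spec i (by omega)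
  have hc := f.comm (Equiv.swap (Fin.castSucc ⟨i, by omega⟩) (Fin.succ ⟨i, by omega⟩))
  have hc' := congrArg (fun (q : (repOf k m S).V ⟶ (repOf k m S').V) => q.hom.hom F) hc
  rw [← h1, ← h2]
  exact hc'

theorem repOf_not_iso (k m : ℕ) (S S' : Finset ℕ) (hS : S ≠ S')
    (hne : (Wd k (m + 1) S).Nonempty) : ¬ Nonempty (repOf k m S ≅ repOf k m S') := by
  rintro ⟨e⟩
  have h := intw_zero _ _ _ _ hS _ (homLin_intw k m S S' e.hom)
  obtain ⟨c, hc⟩ := hne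
  have hc' := (mem_Wd _ _ _ _).1 hc
  let E := FDRep.isoToLinearEquiv e
  have h0 : E (dl k (m + 1) S c hc') = 0 := LinearMap.congr_fun h (dl k (m + 1) S c hc')
  have h1 : dl k (m + 1) S c hc' = 0 := E.map_eq_zero_iff.1 h0
  have h2 : (dl k (m + 1) S c hc').1 c = 0 := by rw [h1]; rfl
  simp [dl] at h2

theorem repOf_simple (k m : ℕ) (S : Finset ℕ) (hne : (Wd k (m + 1) S).Nonempty) :
    Simple (repOf k m S) := by
  have : NeZero (Nat.card (Equiv.Perm (Fin (m + 1))) : ℂ) :=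
    ⟨Nat.cast_ne_zero.2 Nat.card_pos.ne'⟩
  rw [FDRep.simple_iff_end_is_rank_one, finrank_eq_one_iff']
  refine ⟨𝟙 _, ?_, ?_⟩
  · intro h
    obtain ⟨c, hc⟩ := hne
    have hc' := (mem_Wd _ _ _ _).1 hc
    have h0 : homLin k m S S (𝟙 _) (dl k (m + 1) S c hc') = homLin k m S S 0 (dl k (m + 1) S c hc') := by
      rw [h]
    have h1 : dl k (m + 1) S c hc' = 0 := h0
    have h2 : (dl k (m + 1) S c hc').1 c = 0 := by rw [h1]; rfl
    simp [dl] at h2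
  · intro f
    obtain ⟨r, hr⟩ := intw_scalar _ _ _ _ (homLin_intw k m S S f)
    refine ⟨r, ?_⟩
    apply homLin_inj
    rw [hr]
    rfl

section Finiteness
variable (G : Type) [Group G] [Finite G]

theorem irr_inj_bound (d : ℕ) (s : Finset (Quotient (irrSetoid G d))) : s.card ≤ Nat.card G := by
  classical
  have := Fintype.ofFinite G
  have hne : (Nat.card G : ℂ) ≠ 0 := Nat.cast_ne_zero.2 Nat.card_pos.ne'
  have : Invertible (Nat.card G : ℂ) := invertibleOfNonzero hne
  let χ : s → (G → ℂ) := fun x => FDRep.character (x.1.out.1)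
  have key : ∀ x y : s, (Nat.card G : ℂ)⁻¹ * ∑ g : G, χ x g * χ y g⁻¹ = if x = y then 1 else 0 := by
    intro x y
    have := x.1.out.2.1
    have := y.1.out.2.1
    have h := FDRep.char_orthonormal x.1.out.1 y.1.out.1
    show (Nat.card G : ℂ)⁻¹ * ∑ g : G, FDRep.character x.1.out.1 g * FDRep.character y.1.out.1 g⁻¹ = _
    rw [h]
    congr 1
    rw [eq_iff_iff]
    constructor
    · intro hi
      have := Quotient.sound (s := irrSetoid G d) (a := x.1.out) (b := y.1.out) hi
      rw [Quotient.out_eq, Quotient.out_eq] at this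
      exact Subtype.ext this
    · rintro rfl
      exact ⟨Iso.refl _⟩
  have hli : LinearIndependent ℂ χ := by
    rw [Fintype.linearIndependent_iff]
    intro f hf y
    have h1 : (Nat.card G : ℂ)⁻¹ * ∑ g : G, (∑ x, f x • χ x) g * χ y g⁻¹ = f y := by
      have : ∑ g : G, (∑ x, f x • χ x) g * χ y g⁻¹ = ∑ x, f x * ∑ g : G, χ x g * χ y g⁻¹ := by
        simp only [Finset.sum_apply, Pi.smul_apply, smul_eq_mul, Finset.sum_mul, Finset.mul_sum]
        rw [Finset.sum_comm]
        simp only [mul_assoc]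
      rw [this, Finset.mul_sum]
      have : ∀ x, (Nat.card G : ℂ)⁻¹ * (f x * ∑ g : G, χ x g * χ y g⁻¹) =
          f x * if x = y then 1 else 0 := fun x => by rw [← key x y]; ring
      rw [Finset.sum_congr rfl fun x _ => this x]
      simp
    rw [← h1, hf]
    simp
  have := hli.fintype_card_le_finrank
  rwa [Fintype.card_coe, Module.finrank_fintype_fun_eq_card, ← Nat.card_eq_fintype_card] at this

theorem irr_finite (d : ℕ) : Finite (Quotient (irrSetoid G d)) := by
  by_contra h
  rw [not_finite_iff_infinite] at h
  obtain ⟨s, hs⟩ := Infinite.exists_subset_card_eq (Quotient (irrSetoid G d)) (Nat.card G + 1)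
  have := irr_inj_bound G d s
  omega

theorem mult_le_card (d : ℕ) : multOfDegree G d ≤ Nat.card G := by
  have := irr_finite G d
  have := Fintype.ofFinite (Quotient (irrSetoid G d))
  rw [multOfDegree, Nat.card_eq_fintype_card]
  exact irr_inj_bound G d Finset.univ

theorem le_maxMult {ι : Type*} [Fintype ι] (d : ℕ) (R : ι → FDRep ℂ G)
    (h1 : ∀ i, Simple (R i)) (h2 : ∀ i, finrank ℂ (R i) = d)
    (h3 : ∀ i j, i ≠ j → ¬ Nonempty (R i ≅ R j)) : Fintype.card ι ≤ maxMult G := by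
  have hf := irr_finite G d
  have hle : Fintype.card ι ≤ multOfDegree G d := by
    rw [multOfDegree, ← Nat.card_eq_fintype_card]
    refine Nat.card_le_card_of_injective
      (fun i => (Quotient.mk (irrSetoid G d) ⟨R i, h1 i, h2 i⟩)) ?_
    intro i j hij
    by_contra hne
    exact h3 i j hne (Quotient.exact hij)
  refine hle.trans (le_csSup ⟨Nat.card G, ?_⟩ ⟨d, rfl⟩)
  rintro _ ⟨e, rfl⟩
  exact mult_le_card G e

end Finiteness

theorem maxMult_ge_s6 (m k : ℕ) {ι : Type*} [Fintype ι] (S : ι → Finset ℕ) (hinj : S.Injective)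
    (hcard : ∀ i, (S i).card = k)
    (hsum : ∀ i, ∑ y ∈ S i, y = ∑ y ∈ Finset.range k, y + (m + 1))
    (hH : ∀ i j, Hk (S i) = Hk (S j)) :
    Fintype.card ι ≤ maxMult (Equiv.Perm (Fin (m + 1))) := by
  rcases isEmpty_or_nonempty ι with h | ⟨⟨i0⟩⟩
  · simp
  refine le_maxMult _ (Wd k (m + 1) (S i0)).card (fun i => repOf k m (S i)) ?_ ?_ ?_
  · intro i
    exact repOf_simple _ _ _ (Wd_nonempty _ _ _ (hcard i) (hsum i))
  · intro i
    rw [repOf_finrank]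
    have h1 := hook_formula_s6 _ _ _ (hcard i) (hsum i)
    have h2 := hook_formula_s6 _ _ _ (hcard i0) (hsum i0)
    rw [hH i i0, ← h2] at h1
    exact_mod_cast h1
  · intro i j hij
    exact repOf_not_iso _ _ _ _ (fun h => hij (hinj h)) (Wd_nonempty _ _ _ (hcard i) (hsum i))
/-! ### Hook products and autocorrelations -/

section Auto
open LaurentPolynomial

/-- Generating Laurent polynomial of a set. -/
noncomputable def gen (S : Finset ℕ) : ℤ[T;T⁻¹] := ∑ s ∈ S, T (s : ℤ)

/-- The boundary polynomial of a beta-set. -/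
noncomputable def pol (S : Finset ℕ) : ℤ[T;T⁻¹] := 1 - (1 - T 1) * gen S

/-- Autocorrelation of the boundary. -/
noncomputable def acr (S : Finset ℕ) : ℤ[T;T⁻¹] := pol S * invert (pol S)

/-- The coefficient functional. -/
noncomputable def co (d : ℤ) : ℤ[T;T⁻¹] →+ ℤ :=
  (Finsupp.applyAddHom d).comp (AddMonoidAlgebra.coeffAddEquiv (R := ℤ) (M := ℤ)).toAddMonoidHom

theorem co_T (d j : ℤ) : co d (T j) = if j = d then 1 else 0 := by
  exact T_apply _ _

theorem acr_eq (S : Finset ℕ) : acr S = T 0 - ∑ y ∈ S, T (y : ℤ) + ∑ y ∈ S, T ((y : ℤ) + 1)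
    - ∑ y ∈ S, T (-(y : ℤ)) + ∑ y ∈ S, T (-(y : ℤ) - 1)
    + (∑ y ∈ S, ∑ x ∈ S, T ((y : ℤ) - x) + ∑ y ∈ S, ∑ x ∈ S, T ((y : ℤ) - x)
    - ∑ y ∈ S, ∑ x ∈ S, T ((y : ℤ) - x + 1) - ∑ y ∈ S, ∑ x ∈ S, T ((y : ℤ) - x - 1)) := by
  have e1 : ∑ y ∈ S, T (R := ℤ) ((y : ℤ) + 1) = T 1 * gen S := by
    rw [gen, Finset.mul_sum]
    exact Finset.sum_congr rfl fun y _ => by rw [← T_add, add_comm]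
  have e2 : invert (gen S) = ∑ y ∈ S, T (-(y : ℤ)) := by
    rw [gen, map_sum]
    exact Finset.sum_congr rfl fun y _ => by rw [invert_T]
  have e3 : ∑ y ∈ S, T (R := ℤ) (-(y : ℤ) - 1) = T (-1) * invert (gen S) := by
    rw [e2, Finset.mul_sum]
    exact Finset.sum_congr rfl fun y _ => by rw [← T_add]; congr 1; ring
  have e4 : ∑ y ∈ S, ∑ x ∈ S, T (R := ℤ) ((y : ℤ) - x) = gen S * invert (gen S) := by
    rw [e2, gen, Finset.sum_mul_sum]
    exact Finset.sum_congr rfl fun y _ => Finset.sum_congr rfl fun x _ => by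
      rw [← T_add]; rfl
  have e5 : ∑ y ∈ S, ∑ x ∈ S, T (R := ℤ) ((y : ℤ) - x + 1) = T 1 * (gen S * invert (gen S)) := by
    rw [← e4, Finset.mul_sum]
    refine Finset.sum_congr rfl fun y _ => ?_
    rw [Finset.mul_sum]
    exact Finset.sum_congr rfl fun x _ => by rw [← T_add]; congr 1; ring
  have e6 : ∑ y ∈ S, ∑ x ∈ S, T (R := ℤ) ((y : ℤ) - x - 1) = T (-1) * (gen S * invert (gen S)) := by
    rw [← e4, Finset.mul_sum]
    refine Finset.sum_congr rfl fun y _ => ?_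
    rw [Finset.mul_sum]
    exact Finset.sum_congr rfl fun x _ => by rw [← T_add]; congr 1; ring
  have e7 : (T 1 : ℤ[T;T⁻¹]) * T (-1) = 1 := by rw [← T_add]; exact T_zero
  rw [e1, ← e2, e3, e4, e5, e6, T_zero, acr, pol]
  simp only [map_sub, map_one, map_mul, invert_T]
  show _ = 1 - gen S + _ - _ + _ + _
  linear_combination (gen S * invert (gen S)) * e7

/-- Hook counting function. -/
def Ah (S : Finset ℕ) (d : ℤ) : ℤ :=
  ∑ y ∈ S, ((if d ≤ (y : ℤ) then 1 else 0) - ∑ x ∈ S, if (y : ℤ) - x = d then 1 else 0)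

theorem acr_co (S : Finset ℕ) (d : ℤ) (hd : 1 ≤ d) :
    co d (acr S) = Ah S (d + 1) - 2 * Ah S d + Ah S (d - 1) := by
  rw [acr_eq]
  simp only [map_add, map_sub, map_sum, co_T]
  rw [if_neg (by omega)]
  simp only [Ah, ← Finset.sum_sub_distrib, ← Finset.sum_add_distrib, Finset.mul_sum, zero_sub,
    ← Finset.sum_neg_distrib]
  refine Finset.sum_congr rfl fun y _ => ?_
  have e : ∀ x : ℕ, ((y : ℤ) - x + 1 = d ↔ (y : ℤ) - x = d - 1) ∧
    ((y : ℤ) - x - 1 = d ↔ (y : ℤ) - x = d + 1) := fun x => by omega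
  simp only [fun x => (e x).1, fun x => (e x).2, mul_sub, Finset.sum_sub_distrib, Finset.sum_add_distrib]
  generalize (∑ x ∈ S, if (y : ℤ) - x = d then (1 : ℤ) else 0) = u
  generalize (∑ x ∈ S, if (y : ℤ) - x = d - 1 then (1 : ℤ) else 0) = v
  generalize (∑ x ∈ S, if (y : ℤ) - x = d + 1 then (1 : ℤ) else 0) = w
  split_ifs <;> omega

theorem Ah_large (S : Finset ℕ) (L : ℕ) (hS : S ⊆ Finset.range L) (d : ℤ) (hd : (L : ℤ) ≤ d) :
    Ah S d = 0 := by
  refine Finset.sum_eq_zero fun y hy => ?_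
  have := Finset.mem_range.1 (hS hy)
  rw [if_neg (by omega), Finset.sum_eq_zero, sub_zero]
  intro x _
  rw [if_neg (by omega)]

theorem Ah_eq (S S' : Finset ℕ) (h : acr S = acr S') (d : ℕ) : Ah S d = Ah S' d := by
  obtain ⟨L, hL⟩ : ∃ L, S ∪ S' ⊆ Finset.range L := Finset.exists_nat_subset_range _
  have hS := Finset.union_subset_left hL
  have hS' := Finset.union_subset_right hL
  have key : ∀ j : ℕ, j ≤ L → Ah S (L - j) = Ah S' (L - j) ∧ Ah S (L - j + 1) = Ah S' (L - j + 1) := by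
    intro j
    induction j with
    | zero =>
      intro _
      rw [Ah_large S L hS _ (by omega), Ah_large S' L hS' _ (by omega),
        Ah_large S L hS _ (by omega), Ah_large S' L hS' _ (by omega)]
      simp
    | succ j ih =>
      intro hj
      obtain ⟨h1, h2⟩ := ih (by omega)
      have e1 := acr_co S ((L : ℤ) - j) (by omega)
      have e2 := acr_co S' ((L : ℤ) - j) (by omega)
      rw [h] at e1
      push_cast
      rw [show (L : ℤ) - (j + 1) = L - j - 1 by ring, sub_add_cancel]
      constructor <;> linarith
  rcases Nat.lt_or_ge L d with hlt | hge
  · rw [Ah_large S L hS _ (by omega), Ah_large S' L hS' _ (by omega)]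
  · have := (key (L - d) (by omega)).1
    rw [show (L : ℤ) - ((L - d : ℕ) : ℤ) = d by omega] at this
    exact this

theorem Ah_card (S : Finset ℕ) (d : ℕ) :
    Ah S d = ((S.filter fun y => d ≤ y ∧ y - d ∉ S).card : ℤ) := by
  rw [Finset.card_filter]
  push_cast
  refine Finset.sum_congr rfl fun y _ => ?_
  have : (∑ x ∈ S, if (y : ℤ) - x = d then (1 : ℤ) else 0) = if d ≤ y ∧ y - d ∈ S then 1 else 0 := by
    by_cases hd : d ≤ y
    · have : ∀ x : ℕ, ((y : ℤ) - x = d) ↔ (y - d = x) := fun x => by omega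
      simp only [this, hd, true_and, Finset.sum_ite_eq]
    · rw [if_neg (fun h => hd h.1)]
      exact Finset.sum_eq_zero fun x _ => if_neg (by omega)
  rw [this]
  by_cases h1 : d ≤ y <;> by_cases h2 : y - d ∈ S <;> simp [h1, h2]

theorem Hk_eq (S : Finset ℕ) (L : ℕ) (hS : S ⊆ Finset.range L) :
    Hk S = ∏ j ∈ Finset.range L,
      ((j + 1 : ℕ) : ℚ) ^ (S.filter fun y => (j + 1) ≤ y ∧ y - (j + 1) ∉ S).card := by
  have : ∀ j, ((j + 1 : ℕ) : ℚ) ^ (S.filter fun y => (j + 1) ≤ y ∧ y - (j + 1) ∉ S).card =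
      ∏ y ∈ S, if (j + 1) ≤ y ∧ y - (j + 1) ∉ S then ((j + 1 : ℕ) : ℚ) else 1 := by
    intro j
    rw [← Finset.prod_filter, Finset.prod_const]
  simp only [this]
  rw [Finset.prod_comm, Hk]
  refine Finset.prod_congr rfl fun y hy => ?_
  have hy := Finset.mem_range.1 (hS hy)
  rw [Finset.prod_filter, ← Finset.prod_range_reflect,
    ← Finset.prod_subset (Finset.range_mono hy.le)]
  · refine Finset.prod_congr rfl fun j hj => ?_
    have hj := Finset.mem_range.1 hj
    rw [show y - 1 - j = y - (j + 1) by omega]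
    by_cases h : y - (j + 1) ∈ S
    · simp [h]
    · rw [if_pos h, if_pos ⟨by omega, h⟩, Nat.cast_sub (by omega)]
      ring
  · intro j _ hj
    rw [if_neg]
    intro h
    exact hj (Finset.mem_range.2 (by omega))

theorem Hk_of_acr (S S' : Finset ℕ) (h : acr S = acr S') : Hk S = Hk S' := by
  obtain ⟨L, hL⟩ : ∃ L, S ∪ S' ⊆ Finset.range L := Finset.exists_nat_subset_range _
  rw [Hk_eq S L (Finset.union_subset_left hL), Hk_eq S' L (Finset.union_subset_right hL)]
  refine Finset.prod_congr rfl fun j _ => ?_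
  have := Ah_eq S S' h (j + 1)
  rw [Ah_card, Ah_card] at this
  rw [Nat.cast_inj.1 this]

end Auto
/-! ### The family of beta-sets -/

section Family
open LaurentPolynomial

/-- Gluing of beta-sets. -/
def Eg (S : Finset ℕ) (a w : ℕ) (X : Finset ℕ) : Finset ℕ :=
  S ∪ ((Finset.range w \ S).map (addLeftEmbedding a) ∪ X.map (addLeftEmbedding (a + w)))

theorem mem_Eg (S : Finset ℕ) (a w : ℕ) (X : Finset ℕ) (x : ℕ) : x ∈ Eg S a w X ↔
    x ∈ S ∨ (a ≤ x ∧ x < a + w ∧ x - a ∉ S) ∨ (a + w ≤ x ∧ x - (a + w) ∈ X) := by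
  simp only [Eg, Finset.mem_union, Finset.mem_map, Finset.mem_sdiff, Finset.mem_range,
    addLeftEmbedding_apply]
  constructor
  · rintro (h | ⟨y, h, rfl⟩ | ⟨y, h, rfl⟩)
    · exact Or.inl h
    · exact Or.inr (Or.inl ⟨by omega, by omega, by rw [Nat.add_sub_cancel_left]; exact h.2⟩)
    · exact Or.inr (Or.inr ⟨by omega, by rw [Nat.add_sub_cancel_left]; exact h⟩)
  · rintro (h | ⟨h1, h2, h3⟩ | ⟨h1, h2⟩)
    · exact Or.inl h
    · exact Or.inr (Or.inl ⟨x - a, ⟨by omega, h3⟩, by omega⟩)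
    · exact Or.inr (Or.inr ⟨_, h2, by omega⟩)

theorem Eg_lt (S : Finset ℕ) (a w : ℕ) (X : Finset ℕ) (x : ℕ) (hx : x < a) :
    x ∈ Eg S a w X ↔ x ∈ S := by
  rw [mem_Eg]
  constructor
  · rintro (h | h | h)
    · exact h
    · omega
    · omega
  · exact Or.inl

theorem Eg_sub (S : Finset ℕ) (a w L : ℕ) (X : Finset ℕ) (hS : S ⊆ Finset.range a)
    (hX : X ⊆ Finset.range L) : Eg S a w X ⊆ Finset.range (a + w + L) := by
  intro x hx
  rw [mem_Eg] at hx
  rw [Finset.mem_range]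
  rcases hx with h | h | h
  · have := Finset.mem_range.1 (hS h)
    omega
  · omega
  · have := Finset.mem_range.1 (hX h.2)
    omega

theorem sum_Eg {M : Type*} [AddCommMonoid M] (f : ℕ → M) (S : Finset ℕ) (a w : ℕ) (X : Finset ℕ)
    (hS : S ⊆ Finset.range a) : ∑ y ∈ Eg S a w X, f y = ∑ y ∈ S, f y +
      (∑ y ∈ Finset.range w \ S, f (a + y) + ∑ y ∈ X, f (a + w + y)) := by
  rw [Eg, Finset.sum_union, Finset.sum_union, Finset.sum_map, Finset.sum_map]
  · rfl
  · rw [Finset.disjoint_left]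
    simp only [Finset.mem_map, Finset.mem_sdiff, Finset.mem_range, addLeftEmbedding_apply]
    rintro x ⟨y, hy, rfl⟩ ⟨z, hz, hz'⟩
    omega
  · rw [Finset.disjoint_left]
    simp only [Finset.mem_union, Finset.mem_map, Finset.mem_sdiff, Finset.mem_range,
      addLeftEmbedding_apply]
    intro x hx h
    have := Finset.mem_range.1 (hS hx)
    rcases h with ⟨y, hy, rfl⟩ | ⟨y, hy, rfl⟩ <;> omega

/-- Numerical invariants of a beta-set. -/
def BInv (S : Finset ℕ) (k n : ℕ) : Prop := S.card = k ∧ 2 * ∑ y ∈ S, y + k = k ^ 2 + 2 * n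

theorem two_sum_range (w : ℕ) : 2 * ∑ y ∈ Finset.range w, y + w = w ^ 2 := by
  induction w with
  | zero => simp
  | succ w ih => rw [Finset.sum_range_succ]; nlinarith

theorem inv_Eg (S : Finset ℕ) (a w k n u n' : ℕ) (X : Finset ℕ) (hS : S ⊆ Finset.range a)
    (hw : S ⊆ Finset.range w) (h : BInv S k n) (hX : BInv X (k + u) n') :
    BInv (Eg S a w X) (k + u + w) (n' + a * (w + u)) := by
  have c1 : (Finset.range w \ S).card + k = w := by
    have := Finset.card_sdiff_add_card_eq_card hw
    rw [Finset.card_range] at this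
    rw [← h.1, this]
  have c2 := Finset.sum_sdiff (f := fun y => y) hw
  have c3 := two_sum_range w
  constructor
  · rw [Finset.card_eq_sum_ones, sum_Eg _ _ _ _ _ hS]
    simp only [Finset.sum_const, smul_eq_mul, mul_one]
    rw [h.1, hX.1]
    omega
  · have h0 := sum_Eg (fun y => y) S a w X hS
    rw [Finset.sum_add_distrib, Finset.sum_add_distrib, Finset.sum_const, Finset.sum_const, smul_eq_mul, smul_eq_mul] at h0
    rw [h0, hX.1]
    have h2 := hX.2
    generalize (Finset.range w \ S).card = p at *
    generalize ∑ y ∈ S, y = s at *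
    generalize ∑ y ∈ X, y = t at *
    generalize ∑ y ∈ Finset.range w \ S, y = q at *
    generalize ∑ y ∈ Finset.range w, y = r at *
    subst c1
    subst c2
    nlinarith

theorem gen_range (w : ℕ) : (1 - T 1) * gen (Finset.range w) = 1 - T (w : ℤ) := by
  induction w with
  | zero => simp [gen]
  | succ w ih =>
    rw [gen] at *
    rw [Finset.sum_range_succ, mul_add, ih, Nat.cast_succ, T_add]
    ring

theorem pol_Eg (S : Finset ℕ) (a w : ℕ) (X : Finset ℕ) (hS : S ⊆ Finset.range a)
    (hw : S ⊆ Finset.range w) :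
    pol (Eg S a w X) = (1 - T (a : ℤ)) * pol S + T (a : ℤ) * T (w : ℤ) * pol X := by
  have c2 : ∑ y ∈ Finset.range w \ S, T (R := ℤ) (y : ℤ) = gen (Finset.range w) - gen S := by
    rw [eq_sub_iff_add_eq]
    exact Finset.sum_sdiff hw
  have h1 : gen (Eg S a w X) = gen S + (T (a : ℤ) * (gen (Finset.range w) - gen S) +
      T (a : ℤ) * T (w : ℤ) * gen X) := by
    rw [gen, sum_Eg _ _ _ _ _ hS, ← c2]
    push_cast
    simp only [T_add, ← Finset.mul_sum]
    rfl
  rw [pol, pol, pol, h1]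
  linear_combination (- T (a : ℤ)) * gen_range w

theorem acr_mul (S S' : Finset ℕ) (Z : ℤ[T;T⁻¹]) (h : pol S' = Z * pol S) :
    acr S' = Z * invert Z * acr S := by
  rw [acr, acr, h, map_mul]
  ring

/-- First building block. -/
def F0 (c : ℕ) (S : Finset ℕ) : Finset ℕ := Eg S c (2 * c) S

/-- Second building block. -/
def F1 (c : ℕ) (S : Finset ℕ) : Finset ℕ := Eg ∅ 0 c (Eg S (2 * c) c S)

/-- Final building block. -/
def FT (c w u : ℕ) (S : Finset ℕ) : Finset ℕ := Eg S c w (Eg S (c + 1) u S)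

theorem sub_mono {S : Finset ℕ} {c d : ℕ} (h : S ⊆ Finset.range c) (hcd : c ≤ d) :
    S ⊆ Finset.range d := h.trans (Finset.range_mono hcd)

theorem inv_F0 (c k n : ℕ) (S : Finset ℕ) (hS : S ⊆ Finset.range c) (h : BInv S k n) :
    BInv (F0 c S) (k + 2 * c) (n + 2 * c ^ 2) := by
  have := inv_Eg S c (2 * c) k n 0 n S hS (sub_mono hS (by omega)) h h
  have e : n + 2 * c ^ 2 = n + c * (2 * c + 0) := by ring
  rw [e]
  exact this

theorem inv_F1 (c k n : ℕ) (S : Finset ℕ) (hS : S ⊆ Finset.range c) (h : BInv S k n) :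
    BInv (F1 c S) (k + 2 * c) (n + 2 * c ^ 2) := by
  have h1 := inv_Eg S (2 * c) c k n 0 n S (sub_mono hS (by omega)) hS h h
  have h2 := inv_Eg ∅ 0 c 0 0 (k + 0 + c) _ _ (by simp) (by simp) (by simp [BInv])
    (by rw [zero_add]; exact h1)
  have e1 : k + 2 * c = 0 + (k + 0 + c) + c := by ring
  have e2 : n + 2 * c ^ 2 = n + 2 * c * (c + 0) + 0 * (c + (k + 0 + c)) := by ring
  rw [e1, e2]
  exact h2

theorem inv_FT (c w u k n : ℕ) (S : Finset ℕ) (hS : S ⊆ Finset.range c) (hw : c ≤ w) (hu : c ≤ u)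
    (h : BInv S k n) : BInv (FT c w u S) (k + u + w) (n + c * w + (2 * c + 1) * u) := by
  have h1 := inv_Eg S (c + 1) u k n 0 n S (sub_mono hS (by omega)) (sub_mono hS hu) h h
  have h2 := inv_Eg S c w k n u _ _ hS (sub_mono hS hw) h h1
  have e : n + c * w + (2 * c + 1) * u = n + (c + 1) * (u + 0) + c * (w + u) := by ring
  rw [e]
  exact h2

theorem acr_F (c : ℕ) (S : Finset ℕ) (hS : S ⊆ Finset.range c) :
    acr (F0 c S) = acr (F1 c S) := by
  set u : ℤ[T;T⁻¹] := T (c : ℤ) with hu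
  set v : ℤ[T;T⁻¹] := T (-(c : ℤ)) with hv
  have huv : u * v = 1 := by rw [hu, hv, ← T_add, add_neg_cancel, T_zero]
  have hu2 : T ((2 * c : ℕ) : ℤ) = u ^ 2 := by rw [hu, T_pow]; push_cast; rfl
  have hi : invert u = v := by rw [hu, invert_T]
  have p0 : pol (F0 c S) = (1 - u + u ^ 3) * pol S := by
    rw [F0, pol_Eg _ _ _ _ hS (sub_mono hS (by omega)), hu2]
    ring
  have p1 : pol (F1 c S) = (u - u ^ 3 + u ^ 4) * pol S := by
    rw [F1, pol_Eg _ _ _ _ (by simp) (by simp), pol_Eg _ _ _ _ (sub_mono hS (by omega)) hS, hu2]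
    simp only [Nat.cast_zero, T_zero]
    ring
  rw [acr_mul _ _ _ p0, acr_mul _ _ _ p1]
  simp only [map_add, map_sub, map_one, map_pow, hi]
  congr 1
  have e1 : u - u ^ 3 + u ^ 4 = u ^ 4 * (1 - v + v ^ 3) := by
    linear_combination (u ^ 3 - u * (u ^ 2 * v ^ 2 + u * v + 1)) * huv
  have e2 : v - v ^ 3 + v ^ 4 = v ^ 4 * (1 - u + u ^ 3) := by
    linear_combination (v ^ 3 - v * (u ^ 2 * v ^ 2 + u * v + 1)) * huv
  have e3 : u ^ 4 * v ^ 4 = 1 := by rw [← mul_pow, huv, one_pow]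
  rw [e1, e2]
  linear_combination (-(1 - u + u ^ 3) * (1 - v + v ^ 3)) * e3

theorem acr_F0 (c : ℕ) (S S' : Finset ℕ) (hS : S ⊆ Finset.range c) (hS' : S' ⊆ Finset.range c)
    (h : acr S = acr S') : acr (F0 c S) = acr (F0 c S') := by
  have p : ∀ S, S ⊆ Finset.range c →
      pol (F0 c S) = (1 - T (c : ℤ) + T (c : ℤ) * T ((2 * c : ℕ) : ℤ)) * pol S := by
    intro S hS
    rw [F0, pol_Eg _ _ _ _ hS (sub_mono hS (by omega))]
    ring
  rw [acr_mul _ _ _ (p S hS), acr_mul _ _ _ (p S' hS'), h]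

theorem acr_FT (c w u : ℕ) (hw : c ≤ w) (hu : c ≤ u) (S S' : Finset ℕ) (hS : S ⊆ Finset.range c)
    (hS' : S' ⊆ Finset.range c) (h : acr S = acr S') : acr (FT c w u S) = acr (FT c w u S') := by
  have p : ∀ S, S ⊆ Finset.range c →
      pol (FT c w u S) = (1 - T (c : ℤ) + T (c : ℤ) * T (w : ℤ) *
        (1 - T ((c + 1 : ℕ) : ℤ) + T ((c + 1 : ℕ) : ℤ) * T (u : ℤ))) * pol S := by
    intro S hS
    rw [FT, pol_Eg _ _ _ _ hS (sub_mono hS hw),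
      pol_Eg _ _ _ _ (sub_mono hS (by omega)) (sub_mono hS hu)]
    ring
  rw [acr_mul _ _ _ (p S hS), acr_mul _ _ _ (p S' hS'), h]

theorem F0_inj (c : ℕ) (S S' : Finset ℕ) (hS : S ⊆ Finset.range c) (hS' : S' ⊆ Finset.range c)
    (h : F0 c S = F0 c S') : S = S' := by
  ext x
  by_cases hx : x < c
  · rw [← Eg_lt S c (2 * c) S x hx, ← Eg_lt S' c (2 * c) S' x hx]
    exact iff_of_eq (congrArg (fun X => x ∈ X) h)
  · have h1 : x ∉ S := fun h => hx (Finset.mem_range.1 (hS h))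
    have h2 : x ∉ S' := fun h => hx (Finset.mem_range.1 (hS' h))
    simp [h1, h2]

theorem FT_inj (c w u : ℕ) (S S' : Finset ℕ) (hS : S ⊆ Finset.range c) (hS' : S' ⊆ Finset.range c)
    (h : FT c w u S = FT c w u S') : S = S' := by
  ext x
  by_cases hx : x < c
  · rw [← Eg_lt S c w (Eg S (c + 1) u S) x hx, ← Eg_lt S' c w (Eg S' (c + 1) u S') x hx]
    exact iff_of_eq (congrArg (fun X => x ∈ X) h)
  · have h1 : x ∉ S := fun h => hx (Finset.mem_range.1 (hS h))
    have h2 : x ∉ S' := fun h => hx (Finset.mem_range.1 (hS' h))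
    simp [h1, h2]

theorem F1_low (c : ℕ) (S : Finset ℕ) (x : ℕ) (hx : x < c) : x ∈ F1 c S := by
  rw [F1, mem_Eg]
  right; left
  simp [hx]

theorem F1_mid (c : ℕ) (S : Finset ℕ) (x : ℕ) (hx : x < c) : c + x ∈ F1 c S ↔ x ∈ S := by
  rw [F1, mem_Eg, ← Eg_lt S (2 * c) c S x (by omega)]
  simp

theorem F1_inj (c : ℕ) (S S' : Finset ℕ) (hS : S ⊆ Finset.range c) (hS' : S' ⊆ Finset.range c)
    (h : F1 c S = F1 c S') : S = S' := by
  ext x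
  by_cases hx : x < c
  · rw [← F1_mid c S x hx, ← F1_mid c S' x hx, h]
  · have h1 : x ∉ S := fun h => hx (Finset.mem_range.1 (hS h))
    have h2 : x ∉ S' := fun h => hx (Finset.mem_range.1 (hS' h))
    simp [h1, h2]

theorem F0_ne_F1 (c : ℕ) (S S' : Finset ℕ) (hc : S.card < c) : F0 c S ≠ F1 c S' := by
  intro h
  have : Finset.range c ⊆ S := by
    intro x hx
    have hx := Finset.mem_range.1 hx
    have h1 := F1_low c S' x hx
    rw [← h] at h1
    exact (Eg_lt S c (2 * c) S x hx).1 h1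
  have := Finset.card_le_card this
  rw [Finset.card_range] at this
  omega

theorem family (m : ℕ) : ∃ (Fa : Finset (Finset ℕ)) (k n : ℕ), 2 * k + 1 = 5 ^ m ∧
    12 * n + 1 = 25 ^ m ∧ Fa.card = 2 ^ m ∧ (∀ S ∈ Fa, S ⊆ Finset.range (5 ^ m) ∧ BInv S k n) ∧
    ∀ S ∈ Fa, ∀ S' ∈ Fa, acr S = acr S' := by
  classical
  induction m with
  | zero => exact ⟨{∅}, 0, 0, by simp, by simp, by simp, by simp [BInv], by simp⟩
  | succ m ih =>
    obtain ⟨Fa, k, n, hk, hn, hcard, hFa, hacr⟩ := ih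
    set c := 5 ^ m with hc
    have hc2 : 25 ^ m = c ^ 2 := by rw [hc, ← pow_mul, mul_comm, pow_mul]; norm_num
    refine ⟨Fa.image (F0 c) ∪ Fa.image (F1 c), k + 2 * c, n + 2 * c ^ 2, ?_, ?_, ?_, ?_, ?_⟩
    · rw [pow_succ]; omega
    · rw [pow_succ 25 m, hc2]; rw [hc2] at hn; omega
    · rw [Finset.card_union_of_disjoint, Finset.card_image_of_injOn, Finset.card_image_of_injOn,
        hcard, pow_succ]
      · ring
      · intro S hS S' hS' h
        exact F1_inj c S S' (hFa S hS).1 (hFa S' hS').1 h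
      · intro S hS S' hS' h
        exact F0_inj c S S' (hFa S hS).1 (hFa S' hS').1 h
      · rw [Finset.disjoint_left]
        intro X hX hX'
        obtain ⟨S, hS, rfl⟩ := Finset.mem_image.1 hX
        obtain ⟨S', hS', h⟩ := Finset.mem_image.1 hX'
        refine F0_ne_F1 c S S' ?_ h.symm
        rw [(hFa S hS).2.1]
        omega
    · intro X hX
      rw [Finset.mem_union, Finset.mem_image, Finset.mem_image] at hX
      rcases hX with ⟨S, hS, rfl⟩ | ⟨S, hS, rfl⟩
      · obtain ⟨h1, h2⟩ := hFa S hS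
        refine ⟨?_, inv_F0 c k n S h1 h2⟩
        refine sub_mono (Eg_sub S c (2 * c) c S h1 h1) ?_
        rw [pow_succ]; omega
      · obtain ⟨h1, h2⟩ := hFa S hS
        refine ⟨?_, inv_F1 c k n S h1 h2⟩
        refine sub_mono (Eg_sub ∅ 0 c _ _ (by simp)
          (Eg_sub S (2 * c) c c S (sub_mono h1 (by omega)) h1)) ?_
        rw [pow_succ]; omega
    · have key : ∀ X ∈ Fa.image (F0 c) ∪ Fa.image (F1 c), ∃ S ∈ Fa, acr X = acr (F0 c S) := by
        intro X hX
        rw [Finset.mem_union, Finset.mem_image, Finset.mem_image] at hX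
        rcases hX with ⟨S, hS, rfl⟩ | ⟨S, hS, rfl⟩
        · exact ⟨S, hS, rfl⟩
        · exact ⟨S, hS, (acr_F c S (hFa S hS).1).symm⟩
      intro X hX X' hX'
      obtain ⟨S, hS, e⟩ := key X hX
      obtain ⟨S', hS', e'⟩ := key X' hX'
      rw [e, e']
      exact acr_F0 c S S' (hFa S hS).1 (hFa S' hS').1 (hacr S hS S' hS')

end Family

theorem maxMult_pow (m N : ℕ) (hN : 8 * 25 ^ m ≤ N) : 2 ^ m ≤ maxMult (Equiv.Perm (Fin N)) := by
  obtain ⟨Fa, k, n, hk, hn, hcard, hFa, hacr⟩ := family m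
  set c := 5 ^ m with hc
  have hc2 : 25 ^ m = c ^ 2 := by rw [hc, ← pow_mul, mul_comm, pow_mul]; norm_num
  have hcpos : 1 ≤ c := Nat.one_le_pow _ _ (by norm_num)
  rw [hc2] at hN hn
  have hcc : c ≤ c ^ 2 := by nlinarith
  obtain ⟨p, rfl⟩ : ∃ p, N = p + 1 := ⟨N - 1, by omega⟩
  set M := p + 1 - n with hM
  set u := c + M % c with hu
  have huc : u < 2 * c := by have := Nat.mod_lt M hcpos; omega
  have hbig : (2 * c + 1) * u + c * c ≤ M := by
    have e1 : 7 * c ^ 2 ≤ M := by omega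
    have e2 : (2 * c + 1) * u ≤ (2 * c + 1) * (2 * c) := Nat.mul_le_mul_left _ huc.le
    nlinarith
  obtain ⟨w, hw⟩ : c ∣ M - (2 * c + 1) * u := by
    have h1 : M - (2 * c + 1) * u = c * (M / c) - c * (2 * u + 1) := by
      have := Nat.div_add_mod M c
      have e : (2 * c + 1) * u = c * (2 * u + 1) + M % c := by rw [hu]; ring
      omega
    rw [h1]
    exact Nat.dvd_sub (dvd_mul_right _ _) (dvd_mul_right _ _)
  have hwc : c ≤ w := by
    have : c * c ≤ c * w := by omega
    exact Nat.le_of_mul_le_mul_left this hcpos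
  have hcuw : n + c * w + (2 * c + 1) * u = p + 1 := by omega
  have hI : ∀ S ∈ Fa, BInv (FT c w u S) (k + u + w) (p + 1) := fun S hS => by
    rw [← hcuw]
    exact inv_FT c w u k n S (hFa S hS).1 hwc (by omega) (hFa S hS).2
  have := maxMult_ge_s6 p (k + u + w) (ι := {S // S ∈ Fa}) (fun S => FT c w u S.1) ?_ ?_ ?_ ?_
  · rwa [Fintype.card_coe, hcard] at this
  · rintro ⟨S, hS⟩ ⟨S', hS'⟩ h
    exact Subtype.ext (FT_inj c w u S S' (hFa S hS).1 (hFa S' hS').1 h)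
  · rintro ⟨S, hS⟩
    exact (hI S hS).1
  · rintro ⟨S, hS⟩
    have h1 := (hI S hS).2
    have h2 := two_sum_range (k + u + w)
    show ∑ y ∈ FT c w u S, y = _
    omega
  · rintro ⟨S, hS⟩ ⟨S', hS'⟩
    exact Hk_of_acr _ _ (acr_FT c w u hwc (by omega) S S' (hFa S hS).1 (hFa S' hS').1
      (hacr S hS S' hS'))

theorem stmt6 :
    ∃ n₀ : ℕ, ∀ n : ℕ, n₀ ≤ n →
      (n : ℝ) ^ ((1 : ℝ) / 7) ≤ (maxMult (Equiv.Perm (Fin n)) : ℝ) := by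
  refine ⟨8 * 25 ^ 4, fun n hn => ?_⟩
  have hn8 : 25 ^ 4 ≤ n / 8 := by omega
  set m := Nat.log 25 (n / 8) with hm
  have h1 : 25 ^ m ≤ n / 8 := Nat.pow_log_le_self 25 (by omega)
  have h2 : n / 8 < 25 ^ (m + 1) := Nat.lt_pow_succ_log_self (by norm_num) _
  have hm4 : 4 ≤ m := Nat.le_log_of_pow_le (by norm_num) hn8
  have h3 := maxMult_pow m n (by omega)
  clear_value m
  have h4 : n ≤ (2 ^ m) ^ 7 := by
    obtain ⟨j, rfl⟩ : ∃ j, m = j + 4 := ⟨m - 4, by omega⟩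
    have e1 : (2 ^ (j + 4)) ^ 7 = 128 ^ j * 268435456 := by
      rw [← pow_mul, mul_comm, pow_mul, pow_add]; norm_num
    have e2 : 25 ^ j ≤ 128 ^ j := Nat.pow_le_pow_left (by norm_num) j
    have e3 : 25 ^ (j + 4 + 1) = 25 ^ j * 9765625 := by rw [pow_add, pow_add]; ring
    omega
  calc (n : ℝ) ^ ((1 : ℝ) / 7) ≤ (((2 : ℝ) ^ m) ^ 7) ^ ((1 : ℝ) / 7) := by
        refine Real.rpow_le_rpow (by positivity) ?_ (by norm_num)
        exact_mod_cast h4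
    _ = 2 ^ m := by
        have := Real.pow_rpow_inv_natCast (x := (2 : ℝ) ^ m) (n := 7) (by positivity) (by norm_num)
        rw [one_div]
        exact_mod_cast this
    _ ≤ _ := by exact_mod_cast h3
end
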